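/- arXiv:1708.03823 — 5 statements merged into one kernel-verified Lean document; each statement's English description precedes it below -/
import Mathlib

section
/- A Banach space E is 1-separably injective if and only if E is a 1-complemented subspace of some Banach space of universal disposition for separable spaces; that is, if and only if there exist a Banach space U of 𝒮-universal disposition, a linear isometric embedding j : E → U, and a bounded linear operator P : U → E with ‖P‖ ≤ 1 and P ∘ j = id_E. -/
/-- A bundled Banach space over `ℝ`. -/
structure BanachSpace : Type (u + 1) where
  carrier : Type u
  [norm : NormedAddCommGroup carrier]
  [space : NormedSpace ℝ carrier]
  [complete : CompleteSpace carrier]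

attribute [instance] BanachSpace.norm BanachSpace.space BanachSpace.complete

instance : CoeSort BanachSpace.{u} (Type u) := ⟨BanachSpace.carrier⟩

/-- `E` is `1`-separably injective: for every separable Banach space `B` and closed subspace
`A ⊆ B`, every operator `t : A → E` extends to `T : B → E` with `‖T‖ ≤ ‖t‖`. -/
def IsSeparablyInjective1 (E : BanachSpace.{u}) : Prop :=
  ∀ B : BanachSpace.{u}, TopologicalSpace.SeparableSpace B.carrier →
    ∀ A : Submodule ℝ B.carrier, IsClosed (A : Set B.carrier) →
      ∀ t : A →L[ℝ] E.carrier, ∃ T : B.carrier →L[ℝ] E.carrier,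
        (∀ a : A, T (a : B.carrier) = t a) ∧ ‖T‖ ≤ ‖t‖

/-- `U` is of universal disposition for separable Banach spaces. -/
def IsUnivDispSeparable (U : BanachSpace.{u}) : Prop :=
  ∀ A B : BanachSpace.{u}, TopologicalSpace.SeparableSpace A.carrier →
    TopologicalSpace.SeparableSpace B.carrier →
    ∀ (u : A.carrier →ₗᵢ[ℝ] U.carrier) (i : A.carrier →ₗᵢ[ℝ] B.carrier),
      ∃ u' : B.carrier →ₗᵢ[ℝ] U.carrier, ∀ a : A.carrier, u' (i a) = u a

namespace SepInj
open scoped ENNReal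

section Ext
variable {X G F : Type*} [AddCommGroup X] [Module ℝ X] [NormedAddCommGroup G] [NormedSpace ℝ G]
  [NormedAddCommGroup F] [NormedSpace ℝ F]

theorem mem_tc (e : X →ₗ[ℝ] G) (x : X) : e x ∈ (LinearMap.range e).topologicalClosure :=
  Submodule.le_topologicalClosure _ (LinearMap.mem_range_self e x)

theorem closed_ext [CompleteSpace F] (e : X →ₗ[ℝ] G) (L : X →ₗ[ℝ] F)
    (h : ∀ x, ‖L x‖ ≤ ‖e x‖) :
    ∃ T : (LinearMap.range e).topologicalClosure →L[ℝ] F, ‖T‖ ≤ 1 ∧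
      ∀ x, T ⟨e x, mem_tc e x⟩ = L x := by
  let e' : X →ₗ[ℝ] (LinearMap.range e).topologicalClosure :=
    e.codRestrict _ (mem_tc e)
  have hd : DenseRange e' := by
    intro y
    have hy : (y : G) ∈ closure (LinearMap.range e : Set G) := y.2
    rw [closure_subtype]
    convert! hy using 2
    ext z
    constructor
    · rintro ⟨_, ⟨x, rfl⟩, rfl⟩
      exact ⟨x, rfl⟩
    · rintro ⟨x, rfl⟩
      exact ⟨e' x, ⟨x, rfl⟩, rfl⟩
  have hn : ∀ x, ‖L x‖ ≤ 1 * ‖e' x‖ := fun x => by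
    rw [one_mul]; exact h x
  exact ⟨L.extendOfNorm e', LinearMap.opNorm_extendOfNorm_le hd zero_le_one hn,
    fun x => LinearMap.extendOfNorm_eq hd ⟨1, hn⟩ x⟩

theorem hb (e : X →ₗ[ℝ] G) (L : X →ₗ[ℝ] ℝ) (h : ∀ x, |L x| ≤ ‖e x‖) :
    ∃ g : G →L[ℝ] ℝ, ‖g‖ ≤ 1 ∧ ∀ x, g (e x) = L x := by
  obtain ⟨T, hT, hTe⟩ := closed_ext e L h
  obtain ⟨g, hg, hn⟩ := exists_extension_norm_eq (𝕜 := ℝ) _ T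
  exact ⟨g, hn.trans_le hT, fun x => by rw [← hTe, ← hg]⟩

theorem abs_le_of_norm_le_one (g : G →L[ℝ] ℝ) (hg : ‖g‖ ≤ 1) (x : G) : |g x| ≤ ‖x‖ := by
  simpa using g.le_of_opNorm_le hg x

/-- The map into `ℓ∞` given by a pointwise bounded family of functionals. -/
noncomputable def lpMap {Φ : Type*} (f : Φ → X →ₗ[ℝ] ℝ) (N : X → ℝ)
    (h : ∀ φ x, |f φ x| ≤ N x) : X →ₗ[ℝ] lp (fun _ : Φ => ℝ) ∞ where
  toFun x := ⟨fun φ => f φ x, memℓp_infty ⟨N x, by rintro _ ⟨φ, rfl⟩; exact h φ x⟩⟩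
  map_add' x y := by ext φ; simp; rfl
  map_smul' c x := by ext φ; simp

theorem lpMap_apply {Φ : Type*} (f : Φ → X →ₗ[ℝ] ℝ) (N : X → ℝ)
    (h : ∀ φ x, |f φ x| ≤ N x) (x : X) (φ : Φ) : lpMap f N h x φ = f φ x := rfl

theorem lp_apply_le {Φ : Type*} (z : lp (fun _ : Φ => ℝ) ∞) (φ : Φ) : |z φ| ≤ ‖z‖ :=
  lp.norm_apply_le_norm (by simp) z φ

theorem lp_eval {Φ : Type*} (φ : Φ) :
    ∃ g : lp (fun _ : Φ => ℝ) ∞ →ₗ[ℝ] ℝ, ∀ z, g z = z φ :=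
  ⟨{ toFun := fun z => z φ, map_add' := fun x y => by simp, map_smul' := fun c x => by simp },
    fun _ => rfl⟩

end Ext

/-- universal disposition implies 1-separable injectivity -/
theorem univDisp_sepInj (U : BanachSpace.{u}) (hU : IsUnivDispSeparable U) :
    IsSeparablyInjective1 U := by
  intro B hB A hA t
  let Φ : Type u := {p : (B.carrier →L[ℝ] ℝ) × (U.carrier →L[ℝ] ℝ) //
    ‖p.1‖ ≤ ‖t‖ ∧ ‖p.2‖ ≤ 1 ∧ ∀ a : A, p.1 a = p.2 (t a)}
  let jB : B.carrier →ₗ[ℝ] lp (fun _ : Φ => ℝ) ∞ :=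
    lpMap (fun φ => φ.1.1.toLinearMap) (fun x => ‖t‖ * ‖x‖)
      (fun φ x => φ.1.1.le_of_opNorm_le φ.2.1 x)
  have jB_norm : ∀ x, ‖jB x‖ ≤ ‖t‖ * ‖x‖ := fun x =>
    lp.norm_le_of_forall_le (by positivity) (fun φ => φ.1.1.le_of_opNorm_le φ.2.1 x)
  let jU : U.carrier →ₗ[ℝ] lp (fun _ : Φ => ℝ) ∞ :=
    lpMap (fun φ => φ.1.2.toLinearMap) (fun x => ‖x‖)
      (fun φ x => abs_le_of_norm_le_one φ.1.2 φ.2.2.1 x)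
  have jU_norm : ∀ x, ‖jU x‖ = ‖x‖ := by
    intro x
    apply le_antisymm
    · exact lp.norm_le_of_forall_le (by positivity)
        (fun φ => abs_le_of_norm_le_one φ.1.2 φ.2.2.1 x)
    · obtain ⟨g, hg, hgx⟩ := exists_dual_vector'' ℝ x
      obtain ⟨f, hf, hfn⟩ := exists_extension_norm_eq (𝕜 := ℝ) A (g.comp t)
      have hfn' : ‖f‖ ≤ ‖t‖ := by
        rw [hfn]
        refine (ContinuousLinearMap.opNorm_comp_le _ _).trans ?_
        exact mul_le_of_le_one_left (norm_nonneg _) hg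
      let φ : Φ := ⟨(f, g), hfn', hg, fun a => hf a⟩
      have := lp_apply_le (jU x) φ
      have h2 : jU x φ = ‖x‖ := hgx
      rw [h2] at this
      exact (le_abs_self _).trans this
  have jBU : ∀ a : A, jB a = jU (t a) := by
    intro a
    ext φ
    exact φ.2.2.2 a
  let S := (LinearMap.range t.toLinearMap).topologicalClosure
  let W : Submodule ℝ (lp (fun _ : Φ => ℝ) ∞) :=
    (Submodule.span ℝ (Set.range jB ∪ jU '' S)).topologicalClosure
  have hA' : TopologicalSpace.SeparableSpace A := inferInstance
  have hS : TopologicalSpace.IsSeparable (S : Set U.carrier) := by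
    have : TopologicalSpace.IsSeparable (Set.range t) :=
      TopologicalSpace.isSeparable_range t.continuous
    exact this.closure
  have jUc : Continuous jU := AddMonoidHomClass.continuous_of_bound jU 1 (by simp [jU_norm])
  have jBc : Continuous jB := AddMonoidHomClass.continuous_of_bound jB ‖t‖ jB_norm
  have hW : TopologicalSpace.IsSeparable (W : Set (lp (fun _ : Φ => ℝ) ∞)) := by
    refine TopologicalSpace.IsSeparable.closure ?_
    exact ((TopologicalSpace.isSeparable_range jBc).union (hS.image jUc)).span
  let BS : BanachSpace.{u} := { carrier := S, complete := (Submodule.isClosed_topologicalClosure _).completeSpace_coe }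
  let BW : BanachSpace.{u} := { carrier := W, complete := (Submodule.isClosed_topologicalClosure _).completeSpace_coe }
  have h1 : ∀ s : S, jU s ∈ W := fun s => Submodule.le_topologicalClosure _
    (Submodule.subset_span (Or.inr ⟨s, s.2, rfl⟩))
  have h2 : ∀ b, jB b ∈ W := fun b => Submodule.le_topologicalClosure _
    (Submodule.subset_span (Or.inl ⟨b, rfl⟩))
  let i : S →ₗᵢ[ℝ] W :=
    { toLinearMap := (jU.comp S.subtype).codRestrict W h1
      norm_map' := fun s => jU_norm s }
  obtain ⟨u', hu'⟩ := hU BS BW hS.separableSpace hW.separableSpace S.subtypeₗᵢ i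
  let kB : B.carrier →L[ℝ] W := (jB.codRestrict W h2).mkContinuous ‖t‖ jB_norm
  refine ⟨(show W →ₗᵢ[ℝ] U.carrier from u').toContinuousLinearMap.comp kB, ?_, ?_⟩
  · intro a
    have hta : t a ∈ S := Submodule.le_topologicalClosure _ ⟨a, rfl⟩
    refine Eq.trans ?_ (hu' (⟨t a, hta⟩ : S))
    show u' (kB a) = _
    congr 1
    exact Subtype.ext (jBU a)
  · refine ContinuousLinearMap.opNorm_le_bound _ t.opNorm_nonneg fun x => ?_
    refine (u'.norm_map (kB x)).trans_le ?_
    exact jB_norm x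

theorem easy_dir (E U : BanachSpace.{u}) (hU : IsUnivDispSeparable U)
    (j : E.carrier →ₗᵢ[ℝ] U.carrier) (P : U.carrier →L[ℝ] E.carrier) (hP : ‖P‖ ≤ 1)
    (hPj : ∀ x, P (j x) = x) : IsSeparablyInjective1 E := by
  intro B hB A hA t
  obtain ⟨T, hT, hTn⟩ := univDisp_sepInj U hU B hB A hA (j.toContinuousLinearMap.comp t)
  refine ⟨P.comp T, fun a => by simp [hT, hPj], ?_⟩
  refine (ContinuousLinearMap.opNorm_comp_le _ _).trans ?_
  refine (mul_le_of_le_one_left (norm_nonneg _) hP).trans (hTn.trans ?_)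
  refine ContinuousLinearMap.opNorm_le_bound _ t.opNorm_nonneg fun x => ?_
  simpa using t.le_opNorm x

/-- finitely supported sequences -/
abbrev C00 : Type := (ℕ ⊕ ℕ) →₀ ℝ

/-- Names of the elements of the space to be constructed. -/
inductive Tm (E : Type u) : Type u
  | ofE (x : E) : Tm E
  | node (N : Seminorm ℝ C00) (τ : ℕ → Tm E) (k : ℕ) : Tm E

noncomputable def el (n : ℕ) : C00 := Finsupp.single (Sum.inl n) 1
noncomputable def er (n : ℕ) : C00 := Finsupp.single (Sum.inr n) 1

section Build
variable {E : Type u} [NormedAddCommGroup E] [NormedSpace ℝ E]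

/-- structural recursion -/
def Tm.rc {V : Type*} (f : E → V) (Ψ : Seminorm ℝ C00 → (ℕ → Tm E) → (ℕ → V) → ℕ → V) : Tm E → V
  | .ofE x => f x
  | .node N τ k => Ψ N τ (fun n => Tm.rc f Ψ (τ n)) k

/-- `w` extends to a contraction on `C00` -/
def Pre {V : Type*} [NormedAddCommGroup V] [NormedSpace ℝ V] (N : Seminorm ℝ C00) (w : ℕ → V) :
    Prop :=
  ∃ ψ : C00 →ₗ[ℝ] V, (∀ c, ‖ψ c‖ ≤ N c) ∧ ∀ n, ψ (el n) = w n

def Cond {V : Type*} [NormedAddCommGroup V] [NormedSpace ℝ V] (p : Tm E → V)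
    (N : Seminorm ℝ C00) (τ : ℕ → Tm E) : Prop :=
  ∃ ψ : C00 →ₗ[ℝ] V, (∀ c, ‖ψ c‖ ≤ N c) ∧ (∀ n, ψ (el n) = p (τ n)) ∧
    ∀ k, ψ (er k) = p (.node N τ k)

def KS (S : Set (Seminorm ℝ C00 × (ℕ → Tm E))) : Set (Tm E → ℝ) :=
  {φ | (∃ f : E →L[ℝ] ℝ, ‖f‖ ≤ 1 ∧ ∀ x, φ (.ofE x) = f x) ∧
    (∀ N τ k, |φ (.node N τ k)| ≤ N (er k)) ∧
    ∀ N τ, (N, τ) ∈ S → Cond φ N τ}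

theorem KS_anti {S T : Set (Seminorm ℝ C00 × (ℕ → Tm E))} (h : S ⊆ T) : KS T ⊆ KS S :=
  fun _ hφ => ⟨hφ.1, hφ.2.1, fun N τ hN => hφ.2.2 N τ (h hN)⟩

/-- the monotone operator whose least fixed point is the set of admissible data -/
def opG (E : Type u) [NormedAddCommGroup E] [NormedSpace ℝ E] :
    Set (Seminorm ℝ C00 × (ℕ → Tm E)) →o Set (Seminorm ℝ C00 × (ℕ → Tm E)) where
  toFun S := {q | ∀ φ ∈ KS S, Pre q.1 (fun n => φ (q.2 n))}
  monotone' := fun _ _ h _ hq φ hφ => hq φ (KS_anti h hφ)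

def GG (E : Type u) [NormedAddCommGroup E] [NormedSpace ℝ E] :
    Set (Seminorm ℝ C00 × (ℕ → Tm E)) := (opG E).lfp

def K (E : Type u) [NormedAddCommGroup E] [NormedSpace ℝ E] : Set (Tm E → ℝ) := KS (GG E)

theorem GG_of {N : Seminorm ℝ C00} {τ : ℕ → Tm E} (h : ∀ φ ∈ K E, Pre N (fun n => φ (τ n))) :
    (N, τ) ∈ GG E := by
  have : opG E (GG E) = GG E := (opG E).map_lfp
  rw [← this]
  exact h

theorem GG_pre {N : Seminorm ℝ C00} {τ : ℕ → Tm E} (h : (N, τ) ∈ GG E) :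
    ∀ φ ∈ K E, Pre N (fun n => φ (τ n)) := by
  have : opG E (GG E) = GG E := (opG E).map_lfp
  rw [← this] at h
  exact h

/-- induction principle -/
theorem GG_ind (S : Set (Seminorm ℝ C00 × (ℕ → Tm E)))
    (h : ∀ N τ, (N, τ) ∈ GG E → (∀ φ ∈ KS (GG E ∩ S), Pre N (fun n => φ (τ n))) → (N, τ) ∈ S) :
    GG E ⊆ S := by
  have : GG E ⊆ GG E ∩ S := by
    apply (opG E).lfp_le
    rintro ⟨N, τ⟩ hq
    have h1 : (N, τ) ∈ GG E := GG_of fun φ hφ => hq φ (KS_anti Set.inter_subset_left hφ)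
    exact ⟨h1, h N τ h1 hq⟩
  exact fun q hq => (this hq).2

noncomputable def bd : Tm E → ℝ
  | .ofE x => ‖x‖
  | .node N _ k => N (er k)

theorem K_bd {φ : Tm E → ℝ} (hφ : φ ∈ K E) (t : Tm E) : |φ t| ≤ bd t := by
  cases t with
  | ofE x =>
    obtain ⟨f, hf, h⟩ := hφ.1
    rw [h]; exact abs_le_of_norm_le_one f hf x
  | node N τ k => exact hφ.2.1 N τ k

abbrev LI (E : Type u) [NormedAddCommGroup E] [NormedSpace ℝ E] : Type u :=
  lp (fun _ : K E => ℝ) ∞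

noncomputable def ev (t : Tm E) : LI E :=
  ⟨fun φ => φ.1 t, memℓp_infty ⟨bd t, by rintro _ ⟨φ, rfl⟩; exact K_bd φ.2 t⟩⟩

theorem ev_apply (t : Tm E) (φ : K E) : ev t φ = φ.1 t := rfl

theorem ext_of_eval {X : Type*} [AddCommGroup X] [Module ℝ X] {φ : K E} {a : X →ₗ[ℝ] LI E} :
    ∃ g : X →ₗ[ℝ] ℝ, ∀ x, g x = a x φ := by
  obtain ⟨g, hg⟩ := lp_eval φ
  exact ⟨g.comp a, fun x => hg _⟩

noncomputable def lc (E : Type u) [NormedAddCommGroup E] [NormedSpace ℝ E] :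
    (Tm E →₀ ℝ) →ₗ[ℝ] LI E := Finsupp.linearCombination ℝ ev

/-- the space -/
noncomputable def UU (E : Type u) [NormedAddCommGroup E] [NormedSpace ℝ E] :
    Submodule ℝ (LI E) := (LinearMap.range (lc E)).topologicalClosure

theorem ev_mem (t : Tm E) : ev t ∈ UU E :=
  Submodule.le_topologicalClosure _ ⟨Finsupp.single t 1, by simp [lc]⟩

theorem c00_hom_ext {V : Type*} [AddCommGroup V] [Module ℝ V] {f g : C00 →ₗ[ℝ] V}
    (hl : ∀ n, f (el n) = g (el n)) (hr : ∀ n, f (er n) = g (er n)) : f = g := by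
  apply Finsupp.lhom_ext'
  rintro (n | n)
  · ext; simpa [el] using hl n
  · ext; simpa [er] using hr n

/-- the linear map `C00 → V` with prescribed values -/
noncomputable def mk {V : Type*} [AddCommGroup V] [Module ℝ V] (a b : ℕ → V) : C00 →ₗ[ℝ] V :=
  Finsupp.linearCombination ℝ (Sum.elim a b)

@[simp] theorem mk_el {V : Type*} [AddCommGroup V] [Module ℝ V] (a b : ℕ → V) (n : ℕ) :
    mk a b (el n) = a n := by simp [mk, el]
@[simp] theorem mk_er {V : Type*} [AddCommGroup V] [Module ℝ V] (a b : ℕ → V) (n : ℕ) :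
    mk a b (er n) = b n := by simp [mk, er]

/-- seminorm pulled back -/
noncomputable def pb {V : Type*} [NormedAddCommGroup V] [NormedSpace ℝ V] (L : C00 →ₗ[ℝ] V) :
    Seminorm ℝ C00 := (normSeminorm ℝ V).comp L

@[simp] theorem pb_apply {V : Type*} [NormedAddCommGroup V] [NormedSpace ℝ V]
    (L : C00 →ₗ[ℝ] V) (c : C00) : pb L c = ‖L c‖ := rfl

/-- For admissible data the names span a contractive image. -/
theorem GG_map {N : Seminorm ℝ C00} {τ : ℕ → Tm E} (h : (N, τ) ∈ GG E) (c : C00) :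
    ‖mk (fun n => ev (τ n)) (fun k => ev (.node N τ k)) c‖ ≤ N c := by
  refine lp.norm_le_of_forall_le (apply_nonneg N c) fun φ => ?_
  obtain ⟨ψ, h1, h2, h3⟩ := φ.2.2.2 N τ h
  obtain ⟨g, hg⟩ := ext_of_eval (φ := φ)
    (a := mk (fun n => ev (τ n)) (fun k => ev (.node N τ k)))
  have : g = ψ := c00_hom_ext (by intro n; rw [hg, h2, mk_el]; rfl)
    (by intro n; rw [hg, h3, mk_er]; rfl)
  rw [← hg, this]
  exact h1 c

noncomputable def evU (t : Tm E) : UU E := ⟨ev t, ev_mem t⟩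

theorem mk_evU (a b : ℕ → Tm E) (c : C00) :
    ((mk (fun n => evU (a n)) (fun n => evU (b n)) c : UU E) : LI E) =
      mk (fun n => ev (a n)) (fun n => ev (b n)) c := by
  have : (UU E).subtype.comp (mk (fun n => evU (a n)) (fun n => evU (b n))) =
      mk (fun n => ev (a n)) (fun n => ev (b n)) :=
    c00_hom_ext (by intro n; simp; rfl) (by intro n; simp; rfl)
  exact LinearMap.congr_fun this c

theorem ev_norm_le (t : Tm E) : ‖evU t‖ ≤ bd t := by
  refine lp.norm_le_of_forall_le ?_ fun φ => K_bd φ.2 t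
  cases t with
  | ofE x => exact norm_nonneg x
  | node N τ k => exact apply_nonneg N _

noncomputable def jE (E : Type u) [NormedAddCommGroup E] [NormedSpace ℝ E] : E →ₗ[ℝ] UU E where
  toFun x := evU (.ofE x)
  map_add' x y := by
    apply Subtype.ext
    ext φ
    obtain ⟨f, hf, h⟩ := φ.2.1
    show φ.1 (.ofE (x + y)) = φ.1 (.ofE x) + φ.1 (.ofE y)
    simp [h]
  map_smul' c x := by
    apply Subtype.ext
    ext φ
    obtain ⟨f, hf, h⟩ := φ.2.1
    show φ.1 (.ofE (c • x)) = c * φ.1 (.ofE x)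
    simp [h]

/-- functionals on the space belong to `K`. -/
theorem dual_mem_K (g : UU E →L[ℝ] ℝ) (hg : ‖g‖ ≤ 1) : (fun t => g (evU t)) ∈ K E := by
  refine ⟨⟨(g.toLinearMap.comp (jE E)).mkContinuous 1 ?_, ?_, fun x => rfl⟩, ?_, ?_⟩
  · intro x
    rw [one_mul]
    exact (abs_le_of_norm_le_one g hg _).trans (ev_norm_le (.ofE x))
  · exact LinearMap.mkContinuous_norm_le _ zero_le_one _
  · intro N τ k
    exact (abs_le_of_norm_le_one g hg _).trans (ev_norm_le (.node N τ k))
  · intro N τ h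
    refine ⟨g.toLinearMap.comp (mk (fun n => evU (τ n)) (fun k => evU (.node N τ k))), ?_, ?_, ?_⟩
    · intro c
      refine (abs_le_of_norm_le_one g hg _).trans ?_
      refine le_trans (le_of_eq ?_) (GG_map h c)
      rw [← mk_evU]; rfl
    · intro n; simp
    · intro n; simp

theorem exists_name (x : LI E) (hx : x ∈ UU E) : ∃ t, ev t = x := by
  obtain ⟨xs, hxs, hlim⟩ := mem_closure_iff_seq_limit.1
    (show x ∈ closure (LinearMap.range (lc E) : Set (LI E)) from hx)
  choose c hc using hxs
  have hct : (⋃ m, ((c m).support : Set (Tm E)) ∪ {.ofE 0}).Countable :=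
    Set.countable_iUnion fun m => ((c m).support.countable_toSet).union (Set.countable_singleton _)
  obtain ⟨τ, hτ⟩ := hct.exists_eq_range
    ⟨.ofE 0, Set.mem_iUnion.2 ⟨0, Or.inr rfl⟩⟩
  let y : C00 →ₗ[ℝ] LI E := mk (fun n => ev (τ n)) (fun _ => x)
  let il : (ℕ →₀ ℝ) →ₗ[ℝ] C00 := Finsupp.linearCombination ℝ el
  have hyil : ∀ d, y (il d) = Finsupp.linearCombination ℝ (fun n => ev (τ n)) d := by
    intro d
    have : y.comp il = Finsupp.linearCombination ℝ (fun n => ev (τ n)) := by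
      ext n; simp [il, y]
    exact LinearMap.congr_fun this d
  have hd : ∀ m, ∃ d, y (il d) = xs m := by
    intro m
    have : xs m ∈ Submodule.span ℝ (Set.range fun n => ev (τ n)) := by
      rw [← hc m, lc, Finsupp.linearCombination_apply]
      refine Submodule.sum_mem _ fun t ht => Submodule.smul_mem _ _ (Submodule.subset_span ?_)
      have : t ∈ Set.range τ := by
        rw [← hτ]; exact Set.mem_iUnion.2 ⟨m, Or.inl ht⟩
      obtain ⟨n, rfl⟩ := this
      exact ⟨n, rfl⟩
    rw [← Finsupp.range_linearCombination] at this
    obtain ⟨d, hd⟩ := this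
    exact ⟨d, (hyil d).trans hd⟩
  choose d hd using hd
  have hG : (pb y, τ) ∈ GG E := by
    refine GG_of fun φ hφ => ?_
    obtain ⟨g, hg⟩ := ext_of_eval (φ := ⟨φ, hφ⟩) (a := y)
    refine ⟨g, fun c => ?_, fun n => ?_⟩
    · rw [hg]; exact lp_apply_le _ _
    · rw [hg]; simp [y, ev_apply]
  refine ⟨.node (pb y) τ 0, ?_⟩
  have key := GG_map hG
  set z := mk (fun n => ev (τ n)) (fun k => ev (.node (pb y) τ k)) with hz
  have hzil : ∀ e, z (il e) = y (il e) := by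
    intro e
    have : z.comp il = y.comp il := by ext n; simp [il, y, z]
    exact LinearMap.congr_fun this e
  have h1 : ∀ m, ‖ev (.node (pb y) τ 0) - xs m‖ ≤ ‖x - xs m‖ := by
    intro m
    have := key (er 0 - il (d m))
    rw [pb_apply, map_sub, map_sub, hzil, hd] at this
    simpa [y, z] using this
  have h2 : Filter.Tendsto xs Filter.atTop (nhds (ev (.node (pb y) τ 0))) := by
    rw [tendsto_iff_norm_sub_tendsto_zero]
    have h3 := tendsto_iff_norm_sub_tendsto_zero.1 hlim
    refine squeeze_zero (fun _ => norm_nonneg _) (fun m => ?_) h3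
    rw [norm_sub_rev, norm_sub_rev (xs m)]
    exact h1 m
  exact tendsto_nhds_unique h2 hlim

theorem real_mem_K {V : Type*} [NormedAddCommGroup V] [NormedSpace ℝ V]
    (HV : ∀ (N : Seminorm ℝ C00) (w : ℕ → V),
      (∀ f : V →L[ℝ] ℝ, ‖f‖ ≤ 1 → Pre N (fun n => f (w n))) → Pre N w)
    (p : Tm E → V) (f₀ : E →L[ℝ] V) (hf₀ : ‖f₀‖ ≤ 1) (h₀ : ∀ x, p (.ofE x) = f₀ x)
    (hb : ∀ N τ k, ‖p (.node N τ k)‖ ≤ N (er k))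
    (hp : ∀ N τ, (N, τ) ∈ GG E → Pre N (fun n => p (τ n)) → Cond p N τ)
    (f : V →L[ℝ] ℝ) (hf : ‖f‖ ≤ 1) : (fun t => f (p t)) ∈ K E := by
  let S : Set (Seminorm ℝ C00 × (ℕ → Tm E)) := {q | Cond p q.1 q.2}
  have hS : ∀ f : V →L[ℝ] ℝ, ‖f‖ ≤ 1 → (fun t => f (p t)) ∈ KS S := by
    intro f hf
    refine ⟨⟨f.comp f₀, ?_, fun x => by simp [h₀]⟩, ?_, ?_⟩
    · exact (ContinuousLinearMap.opNorm_comp_le _ _).trans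
        (mul_le_one₀ hf (norm_nonneg _) hf₀)
    · exact fun N τ k => (abs_le_of_norm_le_one f hf _).trans (hb N τ k)
    · rintro N τ ⟨ψ, h1, h2, h3⟩
      exact ⟨f.toLinearMap.comp ψ, fun c => (abs_le_of_norm_le_one f hf _).trans (h1 c),
        fun n => by simp [h2], fun n => by simp [h3]⟩
  have : GG E ⊆ S := GG_ind S fun N τ hG h =>
    hp N τ hG (HV _ _ fun f hf => h _ (KS_anti Set.inter_subset_right (hS f hf)))
  exact KS_anti this (hS f hf)

open Classical in
/-- default choice -/
noncomputable def dflt {V : Type*} [NormedAddCommGroup V] [NormedSpace ℝ V] (N : Seminorm ℝ C00)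
    (w : ℕ → V) (k : ℕ) : V :=
  if h : Pre N w then h.choose (er k) else 0

theorem dflt_le {V : Type*} [NormedAddCommGroup V] [NormedSpace ℝ V] (N : Seminorm ℝ C00)
    (w : ℕ → V) (k : ℕ) : ‖dflt N w k‖ ≤ N (er k) := by
  unfold dflt
  split_ifs with h
  · exact h.choose_spec.1 _
  · simp

theorem dflt_cond {V : Type*} [NormedAddCommGroup V] [NormedSpace ℝ V] (p : Tm E → V)
    (N : Seminorm ℝ C00) (τ : ℕ → Tm E) (h : Pre N (fun n => p (τ n)))
    (hp : ∀ k, p (.node N τ k) = dflt N (fun n => p (τ n)) k) : Cond p N τ := by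
  refine ⟨h.choose, h.choose_spec.1, h.choose_spec.2, fun k => ?_⟩
  rw [hp, dflt, dif_pos h]

theorem exists_real {V : Type*} [NormedAddCommGroup V] [NormedSpace ℝ V]
    (HV : ∀ (N : Seminorm ℝ C00) (w : ℕ → V),
      (∀ f : V →L[ℝ] ℝ, ‖f‖ ≤ 1 → Pre N (fun n => f (w n))) → Pre N w)
    (f₀ : E →L[ℝ] V) (hf₀ : ‖f₀‖ ≤ 1) :
    ∃ p : Tm E → V, (∀ x, p (.ofE x) = f₀ x) ∧
      ∀ f : V →L[ℝ] ℝ, ‖f‖ ≤ 1 → (fun t => f (p t)) ∈ K E := by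
  refine ⟨Tm.rc f₀ (fun N τ w k => dflt N w k), fun x => rfl, ?_⟩
  refine real_mem_K HV _ f₀ hf₀ (fun x => rfl) (fun N τ k => dflt_le _ _ _) ?_
  exact fun N τ _ h => dflt_cond _ N τ h fun k => rfl

theorem HV_real (N : Seminorm ℝ C00) (w : ℕ → ℝ)
    (h : ∀ f : ℝ →L[ℝ] ℝ, ‖f‖ ≤ 1 → Pre N (fun n => f (w n))) : Pre N w :=
  h (ContinuousLinearMap.id ℝ ℝ) ContinuousLinearMap.norm_id_le

theorem jE_norm (x : E) : ‖jE E x‖ = ‖x‖ := by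
  apply le_antisymm (ev_norm_le (.ofE x))
  obtain ⟨g, hg, hgx⟩ := exists_dual_vector'' ℝ x
  obtain ⟨p, hp, hK⟩ := exists_real (E := E) HV_real g hg
  have h := lp_apply_le (jE E x : LI E)
    ⟨_, hK (ContinuousLinearMap.id ℝ ℝ) ContinuousLinearMap.norm_id_le⟩
  have h2 : |p (.ofE x)| ≤ ‖jE E x‖ := h
  rw [hp, hgx] at h2
  exact (le_abs_self _).trans h2

theorem exists_proj [CompleteSpace E]
    (HV : ∀ (N : Seminorm ℝ C00) (w : ℕ → E),
      (∀ f : E →L[ℝ] ℝ, ‖f‖ ≤ 1 → Pre N (fun n => f (w n))) → Pre N w) :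
    ∃ P : UU E →L[ℝ] E, ‖P‖ ≤ 1 ∧ ∀ x, P (jE E x) = x := by
  obtain ⟨p, hp, hK⟩ := exists_real (E := E) HV (ContinuousLinearMap.id ℝ E)
    ContinuousLinearMap.norm_id_le
  obtain ⟨T, hT, hTe⟩ := closed_ext (lc E) (Finsupp.linearCombination ℝ p) (by
    intro c
    obtain ⟨g, hg, hgx⟩ := exists_dual_vector'' ℝ (Finsupp.linearCombination ℝ p c)
    obtain ⟨e, he⟩ := ext_of_eval (φ := ⟨_, hK g hg⟩) (a := lc E)
    have h1 : e = g.toLinearMap.comp (Finsupp.linearCombination ℝ p) := by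
      ext t
      simp [he, lc, ev_apply]
    have h2 := LinearMap.congr_fun h1 c
    rw [he] at h2
    have h3 := lp_apply_le (lc E c) ⟨_, hK g hg⟩
    rw [h2] at h3
    refine le_trans ?_ h3
    refine le_trans (le_of_eq ?_) (le_abs_self _)
    exact hgx.symm)
  refine ⟨T, hT, fun x => ?_⟩
  have := hTe (Finsupp.single (.ofE x) 1)
  simp [lc, hp] at this
  exact this

noncomputable def rk : Tm E → Ordinal.{0} :=
  Tm.rc (fun _ => 0) (fun _ _ w _ => ⨆ n, Order.succ (w n))

noncomputable def rks (τ : ℕ → Tm E) : Ordinal.{0} := ⨆ n, Order.succ (rk (τ n))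

theorem rk_node (N : Seminorm ℝ C00) (τ : ℕ → Tm E) (k : ℕ) : rk (.node N τ k) = rks τ := rfl

theorem rk_lt (τ : ℕ → Tm E) (n : ℕ) : rk (τ n) < rks τ :=
  lt_of_lt_of_le (Order.lt_succ _) (Ordinal.le_iSup (fun n => Order.succ (rk (τ n))) n)

open Classical in
theorem amalgam (φ₀ : Tm E → ℝ) (hφ₀ : φ₀ ∈ K E) (N₀ : Seminorm ℝ C00) (τ₀ : ℕ → Tm E)
    (h : C00 →ₗ[ℝ] ℝ) (hN : ∀ c, |h c| ≤ N₀ c) (hh : ∀ n, h (el n) = φ₀ (τ₀ n)) :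
    ∃ φ ∈ K E, (∀ n, φ (τ₀ n) = φ₀ (τ₀ n)) ∧ ∀ k, φ (.node N₀ τ₀ k) = h (er k) := by
  let φ : Tm E → ℝ := Tm.rc (fun x => φ₀ (.ofE x)) (fun N τ w k =>
    if rks τ < rks τ₀ then φ₀ (.node N τ k) else
    if N = N₀ ∧ τ = τ₀ then h (er k) else dflt N w k)
  have φ_node : ∀ N τ k, φ (.node N τ k) = if rks τ < rks τ₀ then φ₀ (.node N τ k) else
    if N = N₀ ∧ τ = τ₀ then h (er k) else dflt N (fun n => φ (τ n)) k := fun N τ k => rfl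
  have low : ∀ t, rk t < rks τ₀ → φ t = φ₀ t := by
    intro t ht
    cases t with
    | ofE x => rfl
    | node N τ k =>
      rw [rk_node] at ht
      rw [φ_node, if_pos ht]
  have h0 : ∀ k, φ (.node N₀ τ₀ k) = h (er k) := fun k => by
    rw [φ_node, if_neg (lt_irrefl _), if_pos ⟨rfl, rfl⟩]
  have hlow : ∀ n, φ (τ₀ n) = φ₀ (τ₀ n) := fun n => low _ (rk_lt _ _)
  refine ⟨φ, ?_, hlow, h0⟩
  obtain ⟨f, hf, hfx⟩ := hφ₀.1
  refine real_mem_K HV_real φ f hf hfx ?_ ?_ (ContinuousLinearMap.id ℝ ℝ)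
    ContinuousLinearMap.norm_id_le
  · intro N τ k
    rw [φ_node]
    split_ifs with h1 h2
    · exact hφ₀.2.1 N τ k
    · rw [h2.1]; exact hN _
    · exact dflt_le _ _ _
  · intro N τ hG hP
    by_cases h1 : rks τ < rks τ₀
    · obtain ⟨ψ, a1, a2, a3⟩ := hφ₀.2.2 N τ hG
      refine ⟨ψ, a1, fun n => ?_, fun k => ?_⟩
      · rw [a2, low _ ((rk_lt τ n).trans h1)]
      · rw [a3, φ_node, if_pos h1]
    · by_cases h2 : N = N₀ ∧ τ = τ₀
      · obtain ⟨rfl, rfl⟩ := h2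
        exact ⟨h, hN, fun n => by rw [hh, hlow], fun k => (h0 k).symm⟩
      · exact dflt_cond φ N τ hP fun k => by rw [φ_node, if_neg h1, if_neg h2]

theorem univ_disp {A B : Type u} [NormedAddCommGroup A] [NormedSpace ℝ A]
    [NormedAddCommGroup B] [NormedSpace ℝ B] [TopologicalSpace.SeparableSpace A]
    [TopologicalSpace.SeparableSpace B] (u : A →ₗᵢ[ℝ] UU E) (i : A →ₗᵢ[ℝ] B) :
    ∃ u' : B →ₗᵢ[ℝ] UU E, ∀ a, u' (i a) = u a := by
  have : CompleteSpace (UU E) :=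
    (Submodule.isClosed_topologicalClosure _).completeSpace_coe
  let a := TopologicalSpace.denseSeq A
  let b := TopologicalSpace.denseSeq B
  let y : C00 →ₗ[ℝ] B := mk (fun n => i (a n)) b
  have hτ : ∀ n, ∃ t, ev t = (u (a n) : LI E) := fun n => exists_name _ (u (a n)).2
  choose τ hτ using hτ
  have hG : (pb y, τ) ∈ GG E := by
    refine GG_of fun φ hφ => ?_
    obtain ⟨e, he⟩ := ext_of_eval (φ := ⟨φ, hφ⟩) (a := (UU E).subtype.comp u.toLinearMap)
    obtain ⟨g, hg, hgi⟩ := hb i.toLinearMap e (by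
      intro x
      rw [he]
      refine (lp_apply_le _ _).trans (le_of_eq ?_)
      exact (u.norm_map x).trans (i.norm_map x).symm)
    refine ⟨g.toLinearMap.comp y, fun c => abs_le_of_norm_le_one g hg _, fun n => ?_⟩
    have h1 := hgi (a n)
    rw [he] at h1
    have h2 : φ (τ n) = (u (a n) : LI E) ⟨φ, hφ⟩ := by rw [← hτ]; rfl
    show _ = φ (τ n)
    rw [h2]
    simpa [y] using h1
  let L : C00 →ₗ[ℝ] UU E := mk (fun n => evU (τ n)) (fun k => evU (.node (pb y) τ k))
  have hτ' : ∀ n, evU (τ n) = u (a n) := fun n => Subtype.ext (hτ n)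
  have hL : ∀ c, ‖L c‖ = ‖y c‖ := by
    intro c
    apply le_antisymm
    · refine le_trans (le_of_eq ?_) (GG_map hG c)
      rw [← mk_evU]; rfl
    · obtain ⟨f, hf, hfy⟩ := exists_dual_vector'' ℝ (y c)
      obtain ⟨g, hg, hgu⟩ := hb u.toLinearMap (f.toLinearMap.comp i.toLinearMap) (by
        intro x
        refine (abs_le_of_norm_le_one f hf _).trans (le_of_eq ?_)
        exact (i.norm_map x).trans (u.norm_map x).symm)
      obtain ⟨φ, hφ, h1, h2⟩ := amalgam _ (dual_mem_K g hg) (pb y) τ (f.toLinearMap.comp y)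
        (fun c => abs_le_of_norm_le_one f hf _) (fun n => by
          have := hgu (a n)
          rw [hτ']
          simpa [y] using this.symm)
      obtain ⟨e, he⟩ := ext_of_eval (φ := ⟨φ, hφ⟩) (a := (UU E).subtype.comp L)
      have h3 : e = f.toLinearMap.comp y := by
        apply c00_hom_ext
        · intro n
          rw [he]
          have h4 : ((UU E).subtype.comp L) (el n) = ev (τ n) := by simp [L, evU]
          rw [h4, ev_apply]
          show φ (τ n) = _
          rw [h1, hτ']
          have := hgu (a n)
          simpa [y] using this
        · intro n
          rw [he]
          have h4 : ((UU E).subtype.comp L) (er n) = ev (.node (pb y) τ n) := by simp [L, evU]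
          rw [h4, ev_apply]
          exact h2 n
      have h5 := LinearMap.congr_fun h3 c
      rw [he] at h5
      have h6 := lp_apply_le (((UU E).subtype.comp L) c) ⟨φ, hφ⟩
      rw [h5] at h6
      refine le_trans (le_trans (le_of_eq ?_) (le_abs_self _)) h6
      exact hfy.symm
  have hd : DenseRange y := by
    refine (TopologicalSpace.denseRange_denseSeq B).mono ?_
    rintro _ ⟨n, rfl⟩
    exact ⟨er n, by simp [y, b]⟩
  have hn : ∀ x, ‖L x‖ ≤ 1 * ‖y x‖ := fun x => by rw [one_mul, hL]
  let T := L.extendOfNorm y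
  have hT : ∀ c, T (y c) = L c := fun c => LinearMap.extendOfNorm_eq hd ⟨1, hn⟩ c
  have hTn : ∀ x, ‖T x‖ = ‖x‖ := by
    refine hd.induction ?_ (isClosed_eq (by fun_prop) (by fun_prop))
    rintro _ ⟨c, rfl⟩
    rw [hT, hL]
  refine ⟨⟨T.toLinearMap, hTn⟩, ?_⟩
  refine (TopologicalSpace.denseRange_denseSeq A).induction ?_
    (isClosed_eq (T.continuous.comp i.continuous) u.continuous)
  rintro _ ⟨n, rfl⟩
  have h1 := hT (el n)
  simp only [y, L, mk_el, hτ'] at h1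
  exact h1

end Build

theorem HV_E (E : BanachSpace.{u}) (hE : IsSeparablyInjective1 E) (N : Seminorm ℝ C00)
    (w : ℕ → E.carrier)
    (h : ∀ f : E.carrier →L[ℝ] ℝ, ‖f‖ ≤ 1 → Pre N (fun n => f (w n))) : Pre N w := by
  let Φ : Type u := ULift.{u} {ψ : C00 →ₗ[ℝ] ℝ // ∀ c, |ψ c| ≤ N c}
  let J : C00 →ₗ[ℝ] lp (fun _ : Φ => ℝ) ∞ := lpMap (fun φ => φ.down.1) N (fun φ c => φ.down.2 c)
  have hJ : ∀ c, ‖J c‖ ≤ N c := fun c =>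
    lp.norm_le_of_forall_le (apply_nonneg N c) (fun φ => φ.down.2 c)
  let W := (LinearMap.range J).topologicalClosure
  let BW : BanachSpace.{u} :=
    { carrier := W, complete := (Submodule.isClosed_topologicalClosure _).completeSpace_coe }
  have hsep : TopologicalSpace.IsSeparable (W : Set (lp (fun _ : Φ => ℝ) ∞)) := by
    refine TopologicalSpace.IsSeparable.closure ?_
    have : LinearMap.range J = Submodule.span ℝ
        (Set.range fun s : ℕ ⊕ ℕ => J (Finsupp.single s 1)) := by
      rw [← Finsupp.range_linearCombination]
      congr 1
      ext s
      simp
    rw [this]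
    exact (Set.countable_range _).isSeparable.span
  let J' : C00 →ₗ[ℝ] W := J.codRestrict W (mem_tc J)
  let il : (ℕ →₀ ℝ) →ₗ[ℝ] C00 := Finsupp.linearCombination ℝ el
  obtain ⟨t, ht, hte⟩ := closed_ext (J'.comp il) (Finsupp.linearCombination ℝ w) (by
    intro c
    obtain ⟨f, hf, hfx⟩ := exists_dual_vector'' ℝ (Finsupp.linearCombination ℝ w c)
    obtain ⟨ψ, h1, h2⟩ := h f hf
    have h3 : ψ.comp il = f.toLinearMap.comp (Finsupp.linearCombination ℝ w) := by
      ext n; simp [il, h2]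
    have h4 := lp_apply_le (J (il c)) ⟨ψ, h1⟩
    have h5 : J (il c) ⟨ψ, h1⟩ = ‖Finsupp.linearCombination ℝ w c‖ :=
      (LinearMap.congr_fun h3 c).trans hfx
    rw [h5] at h4
    exact (le_abs_self _).trans h4)
  obtain ⟨T, hT, hTn⟩ := hE BW hsep.separableSpace _
    (Submodule.isClosed_topologicalClosure (LinearMap.range (J'.comp il))) t
  refine ⟨T.toLinearMap.comp J', fun c => ?_, fun n => ?_⟩
  · have h1 := T.le_of_opNorm_le (hTn.trans ht) (J' c)
    rw [one_mul] at h1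
    exact h1.trans (hJ c)
  · have h1 := hte (Finsupp.single n 1)
    rw [← hT] at h1
    simpa [il] using h1

theorem hard_dir (E : BanachSpace.{u}) (hE : IsSeparablyInjective1 E) :
    ∃ U : BanachSpace.{u}, IsUnivDispSeparable U ∧
        ∃ (j : E.carrier →ₗᵢ[ℝ] U.carrier) (P : U.carrier →L[ℝ] E.carrier),
          ‖P‖ ≤ 1 ∧ ∀ x : E.carrier, P (j x) = x := by
  obtain ⟨P, hP, hPj⟩ := exists_proj (HV_E E hE)
  refine ⟨{ carrier := UU E.carrier,
            complete := (Submodule.isClosed_topologicalClosure _).completeSpace_coe },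
    ?_, ⟨jE E.carrier, jE_norm⟩, P, hP, hPj⟩
  intro A B hA hB u i
  exact univ_disp u i

end SepInj

/-- A Banach space is `1`-separably injective iff it is a `1`-complemented subspace of a
Banach space of universal disposition for separable spaces. -/
theorem separablyInjective1_iff_oneComplemented_univDispSeparable (E : BanachSpace.{u}) :
    IsSeparablyInjective1 E ↔
      ∃ U : BanachSpace.{u}, IsUnivDispSeparable U ∧
        ∃ (j : E.carrier →ₗᵢ[ℝ] U.carrier) (P : U.carrier →L[ℝ] E.carrier),
          ‖P‖ ≤ 1 ∧ ∀ x : E.carrier, P (j x) = x := by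
  constructor
  · exact SepInj.hard_dir E
  · rintro ⟨U, hU, j, P, hP, hPj⟩
    exact SepInj.easy_dir E U hU j P hP hPj
end

section
/- Let ℵ be an uncountable cardinal. A Banach space E is (1, ℵ)-injective if and only if E is a 1-complemented subspace of some Banach space of 𝒮_ℵ-universal disposition; that is, if and only if there exist a Banach space U of 𝒮_ℵ-universal disposition, a linear isometric embedding j : E → U, and a bounded linear operator P : U → E with ‖P‖ ≤ 1 and P ∘ j = id_E. -/
/-- A topological space has density character `< κ`: there is a dense subset of
cardinality `< κ`. -/
def DensityLT (X : Type u) [TopologicalSpace X] (κ : Cardinal.{u}) : Prop :=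
  ∃ s : Set X, Dense s ∧ Cardinal.mk s < κ

/-- `E` is `(1, ℵ)`-injective: for every Banach space `B` with density character `< ℵ` and
closed subspace `A ⊆ B`, every operator `t : A → E` extends to `T : B → E` with
`‖T‖ ≤ ‖t‖`. -/
def IsInjective1 (ℵ : Cardinal.{u}) (E : BanachSpace.{u}) : Prop :=
  ∀ B : BanachSpace.{u}, DensityLT B.carrier ℵ →
    ∀ A : Submodule ℝ B.carrier, IsClosed (A : Set B.carrier) →
      ∀ t : A →L[ℝ] E.carrier, ∃ T : B.carrier →L[ℝ] E.carrier,
        (∀ a : A, T (a : B.carrier) = t a) ∧ ‖T‖ ≤ ‖t‖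

/-- `U` is of universal disposition for the class `𝒮_ℵ` of Banach spaces of density
character `< ℵ`. -/
def IsUnivDispDensLT (ℵ : Cardinal.{u}) (U : BanachSpace.{u}) : Prop :=
  ∀ A B : BanachSpace.{u}, DensityLT A.carrier ℵ → DensityLT B.carrier ℵ →
    ∀ (u : A.carrier →ₗᵢ[ℝ] U.carrier) (i : A.carrier →ₗᵢ[ℝ] B.carrier),
      ∃ u' : B.carrier →ₗᵢ[ℝ] U.carrier, ∀ a : A.carrier, u' (i a) = u a


theorem dual_sep {F : Type*} [NormedAddCommGroup F] [NormedSpace ℝ F] {x y : F}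
    (h : ∀ φ : F →L[ℝ] ℝ, ‖φ‖ ≤ 1 → φ x = φ y) : x = y := by
  obtain ⟨φ, h1, h2⟩ := exists_dual_vector'' ℝ (x - y)
  have := h φ h1
  rw [map_sub, this, sub_self] at h2
  have h3 : ‖x - y‖ = 0 := by simpa using h2.symm
  exact sub_eq_zero.1 (norm_eq_zero.1 h3)

theorem dual_norm_le {F : Type*} [NormedAddCommGroup F] [NormedSpace ℝ F] {x : F} {C : ℝ}
    (h : ∀ φ : F →L[ℝ] ℝ, ‖φ‖ ≤ 1 → |φ x| ≤ C) : ‖x‖ ≤ C := by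
  obtain ⟨φ, h1, h2⟩ := exists_dual_vector'' ℝ x
  have := h φ h1
  rw [h2] at this
  simpa using this

theorem abs_le_of_norm_le_one {A : Type*} [SeminormedAddCommGroup A] [NormedSpace ℝ A]
    {h : A →L[ℝ] ℝ} (h1 : ‖h‖ ≤ 1) (a : A) : |h a| ≤ ‖a‖ := by
  have := h.le_of_opNorm_le h1 a
  simpa using this

theorem exists_clm_of_dual {A F : Type*} [SeminormedAddCommGroup A] [NormedSpace ℝ A]
    [NormedAddCommGroup F] [NormedSpace ℝ F] (q : A → F)
    (h : ∀ φ : F →L[ℝ] ℝ, ‖φ‖ ≤ 1 → ∃ h : A →L[ℝ] ℝ, ‖h‖ ≤ 1 ∧ ∀ a, φ (q a) = h a) :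
    ∃ Q : A →L[ℝ] F, ‖Q‖ ≤ 1 ∧ ∀ a, Q a = q a := by
  let L : A →ₗ[ℝ] F :=
    { toFun := q
      map_add' := fun a b => dual_sep fun φ hφ => by
        obtain ⟨h, -, h2⟩ := h φ hφ
        simp [h2]
      map_smul' := fun c a => dual_sep fun φ hφ => by
        obtain ⟨h, -, h2⟩ := h φ hφ
        simp [h2] }
  have hL : ∀ a, ‖L a‖ ≤ 1 * ‖a‖ := fun a => dual_norm_le fun φ hφ => by
    obtain ⟨h, h1, h2⟩ := h φ hφ
    have : φ (L a) = h a := h2 a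
    rw [this, one_mul]
    exact abs_le_of_norm_le_one h1 a
  exact ⟨L.mkContinuous 1 hL, L.mkContinuous_norm_le zero_le_one hL, fun a => rfl⟩

theorem DensityLT.of_denseRange {X Y : Type u} [TopologicalSpace X] [TopologicalSpace Y]
    {κ : Cardinal.{u}} (h : DensityLT X κ) {f : X → Y} (hf : Continuous f) (hd : DenseRange f) :
    DensityLT Y κ := by
  obtain ⟨s, hs, hc⟩ := h
  exact ⟨Set.image f s, hd.dense_image hf hs, Cardinal.mk_image_le.trans_lt hc⟩

theorem DensityLT.prod {X Y : Type u} [TopologicalSpace X] [TopologicalSpace Y]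
    {κ : Cardinal.{u}} (hκ : Cardinal.aleph0 < κ) (h : DensityLT X κ) (h' : DensityLT Y κ) :
    DensityLT (X × Y) κ := by
  obtain ⟨s, hs, hc⟩ := h
  obtain ⟨t, ht, hc'⟩ := h'
  refine ⟨s ×ˢ t, hs.prod ht, ?_⟩
  rw [Cardinal.mk_setProd]
  simpa using Cardinal.mul_lt_of_lt hκ.le hc hc'

theorem DensityLT.subset {X : Type u} [PseudoMetricSpace X]
    {κ : Cardinal.{u}} (hκ : Cardinal.aleph0 < κ) (h : DensityLT X κ) (A : Set X) :
    DensityLT A κ := by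
  classical
  obtain ⟨s, hs, hc⟩ := h
  by_cases hA : Nonempty A
  · obtain ⟨a0⟩ := hA
    let f : s × ULift.{u} ℕ → A := fun p =>
      if h : ∃ a : A, dist (p.1 : X) a < 1 / ((p.2.down : ℝ) + 1) then h.choose else a0
    refine ⟨Set.range f, ?_, ?_⟩
    · intro a
      rw [Metric.mem_closure_iff]
      intro ε hε
      obtain ⟨n, hn⟩ := exists_nat_one_div_lt (half_pos hε)
      obtain ⟨d, hd, hda⟩ := Metric.dense_iff.1 hs (a : X) (1 / ((n : ℝ) + 1)) (by positivity)
      have hex : ∃ a : A, dist d a < 1 / ((n : ℝ) + 1) := ⟨a, hd⟩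
      refine ⟨f (⟨d, hda⟩, ⟨n⟩), ⟨_, rfl⟩, ?_⟩
      have : f (⟨d, hda⟩, ⟨n⟩) = hex.choose := dif_pos hex
      rw [this, Subtype.dist_eq]
      have h1 := hex.choose_spec
      have h2 : dist d a < 1 / ((n : ℝ) + 1) := hd
      have h3 := dist_triangle_left (a : X) (hex.choose : X) d
      linarith
    · refine Cardinal.mk_range_le.trans_lt ?_
      rw [Cardinal.mk_prod]
      refine Cardinal.mul_lt_of_lt hκ.le ?_ ?_
      · simpa using hc
      · simpa using hκ
  · refine ⟨∅, fun a => (hA ⟨a⟩).elim, ?_⟩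
    simpa using (Cardinal.aleph0_pos.trans hκ)

/-- Functionals on a pushout. -/
def POS {A C B : Type u} [NormedAddCommGroup A] [NormedSpace ℝ A] [NormedAddCommGroup B]
    [NormedSpace ℝ B] [NormedAddCommGroup C] [NormedSpace ℝ C] (t : A →L[ℝ] C) (i : A →L[ℝ] B) :
    Set ((C →L[ℝ] ℝ) × (B →L[ℝ] ℝ)) :=
  {p | ‖p.1‖ ≤ 1 ∧ ‖p.2‖ ≤ 1 ∧ ∀ a, p.1 (t a) = p.2 (i a)}

theorem exists_pushout {C B : Type u} [NormedAddCommGroup B]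
    [NormedSpace ℝ B] [NormedAddCommGroup C] [NormedSpace ℝ C] (A : Submodule ℝ B)
    (t : A →L[ℝ] C) (ht : ‖t‖ ≤ 1) {κ : Cardinal.{u}} (hκ : Cardinal.aleph0 < κ)
    (hB : DensityLT B κ) (hC : DensityLT C κ) :
    ∃ (Q : BanachSpace.{u}) (_ : DensityLT Q.carrier κ) (α : C →ₗᵢ[ℝ] Q.carrier)
      (β : B →L[ℝ] Q.carrier), ‖β‖ ≤ 1 ∧ ∀ a : A, α (t a) = β a := by
  let S := POS t A.subtypeL
  let α0 : C →ₗ[ℝ] (BoundedContinuousFunction S ℝ) :=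
    { toFun := fun c => BoundedContinuousFunction.ofNormedAddCommGroup (fun p : S => p.1.1 c)
        (by fun_prop) ‖c‖ (fun p => abs_le_of_norm_le_one p.2.1 c)
      map_add' := fun a b => by ext p; simp
      map_smul' := fun a b => by ext p; simp }
  let β0 : B →ₗ[ℝ] (BoundedContinuousFunction S ℝ) :=
    { toFun := fun c => BoundedContinuousFunction.ofNormedAddCommGroup (fun p : S => p.1.2 c)
        (by fun_prop) ‖c‖ (fun p => abs_le_of_norm_le_one p.2.2.1 c)
      map_add' := fun a b => by ext p; simp
      map_smul' := fun a b => by ext p; simp }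
  have hα0 : ∀ c p, α0 c p = p.1.1 c := fun c p => rfl
  have hβ0 : ∀ c p, β0 c p = p.1.2 c := fun c p => rfl
  have hα : ∀ c, ‖α0 c‖ = ‖c‖ := by
    intro c
    apply le_antisymm
    · exact (BoundedContinuousFunction.norm_le (norm_nonneg _)).2
        fun p => abs_le_of_norm_le_one p.2.1 c
    · obtain ⟨f, h1, h2⟩ := exists_dual_vector'' ℝ c
      obtain ⟨g, hg1, hg2⟩ := exists_extension_norm_eq A (f.comp t)
      have hg : ‖g‖ ≤ 1 := by
        rw [hg2]
        refine (f.opNorm_comp_le t).trans ?_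
        exact mul_le_one₀ h1 (norm_nonneg _) ht
      have := (α0 c).norm_coe_le_norm (⟨(f, g), h1, hg, fun a => (hg1 a).symm⟩ : S)
      rw [hα0] at this
      simpa [h2] using this
  have hβ : ∀ c, ‖β0 c‖ ≤ 1 * ‖c‖ := fun c => by
    rw [one_mul]
    exact (BoundedContinuousFunction.norm_le (norm_nonneg _)).2
        fun p => abs_le_of_norm_le_one p.2.2.1 c
  let α1 : C →L[ℝ] (BoundedContinuousFunction S ℝ) :=
    α0.mkContinuous 1 (fun c => by rw [hα, one_mul])
  let β1 : B →L[ℝ] (BoundedContinuousFunction S ℝ) := β0.mkContinuous 1 hβ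
  let γ : (C × B) →L[ℝ] (BoundedContinuousFunction S ℝ) := α1.coprod β1
  let M := γ.range.topologicalClosure
  have hM : ∀ x, γ x ∈ M := fun x => γ.range.le_topologicalClosure ⟨x, rfl⟩
  have hMα : ∀ c, α0 c ∈ M := fun c => by
    have := hM (c, 0)
    simpa [γ, α1] using this
  have hMβ : ∀ c, β0 c ∈ M := fun c => by
    have := hM (0, c)
    simpa [γ, β1] using this
  have : CompleteSpace M := (Submodule.isClosed_topologicalClosure _).completeSpace_coe
  refine ⟨⟨M⟩, ?_, ⟨α0.codRestrict M hMα, fun c => hα c⟩, β1.codRestrict M hMβ, ?_, ?_⟩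
  · refine (hC.prod hκ hB).of_denseRange (f := fun x => (⟨γ x, hM x⟩ : M)) (by fun_prop) ?_
    intro x
    rw [closure_subtype, ← Set.range_comp]
    exact x.2
  · refine ContinuousLinearMap.opNorm_le_bound _ zero_le_one hβ
  · intro a
    apply Subtype.ext
    ext p
    exact p.2.2.2 a

theorem univDisp_injective {ℵ : Cardinal.{u}} (hℵ : Cardinal.aleph0 < ℵ) {U : BanachSpace.{u}}
    (hU : IsUnivDispDensLT ℵ U) (B : BanachSpace.{u}) (hB : DensityLT B.carrier ℵ)
    (A : Submodule ℝ B.carrier) (t : A →L[ℝ] U.carrier) (ht : ‖t‖ ≤ 1) :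
    ∃ T : B.carrier →L[ℝ] U.carrier, (∀ a : A, T (a : B.carrier) = t a) ∧ ‖T‖ ≤ 1 := by
  let C := t.range.topologicalClosure
  have hC : ∀ x, t x ∈ C := fun x => t.range.le_topologicalClosure ⟨x, rfl⟩
  have : CompleteSpace C := (Submodule.isClosed_topologicalClosure _).completeSpace_coe
  have hdC : DensityLT C ℵ := by
    refine (hB.subset hℵ (A : Set B.carrier)).of_denseRange
      (f := fun x : A => (⟨t x, hC x⟩ : C)) (by fun_prop) ?_
    intro x
    rw [closure_subtype, ← Set.range_comp]
    exact x.2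
  obtain ⟨Q, hQ, α, β, hβ, hαβ⟩ := exists_pushout A (t.codRestrict C hC)
    (ContinuousLinearMap.opNorm_le_bound _ zero_le_one fun a => t.le_of_opNorm_le ht a) hℵ hB hdC
  obtain ⟨u', hu'⟩ := hU ⟨C⟩ Q hdC hQ C.subtypeₗᵢ α
  refine ⟨u'.toContinuousLinearMap.comp β, fun a => ?_, ?_⟩
  · have := hu' (t.codRestrict C hC a)
    rw [hαβ] at this
    exact this
  · refine ContinuousLinearMap.opNorm_le_bound _ zero_le_one fun a => ?_
    simpa using β.le_of_opNorm_le hβ a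

theorem backward_dir {ℵ : Cardinal.{u}} (hℵ : Cardinal.aleph0 < ℵ) {E U : BanachSpace.{u}}
    (hU : IsUnivDispDensLT ℵ U) (j : E.carrier →ₗᵢ[ℝ] U.carrier) (P : U.carrier →L[ℝ] E.carrier)
    (hP : ‖P‖ ≤ 1) (hPj : ∀ x, P (j x) = x) : IsInjective1 ℵ E := by
  intro B hB A _ t
  obtain ⟨n, hn⟩ : ∃ n : ℝ, n = ‖t‖ := ⟨_, rfl⟩
  have hle : ∀ a, ‖t a‖ ≤ n * ‖a‖ := fun a => hn ▸ t.le_opNorm a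
  have hn0 : 0 ≤ n := hn ▸ norm_nonneg t
  rw [← hn]
  rcases hn0.eq_or_lt with h0 | h0
  · refine ⟨0, fun a => ?_, by simpa using hn0⟩
    have := hle a
    rw [← h0, zero_mul] at this
    simpa using (norm_le_zero_iff.1 this).symm
  · obtain ⟨T, hT, hT1⟩ := univDisp_injective hℵ hU B hB A
      (j.toContinuousLinearMap.comp (n⁻¹ • t)) (by
        refine ContinuousLinearMap.opNorm_le_bound _ zero_le_one fun a => ?_
        simp only [ContinuousLinearMap.comp_apply, LinearIsometry.coe_toContinuousLinearMap,
          LinearIsometry.norm_map, smul_apply, norm_smul, norm_inv, one_mul,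
          Real.norm_of_nonneg hn0]
        rw [inv_mul_le_iff₀ h0]
        exact hle a)
    refine ⟨n • (P.comp T), fun a => ?_, ?_⟩
    · simp [hT, hPj, smul_smul, h0.ne']
    · refine ContinuousLinearMap.opNorm_le_bound _ hn0 fun a => ?_
      simp only [ContinuousLinearMap.comp_apply, smul_apply, norm_smul, Real.norm_of_nonneg hn0]
      refine mul_le_mul_of_nonneg_left ?_ hn0
      have h1 := P.le_of_opNorm_le hP (T a)
      have h2 := T.le_of_opNorm_le hT1 a
      linarith


/-- Bounded continuous functions, as a type synonym with clean instances. -/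
def BW (X : Type u) [TopologicalSpace X] : Type u := BoundedContinuousFunction X ℝ

namespace BW

variable {X : Type u} [TopologicalSpace X]

noncomputable instance : NormedAddCommGroup (BW X) :=
  inferInstanceAs (NormedAddCommGroup (BoundedContinuousFunction X ℝ))

noncomputable instance : NormedSpace ℝ (BW X) :=
  inferInstanceAs (NormedSpace ℝ (BoundedContinuousFunction X ℝ))

instance : CompleteSpace (BW X) := inferInstanceAs (CompleteSpace (BoundedContinuousFunction X ℝ))

instance : FunLike (BW X) X ℝ := inferInstanceAs (FunLike (BoundedContinuousFunction X ℝ) X ℝ)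

theorem ext' {f g : BW X} (h : ∀ x, f x = g x) : f = g := DFunLike.ext _ _ h

theorem add_apply (f g : BW X) (x : X) : (f + g) x = f x + g x := rfl

theorem smul_apply (c : ℝ) (f : BW X) (x : X) : (c • f) x = c * f x := rfl

theorem norm_le {f : BW X} {C : ℝ} (hC : 0 ≤ C) : ‖f‖ ≤ C ↔ ∀ x, |f x| ≤ C :=
  BoundedContinuousFunction.norm_le hC

theorem norm_coe_le (f : BW X) (x : X) : |f x| ≤ ‖f‖ :=
  BoundedContinuousFunction.norm_coe_le_norm f x

theorem dist_le {f g : BW X} {C : ℝ} (hC : 0 ≤ C) : dist f g ≤ C ↔ ∀ x, |f x - g x| ≤ C :=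
  BoundedContinuousFunction.dist_le hC

/-- Evaluation at a point. -/
noncomputable def evalL (x : X) : BW X →L[ℝ] ℝ :=
  LinearMap.mkContinuous
    { toFun := fun f => f x, map_add' := fun _ _ => rfl, map_smul' := fun _ _ => rfl } 1
    (fun f => by rw [one_mul]; exact norm_coe_le f x)

theorem evalL_apply (x : X) (f : BW X) : evalL x f = f x := rfl

end BW


/-- A code for a Banach space of density `< ℵ` with a closed subspace. -/
structure BCode (ℵ : Cardinal.{u}) : Type u where
  C : Set (Set (Set ℵ.out))
  [norm : NormedAddCommGroup C]
  [space : NormedSpace ℝ C]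
  [complete : CompleteSpace C]
  dens : DensityLT C ℵ
  A : Submodule ℝ C
  closed : IsClosed (A : Set C)

attribute [instance] BCode.norm BCode.space BCode.complete

theorem exists_code {ℵ : Cardinal.{u}} (B : BanachSpace.{u}) (hB : DensityLT B.carrier ℵ) :
    ∃ (C : BanachSpace.{u}) (_ : DensityLT C.carrier ℵ) (S : Set (Set (Set ℵ.out)))
      (_ : C.carrier = S), Nonempty (B.carrier ≃ₗᵢ[ℝ] C.carrier) := by
  obtain ⟨D, hD, hc⟩ := id hB
  obtain ⟨f⟩ : Nonempty (D ↪ ℵ.out) := by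
    rw [← Cardinal.le_def]
    simpa using hc.le
  let F : B.carrier → Set (Set ℵ.out) := fun b => {s | b ∈ closure {d | ∃ h : d ∈ D, f ⟨d, h⟩ ∈ s}}
  have hF : Function.Injective F := by
    intro b b' h
    by_contra hne
    obtain ⟨V, W, hV, hW, hb, hb', hVW⟩ := t2_separation hne
    let s : Set ℵ.out := {y | ∃ d : D, f d = y ∧ (d : B.carrier) ∈ V}
    have hs : {d | ∃ h : d ∈ D, f ⟨d, h⟩ ∈ s} = V ∩ D := by
      ext d
      constructor
      · rintro ⟨h, d', hd', hV'⟩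
        have := f.injective hd'
        subst this
        exact ⟨hV', h⟩
      · rintro ⟨h1, h2⟩
        exact ⟨h2, ⟨d, h2⟩, rfl, h1⟩
    have h1 : s ∈ F b := by
      change b ∈ closure _
      rw [hs]
      exact hD.open_subset_closure_inter hV hb
    rw [h] at h1
    change b' ∈ closure _ at h1
    rw [hs, mem_closure_iff] at h1
    obtain ⟨y, hy, hy', -⟩ := h1 W hW hb'
    exact Set.disjoint_left.1 hVW hy' hy
  let e : B.carrier ≃ Set.range F := Equiv.ofInjective F hF
  let i1 : NormedAddCommGroup (Set.range F) := e.symm.normedAddCommGroup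
  let i2 : NormedSpace ℝ (Set.range F) := e.symm.normedSpace ℝ
  let L : B.carrier ≃ₗᵢ[ℝ] Set.range F :=
    { e with
      map_add' := fun a b => by
        apply e.symm.injective
        change e.symm (e (a + b)) = e.symm (e.symm.symm (e.symm (e a) + e.symm (e b)))
        simp
      map_smul' := fun c b => by
        apply e.symm.injective
        change e.symm (e (c • b)) = e.symm (e.symm.symm (c • e.symm (e b)))
        simp
      norm_map' := fun b => by
        change ‖e.symm (e b)‖ = ‖b‖
        simp }
  have : CompleteSpace (Set.range F) :=
    L.toIsometryEquiv.completeSpace_iff.1 inferInstance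
  exact ⟨⟨Set.range F⟩, hB.of_denseRange L.continuous L.surjective.denseRange, Set.range F, rfl, ⟨L⟩⟩

theorem exists_bcode {ℵ : Cardinal.{u}} (B A : BanachSpace.{u}) (hB : DensityLT B.carrier ℵ)
    (i : A.carrier →ₗᵢ[ℝ] B.carrier) : ∃ (k : BCode ℵ) (e : B.carrier ≃ₗᵢ[ℝ] k.C)
      (a : A.carrier ≃ₗᵢ[ℝ] k.A), ∀ x, (a x : k.C) = e (i x) := by
  obtain ⟨⟨C⟩, hC, S, hS, ⟨e⟩⟩ := exists_code B hB
  dsimp only at *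
  subst hS
  let i' : A.carrier →ₗᵢ[ℝ] S := e.toLinearIsometry.comp i
  exact ⟨⟨S, hC, i'.toLinearMap.range, i'.isometry.isClosedEmbedding.isClosed_range⟩, e,
    i'.equivRange, fun x => rfl⟩

/-- Terms. -/
inductive Tm (ℵ : Cardinal.{u}) (E : BanachSpace.{u}) : Type u
  | of (e : E.carrier) : Tm ℵ E
  | lin (a b : ℝ) (s t : Tm ℵ E) : Tm ℵ E
  | lim (s : ℕ → Tm ℵ E) : Tm ℵ E
  | ext (k : BCode ℵ) (w : k.A → Tm ℵ E) (x : k.C) : Tm ℵ E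

namespace Tm

/-- Local validity of a valuation. -/
def Val {ℵ : Cardinal.{u}} {E : BanachSpace.{u}} : Tm ℵ E → (Tm ℵ E → ℝ) → Prop
  | of _ => fun v => ∃ h : E.carrier →L[ℝ] ℝ, ‖h‖ ≤ 1 ∧ ∀ e, v (of e) = h e
  | lin a b s t => fun v => Val s v ∧ Val t v ∧ v (lin a b s t) = a * v s + b * v t
  | lim s => fun v => (∀ n, Val (s n) v) ∧
      ((∀ ε > 0, ∃ N, ∀ m ≥ N, ∀ n ≥ N, ∀ v', (∀ n, Val (s n) v') → |v' (s m) - v' (s n)| ≤ ε) →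
        Filter.Tendsto (fun n => v (s n)) Filter.atTop (nhds (v (lim s)))) ∧
      (¬ (∀ ε > 0, ∃ N, ∀ m ≥ N, ∀ n ≥ N, ∀ v', (∀ n, Val (s n) v') →
          |v' (s m) - v' (s n)| ≤ ε) → v (lim s) = 0)
  | ext k w _ => fun v => (∀ a, Val (w a) v) ∧
      ((∀ v', (∀ a, Val (w a) v') → ∃ h : k.A →L[ℝ] ℝ, ‖h‖ ≤ 1 ∧ ∀ a, v' (w a) = h a) →
        ∃ g : k.C →L[ℝ] ℝ, ‖g‖ ≤ 1 ∧ (∀ x, v (ext k w x) = g x) ∧ ∀ a : k.A, v (w a) = g a) ∧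
      (¬ (∀ v', (∀ a, Val (w a) v') → ∃ h : k.A →L[ℝ] ℝ, ‖h‖ ≤ 1 ∧ ∀ a, v' (w a) = h a) →
        ∀ x, v (ext k w x) = 0)

variable {ℵ : Cardinal.{u}} {E : BanachSpace.{u}}

/-- A uniformly Cauchy sequence of terms. -/
def GoodLim (s : ℕ → Tm ℵ E) : Prop :=
  ∀ ε > 0, ∃ N, ∀ m ≥ N, ∀ n ≥ N, ∀ v', (∀ n, Val (s n) v') → |v' (s m) - v' (s n)| ≤ ε

/-- A contractive linear family of terms. -/
def GoodExt (k : BCode ℵ) (w : k.A → Tm ℵ E) : Prop :=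
  ∀ v', (∀ a, Val (w a) v') → ∃ h : k.A →L[ℝ] ℝ, ‖h‖ ≤ 1 ∧ ∀ a, v' (w a) = h a

theorem val_of (e : E.carrier) (v : Tm ℵ E → ℝ) :
    Val (of e) v ↔ ∃ h : E.carrier →L[ℝ] ℝ, ‖h‖ ≤ 1 ∧ ∀ e, v (of e) = h e := Iff.rfl

theorem val_lin (a b : ℝ) (s t : Tm ℵ E) (v : Tm ℵ E → ℝ) :
    Val (lin a b s t) v ↔ Val s v ∧ Val t v ∧ v (lin a b s t) = a * v s + b * v t := Iff.rfl

theorem val_lim (s : ℕ → Tm ℵ E) (v : Tm ℵ E → ℝ) :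
    Val (lim s) v ↔ (∀ n, Val (s n) v) ∧
      (GoodLim s → Filter.Tendsto (fun n => v (s n)) Filter.atTop (nhds (v (lim s)))) ∧
      (¬ GoodLim s → v (lim s) = 0) := Iff.rfl

theorem val_ext (k : BCode ℵ) (w : k.A → Tm ℵ E) (x : k.C) (v : Tm ℵ E → ℝ) :
    Val (ext k w x) v ↔ (∀ a, Val (w a) v) ∧
      (GoodExt k w →
        ∃ g : k.C →L[ℝ] ℝ, ‖g‖ ≤ 1 ∧ (∀ x, v (ext k w x) = g x) ∧ ∀ a : k.A, v (w a) = g a) ∧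
      (¬ GoodExt k w → ∀ x, v (ext k w x) = 0) := Iff.rfl

theorem Val.scale {c : ℝ} (hc : |c| ≤ 1) (t : Tm ℵ E) (v : Tm ℵ E → ℝ) (h : Val t v) :
    Val t (fun t => c * v t) := by
  have key : ∀ {A : Type u} [SeminormedAddCommGroup A] [NormedSpace ℝ A] (g : A →L[ℝ] ℝ),
      ‖g‖ ≤ 1 → ‖c • g‖ ≤ 1 := by
    intro A _ _ g hg
    rw [norm_smul]
    exact mul_le_one₀ hc (norm_nonneg _) hg
  induction t with
  | of e =>
    obtain ⟨h, h1, h2⟩ := h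
    exact ⟨c • h, key h h1, fun e => by simp [h2]⟩
  | lin a b s t ihs iht =>
    obtain ⟨h1, h2, h3⟩ := h
    exact ⟨ihs h1, iht h2, by simp only [h3]; ring⟩
  | lim s ih =>
    rw [val_lim] at h ⊢
    obtain ⟨h1, h2, h3⟩ := h
    exact ⟨fun n => ih n (h1 n), fun g => (h2 g).const_mul c, fun g => by simp [h3 g]⟩
  | ext k w x ih =>
    rw [val_ext] at h ⊢
    obtain ⟨h1, h2, h3⟩ := h
    refine ⟨fun n => ih n (h1 n), fun g => ?_, fun g x => by simp [h3 g]⟩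
    obtain ⟨g, hg1, hg2, hg3⟩ := h2 g
    exact ⟨c • g, key g hg1, fun x => by simp [hg2], fun a => by simp [hg3]⟩

theorem Val.bound (t : Tm ℵ E) : ∃ C, ∀ v, Val t v → |v t| ≤ C := by
  induction t with
  | of e =>
    refine ⟨‖e‖, ?_⟩
    rintro v ⟨h, h1, h2⟩
    rw [h2]; exact abs_le_of_norm_le_one h1 e
  | lin a b s t ihs iht =>
    obtain ⟨C, hC⟩ := ihs
    obtain ⟨D, hD⟩ := iht
    refine ⟨|a| * C + |b| * D, ?_⟩
    rintro v ⟨h1, h2, h3⟩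
    rw [h3]
    refine (abs_add_le _ _).trans ?_
    rw [abs_mul, abs_mul]
    gcongr
    · exact hC v h1
    · exact hD v h2
  | lim s ih =>
    by_cases hg : GoodLim s
    · obtain ⟨N, hN⟩ := hg 1 one_pos
      obtain ⟨C, hC⟩ := ih N
      refine ⟨C + 1, fun v hv => ?_⟩
      rw [val_lim] at hv
      obtain ⟨h1, h2, -⟩ := hv
      refine le_of_tendsto (h2 hg).abs ?_
      filter_upwards [Filter.eventually_ge_atTop N] with n hn
      have h3 := hN n hn N le_rfl v h1
      have h4 := hC v (h1 N)
      have h5 := abs_add_le (v (s n) - v (s N)) (v (s N))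
      rw [sub_add_cancel] at h5
      linarith
    · exact ⟨0, fun v hv => by rw [((val_lim s v).1 hv).2.2 hg, abs_zero]⟩
  | ext k w x ih =>
    by_cases hg : GoodExt k w
    · refine ⟨‖x‖, fun v hv => ?_⟩
      obtain ⟨g, hg1, hg2, hg3⟩ := ((val_ext k w x v).1 hv).2.1 hg
      rw [hg2]; exact abs_le_of_norm_le_one hg1 x
    · exact ⟨0, fun v hv => by rw [((val_ext k w x v).1 hv).2.2 hg, abs_zero]⟩

/-- Extension of partial `F`-valued valuations. -/
noncomputable def pext {F : Type v} [NormedAddCommGroup F] [NormedSpace ℝ F]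
    (P0 : Tm ℵ E → F) : Tm ℵ E → F
  | of e => by
      classical
      exact if ∀ φ : F →L[ℝ] ℝ, ‖φ‖ ≤ 1 → Val (of e) (fun t => φ (P0 t)) then P0 (of e) else 0
  | lin a b s t => a • pext P0 s + b • pext P0 t
  | lim s => by
      classical
      exact if GoodLim s then Filter.limUnder Filter.atTop (fun n => pext P0 (s n)) else 0
  | ext k w x => by
      classical
      exact if ∀ φ : F →L[ℝ] ℝ, ‖φ‖ ≤ 1 → Val (ext k w x) (fun t => φ (P0 t)) then P0 (ext k w x)
        else if h : GoodExt k w ∧ ∃ g : k.C →L[ℝ] F, ‖g‖ ≤ 1 ∧ ∀ a : k.A, pext P0 (w a) = g a then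
          h.2.choose x else 0

theorem pext_spec {F : Type v} [NormedAddCommGroup F] [NormedSpace ℝ F] [CompleteSpace F]
    (hF : ∀ (k : BCode ℵ) (t : k.A →L[ℝ] F), ∃ T : k.C →L[ℝ] F, (∀ a : k.A, T a = t a) ∧ ‖T‖ ≤ ‖t‖)
    (P0 : Tm ℵ E → F) (t : Tm ℵ E) :
    (∀ φ : F →L[ℝ] ℝ, ‖φ‖ ≤ 1 → Val t (fun t => φ (pext P0 t))) ∧
    ((∀ φ : F →L[ℝ] ℝ, ‖φ‖ ≤ 1 → Val t (fun t => φ (P0 t))) → pext P0 t = P0 t) := by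
  induction t with
  | of e =>
    by_cases hS : ∀ φ : F →L[ℝ] ℝ, ‖φ‖ ≤ 1 → Val (of e : Tm ℵ E) (fun t => φ (P0 t))
    · have h1 : ∀ e, pext P0 (of e : Tm ℵ E) = P0 (of e) := fun e => if_pos hS
      refine ⟨fun φ hφ => ?_, fun _ => h1 e⟩
      obtain ⟨h, h2, h3⟩ := hS φ hφ
      exact ⟨h, h2, fun e => by rw [← h3]; simp only [h1]⟩
    · have h1 : ∀ e, pext P0 (of e : Tm ℵ E) = 0 := fun e => if_neg hS
      exact ⟨fun φ hφ => ⟨0, by simp, fun e => by simp [h1]⟩, fun h => (hS h).elim⟩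
  | lin a b s t ihs iht =>
    refine ⟨fun φ hφ => ⟨ihs.1 φ hφ, iht.1 φ hφ, by simp [pext]⟩, fun h => ?_⟩
    have h1 : pext P0 s = P0 s := ihs.2 fun φ hφ => (h φ hφ).1
    have h2 : pext P0 t = P0 t := iht.2 fun φ hφ => (h φ hφ).2.1
    rw [pext, h1, h2]
    exact dual_sep fun φ hφ => by
      have := (h φ hφ).2.2
      simp only at this
      rw [this]; simp
  | lim s ih =>
    by_cases hg : GoodLim s
    · have hc : CauchySeq (fun n => pext P0 (s n)) := by
        rw [Metric.cauchySeq_iff]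
        intro ε hε
        obtain ⟨N, hN⟩ := hg (ε / 2) (half_pos hε)
        refine ⟨N, fun m hm n hn => lt_of_le_of_lt ?_ (half_lt_self hε)⟩
        rw [dist_eq_norm]
        refine dual_norm_le fun φ hφ => ?_
        rw [map_sub]
        exact hN m hm n hn (fun t => φ (pext P0 t)) fun n => (ih n).1 φ hφ
      have ht : Filter.Tendsto (fun n => pext P0 (s n)) Filter.atTop (nhds (pext P0 (lim s))) := by
        have : pext P0 (lim s) = Filter.limUnder Filter.atTop (fun n => pext P0 (s n)) := if_pos hg
        rw [this]
        exact CauchySeq.tendsto_limUnder hc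
      refine ⟨fun φ hφ => ?_, fun h => ?_⟩
      · rw [val_lim]
        exact ⟨fun n => (ih n).1 φ hφ, fun _ => (φ.continuous.tendsto _).comp ht,
          fun h => (h hg).elim⟩
      · have h1 : ∀ n, pext P0 (s n) = P0 (s n) := fun n => (ih n).2 fun φ hφ => (h φ hφ).1 n
        refine dual_sep fun φ hφ => ?_
        refine tendsto_nhds_unique ((φ.continuous.tendsto _).comp ht) ?_
        have h2 := ((val_lim _ _).1 (h φ hφ)).2.1 hg
        refine h2.congr fun n => ?_
        simp [h1]
    · have h0 : pext P0 (lim s) = 0 := if_neg hg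
      refine ⟨fun φ hφ => ?_, fun h => ?_⟩
      · rw [val_lim]
        exact ⟨fun n => (ih n).1 φ hφ, fun h => (hg h).elim, fun _ => by simp [h0]⟩
      · rw [h0]
        refine dual_sep fun φ hφ => ?_
        rw [map_zero]
        exact (((val_lim _ _).1 (h φ hφ)).2.2 hg).symm
  | ext k w x ih =>
    by_cases hS : ∀ φ : F →L[ℝ] ℝ, ‖φ‖ ≤ 1 → Val (ext k w x) (fun t => φ (P0 t))
    · have h1 : ∀ x, pext P0 (ext k w x) = P0 (ext k w x) := fun e => if_pos hS
      have h2 : ∀ a, pext P0 (w a) = P0 (w a) := fun a => (ih a).2 fun φ hφ => (hS φ hφ).1 a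
      refine ⟨fun φ hφ => ?_, fun _ => h1 x⟩
      rw [val_ext]
      simp only [h1, h2]
      exact ⟨fun a => (ih a).1 φ hφ, (hS φ hφ).2⟩
    · refine ⟨fun φ hφ => ?_, fun h => (hS h).elim⟩
      rw [val_ext]
      refine ⟨fun a => (ih a).1 φ hφ, fun hg => ?_, fun hg y => ?_⟩
      · have hex : ∃ g : k.C →L[ℝ] F, ‖g‖ ≤ 1 ∧ ∀ a : k.A, pext P0 (w a) = g a := by
          obtain ⟨Q, hQ1, hQ2⟩ := exists_clm_of_dual (fun a => pext P0 (w a)) fun φ hφ =>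
            hg (fun t => φ (pext P0 t)) fun a => (ih a).1 φ hφ
          obtain ⟨T, hT1, hT2⟩ := hF k Q
          exact ⟨T, hT2.trans hQ1, fun a => by rw [hT1, hQ2]⟩
        have h1 : ∀ x, pext P0 (ext k w x) = hex.choose x := fun x =>
          (if_neg hS).trans (dif_pos ⟨hg, hex⟩)
        refine ⟨φ.comp hex.choose, ?_, fun x => by simp [h1], fun a => ?_⟩
        · exact (φ.opNorm_comp_le _).trans (mul_le_one₀ hφ (norm_nonneg _) hex.choose_spec.1)
        · rw [hex.choose_spec.2 a]; rfl
      · have : pext P0 (ext k w y) = 0 := (if_neg hS).trans (dif_neg fun h => hg h.1)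
        rw [this, map_zero]

/-- Global valuations. -/
def All (ℵ : Cardinal.{u}) (E : BanachSpace.{u}) : Set (Tm ℵ E → ℝ) := {v | ∀ t, Val t v}

theorem exists_all (v0 : Tm ℵ E → ℝ) : ∃ v ∈ All ℵ E, ∀ t, Val t v0 → v t = v0 t := by
  have hF : ∀ (k : BCode ℵ) (t : k.A →L[ℝ] ℝ),
      ∃ T : k.C →L[ℝ] ℝ, (∀ a : k.A, T a = t a) ∧ ‖T‖ ≤ ‖t‖ := fun k t => by
    obtain ⟨g, h1, h2⟩ := exists_extension_norm_eq k.A t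
    exact ⟨g, h1, h2.le⟩
  refine ⟨pext v0, fun t => ?_, fun t ht => (pext_spec hF v0 t).2 fun φ hφ => ?_⟩
  · exact (pext_spec hF v0 t).1 (ContinuousLinearMap.id ℝ ℝ) ContinuousLinearMap.norm_id_le
  · have : (fun t => φ (v0 t)) = fun t => φ 1 * v0 t := by
      ext t
      have := φ.map_smul (v0 t) 1
      simp only [smul_eq_mul, mul_one] at this
      rw [this, mul_comm]
    rw [this]
    refine Val.scale ?_ t v0 ht
    simpa using abs_le_of_norm_le_one hφ (1 : ℝ)

/-- Rank of terms. -/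
noncomputable def rank : Tm ℵ E → Ordinal.{u}
  | of _ => 0
  | lin _ _ s t => max (rank s) (rank t) + 1
  | lim s => (⨆ n, rank (s n)) + 1
  | ext _ w _ => (⨆ a, rank (w a)) + 1

theorem rank_lim_lt (s : ℕ → Tm ℵ E) (n : ℕ) : rank (s n) < rank (lim s) := by
  rw [rank]
  exact Order.lt_add_one_iff.2 (Ordinal.le_iSup (fun n => rank (s n)) n)

theorem rank_ext_lt (k : BCode ℵ) (w : k.A → Tm ℵ E) (x : k.C) (a : k.A) :
    rank (w a) < rank (ext k w x) := by
  rw [rank]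
  exact Order.lt_add_one_iff.2 (Ordinal.le_iSup (fun n => rank (w n)) a)

theorem Val.congr {v v' : Tm ℵ E → ℝ} (t : Tm ℵ E) (h : ∀ t', rank t' ≤ rank t → v t' = v' t')
    (hv : Val t v) : Val t v' := by
  induction t with
  | of e =>
    obtain ⟨g, h1, h2⟩ := hv
    exact ⟨g, h1, fun e' => by rw [← h2]; exact (h (of e') le_rfl).symm⟩
  | lin a b s t ihs iht =>
    have hs : rank s ≤ rank (lin a b s t) := by
      rw [rank]; exact (le_max_left _ _).trans (Order.lt_add_one_iff.2 le_rfl).le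
    have ht : rank t ≤ rank (lin a b s t) := by
      rw [rank]; exact (le_max_right _ _).trans (Order.lt_add_one_iff.2 le_rfl).le
    obtain ⟨h1, h2, h3⟩ := hv
    refine ⟨ihs (fun t' ht' => h t' (ht'.trans hs)) h1, iht (fun t' ht' => h t' (ht'.trans ht)) h2, ?_⟩
    rw [← h _ le_rfl, ← h _ hs, ← h _ ht, h3]
  | lim s ih =>
    have hs := fun n => (rank_lim_lt s n).le
    rw [val_lim] at hv ⊢
    obtain ⟨h1, h2⟩ := hv
    refine ⟨fun n => ih n (fun t' ht' => h t' (ht'.trans (hs n))) (h1 n), ?_⟩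
    simpa only [h _ le_rfl, fun n => h _ (hs n)] using h2
  | ext k w x ih =>
    have hs := fun n => (rank_ext_lt k w x n).le
    rw [val_ext] at hv ⊢
    obtain ⟨h1, h2⟩ := hv
    refine ⟨fun n => ih n (fun t' ht' => h t' (ht'.trans (hs n))) (h1 n), ?_⟩
    have h3 : ∀ y, v (ext k w y) = v' (ext k w y) := fun y => h _ le_rfl
    simpa only [h3, fun n => h _ (hs n)] using h2


/-- Evaluation of a term on all valuations. -/
noncomputable def ev (t : Tm ℵ E) : BW (All ℵ E) :=
  BoundedContinuousFunction.ofNormedAddCommGroup (fun v : All ℵ E => v.1 t)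
    ((continuous_apply t).comp continuous_subtype_val) (Val.bound t).choose
    (fun v => (Val.bound t).choose_spec v.1 (v.2 t))

theorem ev_apply (t : Tm ℵ E) (v : All ℵ E) : ev t v = v.1 t := rfl

theorem ev_lin (a b : ℝ) (s t : Tm ℵ E) : ev (lin a b s t) = a • ev s + b • ev t := by
  refine BW.ext' fun v => ?_
  exact (v.2 (lin a b s t)).2.2

theorem all_of (v : All ℵ E) :
    ∃ h : E.carrier →L[ℝ] ℝ, ‖h‖ ≤ 1 ∧ ∀ e, v.1 (of e) = h e := v.2 (of 0)

/-- The linear map `E → U`. -/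
noncomputable def evOf (ℵ : Cardinal.{u}) (E : BanachSpace.{u}) :
    E.carrier →ₗᵢ[ℝ] BW (All ℵ E) where
  toFun e := ev (of e)
  map_add' a b := by
    refine BW.ext' fun v => ?_
    obtain ⟨h, -, h2⟩ := all_of v
    simp [BW.add_apply, BW.smul_apply, ev_apply, h2]
  map_smul' a b := by
    refine BW.ext' fun v => ?_
    obtain ⟨h, -, h2⟩ := all_of v
    simp [BW.add_apply, BW.smul_apply, ev_apply, h2]
  norm_map' e := by
    apply le_antisymm
    · refine (BW.norm_le (norm_nonneg _)).2 fun v => ?_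
      obtain ⟨h, h1, h2⟩ := all_of v
      have : (ev (of e : Tm ℵ E)) v = h e := h2 e
      change |(ev (of e : Tm ℵ E)) v| ≤ ‖e‖
      rw [this]
      exact abs_le_of_norm_le_one h1 e
    · obtain ⟨h, h1, h2⟩ := exists_dual_vector'' ℝ e
      obtain ⟨v, hv, hv'⟩ := exists_all (fun t : Tm ℵ E => match t with
        | of e => h e
        | _ => 0)
      have h3 := hv' (of e) ⟨h, h1, fun e => rfl⟩
      have h4 := (ev (of e)).norm_coe_le (⟨v, hv⟩ : All ℵ E)
      have h5 : v (of e) = ‖e‖ := h3.trans h2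
      change |v (of e)| ≤ _ at h4
      rw [h5] at h4
      simpa using h4

theorem goodLim_of_cauchy {s : ℕ → Tm ℵ E} (h : CauchySeq fun n => ev (s n)) : GoodLim s := by
  intro ε hε
  obtain ⟨N, hN⟩ := Metric.cauchySeq_iff.1 h ε hε
  refine ⟨N, fun m hm n hn v' hv' => ?_⟩
  obtain ⟨v, hv, hvv⟩ := exists_all v'
  rw [← hvv _ (hv' m), ← hvv _ (hv' n)]
  exact (BW.dist_le hε.le).1 (hN m hm n hn).le (⟨v, hv⟩ : All ℵ E)

theorem tendsto_of_goodLim {s : ℕ → Tm ℵ E} (h : GoodLim s) :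
    Filter.Tendsto (fun n => ev (s n)) Filter.atTop (nhds (ev (lim s))) := by
  have hc : CauchySeq fun n => ev (s n) := by
    rw [Metric.cauchySeq_iff]
    intro ε hε
    obtain ⟨N, hN⟩ := h (ε / 2) (half_pos hε)
    refine ⟨N, fun m hm n hn => lt_of_le_of_lt ?_ (half_lt_self hε)⟩
    exact (BW.dist_le (half_pos hε).le).2 fun v =>
      hN m hm n hn v.1 fun n => v.2 (s n)
  obtain ⟨y, hy⟩ := cauchySeq_tendsto_of_complete hc
  have : ev (lim s) = y := by
    refine BW.ext' fun v => ?_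
    have h1 := ((val_lim s v.1).1 (v.2 (lim s))).2.1 h
    refine tendsto_nhds_unique h1 ?_
    exact ((BW.evalL v).continuous.tendsto _).comp hy
  rwa [this]

/-- The space of evaluations of terms. -/
noncomputable def USub (ℵ : Cardinal.{u}) (E : BanachSpace.{u}) :
    Submodule ℝ (BW (All ℵ E)) where
  carrier := Set.range ev
  add_mem' := by
    rintro _ _ ⟨s, rfl⟩ ⟨t, rfl⟩
    exact ⟨lin 1 1 s t, by simp [ev_lin]⟩
  zero_mem' := ⟨of 0, (evOf ℵ E).map_zero⟩
  smul_mem' := by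
    rintro c _ ⟨s, rfl⟩
    exact ⟨lin c 0 s s, by simp [ev_lin]⟩

theorem USub_closed : IsClosed (USub ℵ E : Set (BW (All ℵ E))) := by
  refine isClosed_of_closure_subset fun x hx => ?_
  obtain ⟨y, hy, hlim⟩ := mem_closure_iff_seq_limit.1 hx
  choose s hs using hy
  have hs' : Filter.Tendsto (fun n => ev (s n)) Filter.atTop (nhds x) := by
    simpa only [hs] using hlim
  have := tendsto_of_goodLim (goodLim_of_cauchy hs'.cauchySeq)
  exact ⟨lim s, tendsto_nhds_unique this hs'⟩

instance : CompleteSpace (USub ℵ E) := USub_closed.completeSpace_coe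

/-- Evaluation as an element of `USub`. -/
noncomputable def evU (t : Tm ℵ E) : USub ℵ E := ⟨ev t, t, rfl⟩

/-- Evaluation at a valuation as a functional. -/
theorem exists_evalU (v : All ℵ E) :
    ∃ h : USub ℵ E →L[ℝ] ℝ, ‖h‖ ≤ 1 ∧ ∀ x : USub ℵ E, x.1 v = h x := by
  refine ⟨(BW.evalL v).comp (USub ℵ E).subtypeL, ?_, fun x => rfl⟩
  refine ContinuousLinearMap.opNorm_le_bound _ zero_le_one fun x => ?_
  rw [one_mul]
  exact x.1.norm_coe_le v

theorem exists_proj (hE : IsInjective1 ℵ E) : ∃ P : USub ℵ E →L[ℝ] E.carrier,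
    ‖P‖ ≤ 1 ∧ ∀ e, P (evU (of e)) = e := by
  have hF : ∀ (k : BCode ℵ) (t : k.A →L[ℝ] E.carrier),
      ∃ T : k.C →L[ℝ] E.carrier, (∀ a : k.A, T a = t a) ∧ ‖T‖ ≤ ‖t‖ :=
    fun k t => hE ⟨k.C⟩ k.dens k.A k.closed t
  let P0 : Tm ℵ E → E.carrier := fun t => match t with
        | of e => e
        | _ => 0
  have hall : ∀ φ : E.carrier →L[ℝ] ℝ, ‖φ‖ ≤ 1 → (fun t => φ (pext P0 t)) ∈ All ℵ E :=
    fun φ hφ t => (pext_spec hF P0 t).1 φ hφ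
  have hof : ∀ e, pext P0 (of e) = e := fun e =>
    (pext_spec hF P0 (of e)).2 fun φ hφ => ⟨φ, hφ, fun e => rfl⟩
  have hev : ∀ x : USub ℵ E, ev x.2.choose = x.1 := fun x => x.2.choose_spec
  have key : ∀ (φ : E.carrier →L[ℝ] ℝ) (hφ : ‖φ‖ ≤ 1) (x : USub ℵ E),
      φ (pext P0 x.2.choose) = x.1 ⟨_, hall φ hφ⟩ := fun φ hφ x => by
    conv_rhs => rw [← hev x]
    rfl
  obtain ⟨Q, hQ1, hQ2⟩ := exists_clm_of_dual (fun x : USub ℵ E => pext P0 x.2.choose)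
    fun φ hφ => by
      obtain ⟨h, h1, h2⟩ := exists_evalU ⟨_, hall φ hφ⟩
      exact ⟨h, h1, fun x => by rw [← h2, key φ hφ]⟩
  refine ⟨Q, hQ1, fun e => ?_⟩
  rw [hQ2]
  refine dual_sep fun φ hφ => ?_
  rw [key φ hφ]
  change φ (pext P0 (of e)) = φ e
  rw [hof]

/-- For a good family, the extension is a contraction. -/
theorem exists_extCLM {k : BCode ℵ} {w : k.A → Tm ℵ E} (hg : GoodExt k w) :
    ∃ L : k.C →L[ℝ] USub ℵ E, ‖L‖ ≤ 1 ∧ (∀ x, L x = evU (ext k w x)) ∧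
      ∀ a : k.A, L a = evU (w a) := by
  have hv : ∀ v : All ℵ E, ∃ g : k.C →L[ℝ] ℝ, ‖g‖ ≤ 1 ∧ (∀ x, v.1 (ext k w x) = g x) ∧
      ∀ a : k.A, v.1 (w a) = g a := fun v => ((val_ext k w 0 v.1).1 (v.2 _)).2.1 hg
  let L0 : k.C →ₗ[ℝ] USub ℵ E :=
    { toFun := fun x => evU (ext k w x)
      map_add' := fun x y => by
        apply Subtype.ext
        refine BW.ext' fun v => ?_
        obtain ⟨g, -, h, -⟩ := hv v
        change v.1 (ext k w (x + y)) = v.1 (ext k w x) + v.1 (ext k w y)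
        simp [h]
      map_smul' := fun c x => by
        apply Subtype.ext
        refine BW.ext' fun v => ?_
        obtain ⟨g, -, h, -⟩ := hv v
        change v.1 (ext k w (c • x)) = c * v.1 (ext k w x)
        simp [h] }
  have hL : ∀ x, ‖L0 x‖ ≤ 1 * ‖x‖ := fun x => by
    rw [one_mul]
    refine (BW.norm_le (norm_nonneg _)).2 fun v => ?_
    obtain ⟨g, h1, h, -⟩ := hv v
    change |v.1 (ext k w x)| ≤ _
    rw [h]
    exact abs_le_of_norm_le_one h1 x
  refine ⟨L0.mkContinuous 1 hL, L0.mkContinuous_norm_le zero_le_one hL, fun x => rfl, fun a => ?_⟩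
  apply Subtype.ext
  refine BW.ext' fun v => ?_
  obtain ⟨g, -, h, h'⟩ := hv v
  change v.1 (ext k w a) = v.1 (w a)
  rw [h, h']

theorem functional_val {H : USub ℵ E →L[ℝ] ℝ} (hH : ‖H‖ ≤ 1) (t : Tm ℵ E) :
    Val t (fun t => H (evU t)) := by
  induction t with
  | of e =>
    let J : E.carrier →ₗᵢ[ℝ] USub ℵ E :=
      ⟨(evOf ℵ E).toLinearMap.codRestrict (USub ℵ E) (fun e => ⟨of e, rfl⟩), (evOf ℵ E).norm_map⟩
    refine ⟨H.comp J.toContinuousLinearMap, ?_, fun e => rfl⟩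
    refine ContinuousLinearMap.opNorm_le_bound _ zero_le_one fun x => ?_
    have := H.le_of_opNorm_le hH (J x)
    rwa [J.norm_map] at this
  | lin a b s t ihs iht =>
    refine ⟨ihs, iht, ?_⟩
    have : evU (lin a b s t) = a • evU s + b • evU t := Subtype.ext (ev_lin a b s t)
    simp only [this, map_add, map_smul, smul_eq_mul]
  | lim s ih =>
    rw [val_lim]
    refine ⟨ih, fun hg => ?_, fun hg => ?_⟩
    · refine (H.continuous.tendsto _).comp ?_
      rw [tendsto_subtype_rng]
      exact tendsto_of_goodLim hg
    · have : evU (lim s) = 0 := by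
        apply Subtype.ext
        refine BW.ext' fun v => ?_
        exact ((val_lim s v.1).1 (v.2 (lim s))).2.2 hg
      simp only [this, map_zero]
  | ext k w x ih =>
    rw [val_ext]
    refine ⟨ih, fun hg => ?_, fun hg y => ?_⟩
    · obtain ⟨L, h1, h2, h3⟩ := exists_extCLM hg
      refine ⟨H.comp L, ?_, fun x => by simp [h2], fun a => by simp [h3]⟩
      exact (H.opNorm_comp_le L).trans (mul_le_one₀ hH (norm_nonneg _) h1)
    · have : evU (ext k w y) = 0 := by
        apply Subtype.ext
        refine BW.ext' fun v => ?_
        exact ((val_ext k w y v.1).1 (v.2 (ext k w y))).2.2 hg y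
      simp only [this, map_zero]

theorem univDisp (ℵ : Cardinal.{u}) (E : BanachSpace.{u}) : IsUnivDispDensLT ℵ ⟨USub ℵ E⟩ := by
  classical
  intro A B _ hB u i
  change A.carrier →ₗᵢ[ℝ] USub ℵ E at u
  change ∃ u' : B.carrier →ₗᵢ[ℝ] USub ℵ E, ∀ a : A.carrier, u' (i a) = u a
  obtain ⟨k, e, r, hr⟩ := exists_bcode B A hB i
  let w : k.A → Tm ℵ E := fun a => (u (r.symm a)).2.choose
  have hw : ∀ a, evU (w a) = u (r.symm a) := fun a =>
    Subtype.ext (u (r.symm a)).2.choose_spec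
  have hg : GoodExt k w := by
    intro v' hv'
    obtain ⟨v, hv, hvv⟩ := exists_all v'
    obtain ⟨h, h1, h2⟩ := exists_evalU ⟨v, hv⟩
    refine ⟨h.comp (u.comp r.symm.toLinearIsometry).toContinuousLinearMap, ?_, fun a => ?_⟩
    · refine ContinuousLinearMap.opNorm_le_bound _ zero_le_one fun x => ?_
      have := h.le_of_opNorm_le h1 (u (r.symm x))
      rwa [u.norm_map, r.symm.norm_map] at this
    · rw [← hvv _ (hv' a)]
      change v (w a) = h (u (r.symm a))
      rw [← hw, ← h2]
      rfl
  obtain ⟨L, hL1, hL2, hL3⟩ := exists_extCLM hg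
  have hiso : ∀ x, ‖L x‖ = ‖x‖ := by
    intro x
    apply le_antisymm
    · simpa using L.le_of_opNorm_le hL1 x
    obtain ⟨g, hg1, hg2⟩ := exists_dual_vector'' ℝ x
    let f : u.toLinearMap.range →L[ℝ] ℝ := (g.comp k.A.subtypeL).comp
      (r.toLinearIsometry.comp u.equivRange.symm.toLinearIsometry).toContinuousLinearMap
    have hf : ‖f‖ ≤ 1 := by
      refine ContinuousLinearMap.opNorm_le_bound _ zero_le_one fun y => ?_
      have h1 := g.le_of_opNorm_le hg1 (r (u.equivRange.symm y) : k.C)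
      have h2 : ‖(r (u.equivRange.symm y) : k.C)‖ = ‖y‖ :=
        (r.norm_map _).trans (u.equivRange.symm.norm_map _)
      rwa [h2] at h1
    obtain ⟨H, hH1, hH2⟩ := exists_extension_norm_eq _ f
    have hH : ‖H‖ ≤ 1 := hH2.le.trans hf
    have hHu : ∀ a : k.A, H (evU (w a)) = g a := by
      intro a
      rw [hw]
      have h1 := hH1 (u.equivRange (r.symm a))
      have h2 : f (u.equivRange (r.symm a)) = g a := by
        change g (r (u.equivRange.symm (u.equivRange (r.symm a))) : k.C) = g a
        rw [u.equivRange.symm_apply_apply, r.apply_symm_apply]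
      rw [h2] at h1
      exact h1
    let v0 : Tm ℵ E → ℝ := fun t =>
      if h : ∃ y, t = ext k w y then g h.choose else H (evU t)
    have hv0 : ∀ y, v0 (ext k w y) = g y := by
      intro y
      have hex : ∃ z, ext k w y = ext k w z := ⟨y, rfl⟩
      have h1 : v0 (ext k w y) = g hex.choose := dif_pos hex
      have h2 := hex.choose_spec
      rw [h1]
      have h3 : y = hex.choose := by
        injection h2
      rw [← h3]
    have hv0' : ∀ t, rank t < rank (ext k w 0) → v0 t = H (evU t) := by
      intro t ht
      refine dif_neg ?_
      rintro ⟨y, rfl⟩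
      exact lt_irrefl _ ht
    have hval : Val (ext k w x) v0 := by
      rw [val_ext]
      refine ⟨fun a => ?_, fun _ => ⟨g, hg1, hv0, fun a => ?_⟩, fun h => (h hg).elim⟩
      · exact Val.congr (w a) (fun t' ht' =>
          (hv0' t' (ht'.trans_lt (rank_ext_lt k w 0 a))).symm) (functional_val hH (w a))
      · rw [hv0' _ (rank_ext_lt k w 0 a), hHu]
    obtain ⟨v, hv, hvv⟩ := exists_all v0
    have h1 := hvv _ hval
    rw [hv0, hg2] at h1
    have h2 := (ev (ext k w x)).norm_coe_le (⟨v, hv⟩ : All ℵ E)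
    change |v (ext k w x)| ≤ _ at h2
    rw [h1] at h2
    rw [hL2]
    have h3 : ‖x‖ ≤ ‖ev (ext k w x)‖ := by simpa using h2
    exact h3
  refine ⟨(⟨L.toLinearMap, hiso⟩ : k.C →ₗᵢ[ℝ] USub ℵ E).comp e.toLinearIsometry, fun a => ?_⟩
  change L (e (i a)) = u a
  rw [← hr, hL3, hw, r.symm_apply_apply]

end Tm


/-- For an uncountable cardinal `ℵ`, a Banach space is `(1, ℵ)`-injective iff it is a
`1`-complemented subspace of a Banach space of `𝒮_ℵ`-universal disposition. -/
theorem injective1_iff_oneComplemented_univDispDensLT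
    (ℵ : Cardinal.{u}) (hℵ : Cardinal.aleph0 < ℵ) (E : BanachSpace.{u}) :
    IsInjective1 ℵ E ↔
      ∃ U : BanachSpace.{u}, IsUnivDispDensLT ℵ U ∧
        ∃ (j : E.carrier →ₗᵢ[ℝ] U.carrier) (P : U.carrier →L[ℝ] E.carrier),
          ‖P‖ ≤ 1 ∧ ∀ x : E.carrier, P (j x) = x := by

  constructor
  · intro hE
    obtain ⟨P, hP1, hP2⟩ := Tm.exists_proj hE
    let J : E.carrier →ₗᵢ[ℝ] Tm.USub ℵ E :=
      ⟨(Tm.evOf ℵ E).toLinearMap.codRestrict (Tm.USub ℵ E) (fun e => ⟨Tm.of e, rfl⟩),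
        (Tm.evOf ℵ E).norm_map⟩
    exact ⟨⟨Tm.USub ℵ E⟩, Tm.univDisp ℵ E, J, P, hP1, hP2⟩
  · rintro ⟨U, hU, j, P, hP, hPj⟩
    exact backward_dir hℵ hU j P hP hPj
end

section
/- Let α ≤ β be infinite cardinals. A Banach space E is (α, β)₁-injective if and only if E is a 1-complemented subspace of some Banach space of (α, β)-universal disposition; that is, if and only if there exist a Banach space U of (α, β)-universal disposition, a linear isometric embedding j : E → U, and a bounded linear operator P : U → E with ‖P‖ ≤ 1 and P ∘ j = id_E. -/
/-- `E` is `(α, β)₁`-injective: for every Banach space `B` with density character `< β` and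
every closed subspace `A ⊆ B` of density character `< α`, every operator `t : A → E`
extends to `T : B → E` with `‖T‖ ≤ ‖t‖`. -/
def IsABInjective1 (α β : Cardinal.{u}) (E : BanachSpace.{u}) : Prop :=
  ∀ B : BanachSpace.{u}, DensityLT B.carrier β →
    ∀ A : Submodule ℝ B.carrier, IsClosed (A : Set B.carrier) → DensityLT A α →
      ∀ t : A →L[ℝ] E.carrier, ∃ T : B.carrier →L[ℝ] E.carrier,
        (∀ a : A, T (a : B.carrier) = t a) ∧ ‖T‖ ≤ ‖t‖

/-- `U` is of `(α, β)`-universal disposition: given Banach spaces `A` of density character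
`< α` and `B` of density character `< β` and isometric embeddings `u : A → U`, `i : A → B`,
there is an isometric embedding `u' : B → U` with `u' ∘ i = u`. -/
def IsABUnivDisp (α β : Cardinal.{u}) (U : BanachSpace.{u}) : Prop :=
  ∀ A B : BanachSpace.{u}, DensityLT A.carrier α → DensityLT B.carrier β →
    ∀ (u : A.carrier →ₗᵢ[ℝ] U.carrier) (i : A.carrier →ₗᵢ[ℝ] B.carrier),
      ∃ u' : B.carrier →ₗᵢ[ℝ] U.carrier, ∀ a : A.carrier, u' (i a) = u a

open scoped ENNReal

/-- Contractive data on a family extend to the span of the family. -/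
theorem exists_span_map {κ B W : Type*} [NormedAddCommGroup B] [NormedSpace ℝ B]
    [NormedAddCommGroup W] [NormedSpace ℝ W] (g : κ → B) (h : κ → W)
    (dom : ∀ c : κ →₀ ℝ, ‖Finsupp.linearCombination ℝ h c‖ ≤ ‖Finsupp.linearCombination ℝ g c‖) :
    ∃ L : Submodule.span ℝ (Set.range g) →L[ℝ] W, ‖L‖ ≤ 1 ∧
      ∀ k (hk : g k ∈ Submodule.span ℝ (Set.range g)), L ⟨g k, hk⟩ = h k := by
  have hr : ∀ x : Submodule.span ℝ (Set.range g), ∃ c : κ →₀ ℝ,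
      Finsupp.linearCombination ℝ g c = x := by
    intro x
    have := x.2
    rwa [Finsupp.mem_span_range_iff_exists_finsupp] at this
  choose σ hσ using hr
  have key : ∀ (c d : κ →₀ ℝ), Finsupp.linearCombination ℝ g c = Finsupp.linearCombination ℝ g d →
      Finsupp.linearCombination ℝ h c = Finsupp.linearCombination ℝ h d := by
    intro c d hcd
    have := dom (c - d)
    rw [map_sub, map_sub, hcd, sub_self, norm_zero, norm_le_zero_iff, sub_eq_zero] at this
    exact this
  let L0 : Submodule.span ℝ (Set.range g) →ₗ[ℝ] W :=
    { toFun := fun x => Finsupp.linearCombination ℝ h (σ x)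
      map_add' := by
        intro x y
        rw [← map_add]
        apply key
        rw [map_add, hσ, hσ, hσ]; rfl
      map_smul' := by
        intro r x
        rw [RingHom.id_apply, ← map_smul]
        apply key
        rw [map_smul, hσ, hσ]; rfl }
  refine ⟨L0.mkContinuous 1 ?_, LinearMap.mkContinuous_norm_le _ zero_le_one _, ?_⟩
  · intro x
    have := dom (σ x)
    rw [hσ] at this
    simpa [L0] using this
  · intro k hk
    have : Finsupp.linearCombination ℝ h (σ ⟨g k, hk⟩)
        = Finsupp.linearCombination ℝ h (Finsupp.single k 1) := by
      apply key
      rw [hσ]; simp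
    simpa [L0] using this

/-- Hahn-Banach for families. -/
theorem hb_family {κ B : Type*} [NormedAddCommGroup B] [NormedSpace ℝ B] (g : κ → B) (h : κ → ℝ)
    (dom : ∀ c : κ →₀ ℝ, ‖Finsupp.linearCombination ℝ h c‖ ≤ ‖Finsupp.linearCombination ℝ g c‖) :
    ∃ H : B →L[ℝ] ℝ, ‖H‖ ≤ 1 ∧ ∀ k, H (g k) = h k := by
  obtain ⟨L, hL, hLk⟩ := exists_span_map g h dom
  obtain ⟨H, hH, hn⟩ := exists_extension_norm_eq _ L
  refine ⟨H, hn ▸ hL, fun k => ?_⟩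
  have hk : g k ∈ Submodule.span ℝ (Set.range g) := Submodule.subset_span ⟨k, rfl⟩
  rw [← hLk k hk, ← hH ⟨g k, hk⟩]

/-- The operator into `ℓ∞` with prescribed coordinates. -/
theorem exists_linf {Γ B : Type*} [NormedAddCommGroup B] [NormedSpace ℝ B] (f : Γ → B →L[ℝ] ℝ)
    (C : ℝ) (hC : 0 ≤ C) (hf : ∀ γ, ‖f γ‖ ≤ C) :
    ∃ T : B →L[ℝ] lp (fun _ : Γ => ℝ) ∞, ‖T‖ ≤ C ∧ ∀ b γ, (T b : Γ → ℝ) γ = f γ b := by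
  have hb : ∀ b γ, ‖f γ b‖ ≤ C * ‖b‖ := fun b γ =>
    ((f γ).le_opNorm b).trans (by gcongr; exact hf γ)
  let T0 : B →ₗ[ℝ] lp (fun _ : Γ => ℝ) ∞ :=
    { toFun := fun b => ⟨fun γ => f γ b, memℓp_infty ⟨C * ‖b‖, by rintro _ ⟨γ, rfl⟩; exact hb b γ⟩⟩
      map_add' := by intro x y; ext γ; simp; try rfl
      map_smul' := by intro r x; ext γ; simp }
  refine ⟨T0.mkContinuous C ?_, LinearMap.mkContinuous_norm_le _ hC _, fun b γ => rfl⟩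
  intro b
  exact lp.norm_le_of_forall_le (by positivity) (fun γ => hb b γ)

/-- Isometric embedding into `ℓ∞(Γ)` of a space with a dense subset indexed by `Γ`. -/
theorem exists_embed_linf {Γ B : Type*} [NormedAddCommGroup B] [NormedSpace ℝ B] (d : Γ → B)
    (hd : DenseRange d) : Nonempty (B →ₗᵢ[ℝ] lp (fun _ : Γ => ℝ) ∞) := by
  choose φ hφ hφd using fun γ => exists_dual_vector'' ℝ (d γ)
  obtain ⟨T, hT, hTγ⟩ := exists_linf φ 1 zero_le_one hφ
  refine ⟨⟨T.toLinearMap, fun b => ?_⟩⟩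
  have : ∀ b, ‖T b‖ = ‖b‖ := by
    intro b
    refine hd.induction_on (p := fun b => ‖T b‖ = ‖b‖) b
      (isClosed_eq T.continuous.norm continuous_norm) ?_
    intro γ
    apply le_antisymm
    · exact (T.le_of_opNorm_le hT _).trans (by simp)
    · have h1 := lp.norm_apply_le_norm (E := fun _ : Γ => ℝ) ENNReal.top_ne_zero (T (d γ)) γ
      rw [hTγ, hφd] at h1
      simpa using h1
  exact this b

theorem densityLT_closure_range {A X : Type u} [NormedAddCommGroup A] [NormedSpace ℝ A]
    [NormedAddCommGroup X] [NormedSpace ℝ X] (f : A →L[ℝ] X) {κ : Cardinal.{u}}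
    (hA : DensityLT A κ) : DensityLT (LinearMap.range f.toLinearMap).topologicalClosure κ := by
  obtain ⟨s, hs, hc⟩ := hA
  let F : A → (LinearMap.range f.toLinearMap).topologicalClosure := fun a =>
    ⟨f a, Submodule.le_topologicalClosure _ ⟨a, rfl⟩⟩
  have hFc : Continuous F := by fun_prop
  have hF : DenseRange F := by
    intro x
    rw [closure_subtype]
    have h2 : (Subtype.val '' Set.range F) = (LinearMap.range f.toLinearMap : Set X) := by
      ext y
      constructor
      · rintro ⟨_, ⟨a, rfl⟩, rfl⟩
        exact ⟨a, rfl⟩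
      · rintro ⟨a, rfl⟩
        exact ⟨_, ⟨a, rfl⟩, rfl⟩
    rw [h2]
    exact x.2
  exact ⟨F '' s, hF.dense_image hFc hs, Cardinal.mk_image_le.trans_lt hc⟩

theorem backward (α β : Cardinal.{u}) (E U : BanachSpace.{u}) (hU : IsABUnivDisp α β U)
    (j : E.carrier →ₗᵢ[ℝ] U.carrier) (P : U.carrier →L[ℝ] E.carrier) (hP : ‖P‖ ≤ 1)
    (hPj : ∀ x : E.carrier, P (j x) = x) : IsABInjective1 α β E := by
  intro B hB A hA hAd t
  obtain ⟨e⟩ := exists_embed_linf (id : U.carrier → U.carrier) denseRange_id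
  let jt : A →L[ℝ] U.carrier := j.toContinuousLinearMap.comp t
  have hjt : ∀ a, jt a = j (t a) := fun a => rfl
  -- extend coordinatewise
  have hcoord : ∀ γ : U.carrier, ∃ f : B.carrier →L[ℝ] ℝ, ‖f‖ ≤ ‖t‖ ∧
      ∀ a : A, f a = (e (jt a) : U.carrier → ℝ) γ := by
    intro γ
    let f0 : A →ₗ[ℝ] ℝ :=
      { toFun := fun a => (e (jt a) : U.carrier → ℝ) γ
        map_add' := by intro x y; simp
        map_smul' := by intro r x; simp }
    have hf0 : ∀ a, ‖f0 a‖ ≤ ‖t‖ * ‖a‖ := by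
      intro a
      have h1 := lp.norm_apply_le_norm (E := fun _ : U.carrier => ℝ) ENNReal.top_ne_zero
        (e (jt a)) γ
      refine h1.trans ?_
      rw [e.norm_map, hjt, j.norm_map]
      exact t.le_opNorm a
    obtain ⟨f, hf, hfn⟩ := exists_extension_norm_eq A (f0.mkContinuous _ hf0)
    exact ⟨f, hfn ▸ LinearMap.mkContinuous_norm_le _ (norm_nonneg t) _, fun a => hf a⟩
  choose f hfn hf using hcoord
  obtain ⟨S, hS, hSγ⟩ := exists_linf f ‖t‖ (norm_nonneg t) hfn
  have hSA : ∀ a : A, S a = e (jt a) := by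
    intro a
    ext γ
    rw [hSγ, hf]
  let A' : Submodule ℝ U.carrier := (LinearMap.range jt.toLinearMap).topologicalClosure
  let B' : Submodule ℝ (lp (fun _ : U.carrier => ℝ) ∞) :=
    (LinearMap.range S.toLinearMap).topologicalClosure
  have : CompleteSpace A' := (Submodule.isClosed_topologicalClosure _).completeSpace_coe
  have : CompleteSpace B' := (Submodule.isClosed_topologicalClosure _).completeSpace_coe
  have hmem : ∀ x ∈ A', e x ∈ B' := by
    intro x hx
    have hc : IsClosed (e ⁻¹' (B' : Set (lp (fun _ : U.carrier => ℝ) ∞))) :=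
      (Submodule.isClosed_topologicalClosure _).preimage e.continuous
    have : (LinearMap.range jt.toLinearMap).topologicalClosure ≤ B'.comap e.toLinearMap := by
      refine Submodule.topologicalClosure_minimal _ ?_ hc
      rintro _ ⟨a, rfl⟩
      exact Submodule.le_topologicalClosure _ ⟨(a : B.carrier), hSA a⟩
    exact this hx
  let i : A' →ₗᵢ[ℝ] B' := ⟨e.toLinearMap.restrict hmem, fun x => e.norm_map x⟩
  obtain ⟨u', hu'⟩ := hU ⟨A'⟩ ⟨B'⟩ (densityLT_closure_range jt hAd)
    (densityLT_closure_range S hB) A'.subtypeₗᵢ i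
  let S' : B.carrier →L[ℝ] B' := S.codRestrict B' fun b =>
    Submodule.le_topologicalClosure _ ⟨b, rfl⟩
  refine ⟨(P.comp u'.toContinuousLinearMap).comp S', ?_, ?_⟩
  · intro a
    have hx : jt a ∈ A' := Submodule.le_topologicalClosure _ ⟨a, rfl⟩
    have h1 : S' a = i ⟨jt a, hx⟩ := Subtype.ext (hSA a)
    have h2 := hu' ⟨jt a, hx⟩
    change P (u' (S' a)) = t a
    rw [h1]
    exact (congrArg P h2).trans (hPj _)
  · refine ContinuousLinearMap.opNorm_le_bound _ (norm_nonneg t) fun b => ?_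
    change ‖P (u' (S' b))‖ ≤ _
    refine (P.le_of_opNorm_le hP _).trans ?_
    rw [one_mul, u'.norm_map]
    exact S.le_of_opNorm_le hS b

/-- Extension property of a pair (`S ⊆ B`) with respect to `W`. -/
def ExtProp (B : Type*) [NormedAddCommGroup B] [NormedSpace ℝ B] (S : Set B)
    (W : Type*) [NormedAddCommGroup W] [NormedSpace ℝ W] : Prop :=
  ∀ h : S → W, (∀ c : S →₀ ℝ, ‖Finsupp.linearCombination ℝ h c‖ ≤
    ‖Finsupp.linearCombination ℝ (Subtype.val : S → B) c‖) →
    ∃ H : B →L[ℝ] W, ‖H‖ ≤ 1 ∧ ∀ s : S, H s = h s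

section Construction

variable {ι : Type u} (Y : ι → Type u) [∀ i, NormedAddCommGroup (Y i)] [∀ i, NormedSpace ℝ (Y i)]
  (S : ∀ i, Set (Y i)) (E : Type u) [NormedAddCommGroup E] [NormedSpace ℝ E]

/-- Terms generating the universal space. -/
inductive Tm_s4 : Type u where
  | of : E → Tm_s4
  | gen : (i : ι) → (S i → Tm_s4) → Y i → Tm_s4

variable {Y S E}

/-- Rules for the seminorms on the free vector space over the terms. -/
structure IsModel (p : Seminorm ℝ (Tm_s4 Y S E →₀ ℝ)) : Prop where
  of : ∀ c : E →₀ ℝ, p (c.mapDomain Tm_s4.of) ≤ ‖Finsupp.linearCombination ℝ (id : E → E) c‖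
  gen : ∀ i u (c : Y i →₀ ℝ), p (c.mapDomain (Tm_s4.gen i u)) ≤
    ‖Finsupp.linearCombination ℝ (id : Y i → Y i) c‖
  ext : ∀ i (u : S i → Tm_s4 Y S E), (∀ c : S i →₀ ℝ, p (c.mapDomain u) ≤
    ‖Finsupp.linearCombination ℝ (Subtype.val : S i → Y i) c‖) →
    ∀ s : S i, p (Finsupp.single (Tm_s4.gen i u s) 1 - Finsupp.single (u s) 1) ≤ 0

/-- A priori bound of a term. -/
noncomputable def Tm_s4.wt : Tm_s4 Y S E → ℝ
  | .of e => ‖e‖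
  | .gen _ _ b => ‖b‖

theorem IsModel.bound_single {p : Seminorm ℝ (Tm_s4 Y S E →₀ ℝ)} (hp : IsModel p) (t : Tm_s4 Y S E) :
    p (Finsupp.single t 1) ≤ t.wt := by
  cases t with
  | of e => simpa [Tm_s4.wt] using hp.of (Finsupp.single e 1)
  | gen i u b => simpa [Tm_s4.wt] using hp.gen i u (Finsupp.single b 1)

theorem IsModel.bound {p : Seminorm ℝ (Tm_s4 Y S E →₀ ℝ)} (hp : IsModel p) (v : Tm_s4 Y S E →₀ ℝ) :
    p v ≤ v.sum fun t r => |r| * t.wt := by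
  have h1 : v = v.sum fun t r => r • Finsupp.single t (1 : ℝ) := by
    conv_lhs => rw [← Finsupp.sum_single v]
    simp
  conv_lhs => rw [h1]
  refine (Finset.le_sum_of_subadditive p (map_zero p).le (map_add_le_add p) _ _).trans ?_
  refine Finset.sum_le_sum fun t _ => ?_
  rw [map_smul_eq_mul, Real.norm_eq_abs]
  exact mul_le_mul_of_nonneg_left (hp.bound_single t) (abs_nonneg _)

variable (Y S E) in
/-- The largest model seminorm. -/
noncomputable def NN : Seminorm ℝ (Tm_s4 Y S E →₀ ℝ) := sSup {p | IsModel p}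

theorem bdd_models : BddAbove {p : Seminorm ℝ (Tm_s4 Y S E →₀ ℝ) | IsModel p} := by
  rw [Seminorm.bddAbove_iff]
  refine ⟨fun v => v.sum fun t r => |r| * t.wt, ?_⟩
  rintro _ ⟨p, hp, rfl⟩ v
  exact IsModel.bound hp v

theorem IsModel.le_NN {p : Seminorm ℝ (Tm_s4 Y S E →₀ ℝ)} (hp : IsModel p) : p ≤ NN Y S E :=
  le_csSup bdd_models hp

theorem isModel_bot : IsModel (⊥ : Seminorm ℝ (Tm_s4 Y S E →₀ ℝ)) where
  of c := by simp
  gen i u c := by simp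
  ext i u _ s := by simp

theorem NN_le {v : Tm_s4 Y S E →₀ ℝ} {r : ℝ} (h : ∀ p, IsModel p → p v ≤ r) : NN Y S E v ≤ r := by
  rw [NN, Seminorm.sSup_apply bdd_models]
  have : Nonempty {p : Seminorm ℝ (Tm_s4 Y S E →₀ ℝ) | IsModel p} := ⟨⟨⊥, isModel_bot⟩⟩
  exact ciSup_le fun p => h p.1 p.2

theorem isModel_NN : IsModel (NN Y S E) where
  of c := NN_le fun p hp => hp.of c
  gen i u c := NN_le fun p hp => hp.gen i u c
  ext i u h s := NN_le fun p hp => hp.ext i u (fun c => (hp.le_NN _).trans (h c)) s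

/-- Criterion for a map on terms to be contractive. -/
theorem le_NN_of {W : Type*} [NormedAddCommGroup W] [NormedSpace ℝ W] (f : Tm_s4 Y S E → W)
    (hof : ∀ c : E →₀ ℝ, ‖Finsupp.linearCombination ℝ (fun e => f (Tm_s4.of e)) c‖ ≤
      ‖Finsupp.linearCombination ℝ (id : E → E) c‖)
    (hgen : ∀ i u (c : Y i →₀ ℝ), ‖Finsupp.linearCombination ℝ (fun b => f (Tm_s4.gen i u b)) c‖ ≤
      ‖Finsupp.linearCombination ℝ (id : Y i → Y i) c‖)
    (hext : ∀ i (u : S i → Tm_s4 Y S E), (∀ c : S i →₀ ℝ, NN Y S E (c.mapDomain u) ≤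
      ‖Finsupp.linearCombination ℝ (Subtype.val : S i → Y i) c‖) →
      (∀ c : S i →₀ ℝ, ‖Finsupp.linearCombination ℝ (fun s => f (u s)) c‖ ≤
      ‖Finsupp.linearCombination ℝ (Subtype.val : S i → Y i) c‖) →
      ∀ s : S i, f (Tm_s4.gen i u s) = f (u s)) (v : Tm_s4 Y S E →₀ ℝ) :
    ‖Finsupp.linearCombination ℝ f v‖ ≤ NN Y S E v := by
  let q : Seminorm ℝ (Tm_s4 Y S E →₀ ℝ) := (normSeminorm ℝ W).comp (Finsupp.linearCombination ℝ f)
  have hq : ∀ v, q v = ‖Finsupp.linearCombination ℝ f v‖ := fun v => rfl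
  have hm : IsModel (q ⊔ NN Y S E) := by
    constructor
    · intro c
      rw [Seminorm.sup_apply, hq, Finsupp.linearCombination_mapDomain]
      exact sup_le (hof c) (isModel_NN.of c)
    · intro i u c
      rw [Seminorm.sup_apply, hq, Finsupp.linearCombination_mapDomain]
      exact sup_le (hgen i u c) (isModel_NN.gen i u c)
    · intro i u h s
      have h1 : ∀ c : S i →₀ ℝ, NN Y S E (c.mapDomain u) ≤
          ‖Finsupp.linearCombination ℝ (Subtype.val : S i → Y i) c‖ := fun c =>
        le_trans (le_sup_right (a := q (c.mapDomain u))) (h c)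
      have h2 : ∀ c : S i →₀ ℝ, q (c.mapDomain u) ≤
          ‖Finsupp.linearCombination ℝ (Subtype.val : S i → Y i) c‖ := fun c =>
        le_trans (le_sup_left (b := NN Y S E (c.mapDomain u))) (h c)
      rw [Seminorm.sup_apply]
      refine sup_le ?_ (isModel_NN.ext i u h1 s)
      rw [hq, map_sub, Finsupp.linearCombination_single, Finsupp.linearCombination_single,
        hext i u h1 (fun c => by
          have := h2 c
          rwa [hq, Finsupp.linearCombination_mapDomain] at this) s]
      simp
  exact (le_sup_left (a := q) (b := NN Y S E)).trans hm.le_NN v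

variable (Y S E) in
/-- The free space with its seminorm. -/
def VN : Type u := Tm_s4 Y S E →₀ ℝ

noncomputable instance : AddCommGroup (VN Y S E) := inferInstanceAs (AddCommGroup (Tm_s4 Y S E →₀ ℝ))
noncomputable instance : Module ℝ (VN Y S E) := inferInstanceAs (Module ℝ (Tm_s4 Y S E →₀ ℝ))
noncomputable instance : SeminormedAddCommGroup (VN Y S E) :=
  AddGroupSeminorm.toSeminormedAddCommGroup (E := VN Y S E) (NN Y S E).toAddGroupSeminorm
noncomputable instance : NormedSpace ℝ (VN Y S E) where
  norm_smul_le r v := (map_smul_eq_mul (NN Y S E) r v).le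

variable (Y S E) in
/-- The universal space. -/
abbrev QQ : Type u := SeparationQuotient (VN Y S E)

variable (Y S E) in
/-- The quotient map. -/
noncomputable def qmk : (Tm_s4 Y S E →₀ ℝ) →ₗ[ℝ] QQ Y S E :=
  (SeparationQuotient.mkCLM ℝ (VN Y S E)).toLinearMap

theorem norm_qmk (v : Tm_s4 Y S E →₀ ℝ) : ‖qmk Y S E v‖ = NN Y S E v :=
  SeparationQuotient.norm_mk (E := VN Y S E) v

theorem qmk_surj : Function.Surjective (qmk Y S E) :=
  SeparationQuotient.surjective_mk (X := VN Y S E)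

/-- The class of a term. -/
noncomputable def cls (t : Tm_s4 Y S E) : QQ Y S E := qmk Y S E (Finsupp.single t 1)

theorem qmk_eq (v : Tm_s4 Y S E →₀ ℝ) : qmk Y S E v = Finsupp.linearCombination ℝ cls v := by
  have : qmk Y S E = Finsupp.linearCombination ℝ cls := by
    ext t
    simp [cls]
  rw [this]

theorem qmk_mapDomain {κ : Type*} (u : κ → Tm_s4 Y S E) (c : κ →₀ ℝ) :
    qmk Y S E (c.mapDomain u) = Finsupp.linearCombination ℝ (fun k => cls (u k)) c := by
  rw [qmk_eq, Finsupp.linearCombination_mapDomain]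
  rfl

/-- A family that is contractive gives a linear contraction. -/
theorem exists_clm_of_id {B W : Type*} [NormedAddCommGroup B] [NormedSpace ℝ B]
    [NormedAddCommGroup W] [NormedSpace ℝ W] (h : B → W)
    (dom : ∀ c : B →₀ ℝ, ‖Finsupp.linearCombination ℝ h c‖ ≤
      ‖Finsupp.linearCombination ℝ (id : B → B) c‖) :
    ∃ L : B →L[ℝ] W, ‖L‖ ≤ 1 ∧ ∀ b, L b = h b := by
  obtain ⟨L, hL, hk⟩ := exists_span_map (id : B → B) h dom
  have hm : ∀ b : B, b ∈ Submodule.span ℝ (Set.range (id : B → B)) := fun b =>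
    Submodule.subset_span ⟨b, rfl⟩
  refine ⟨L.comp ((ContinuousLinearMap.id ℝ B).codRestrict _ hm), ?_, fun b => hk b (hm b)⟩
  refine ContinuousLinearMap.opNorm_le_bound _ zero_le_one fun b => ?_
  exact L.le_of_opNorm_le hL ⟨b, hm b⟩

theorem exists_genL (i : ι) (u : S i → Tm_s4 Y S E) :
    ∃ L : Y i →L[ℝ] QQ Y S E, ‖L‖ ≤ 1 ∧ ∀ b, L b = cls (Tm_s4.gen i u b) := by
  apply exists_clm_of_id
  intro c
  rw [← qmk_mapDomain, norm_qmk]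
  exact isModel_NN.gen i u c

theorem exists_ofL :
    ∃ L : E →L[ℝ] QQ Y S E, ‖L‖ ≤ 1 ∧ ∀ b, L b = cls (Tm_s4.of b) := by
  apply exists_clm_of_id
  intro c
  rw [← qmk_mapDomain, norm_qmk]
  exact isModel_NN.of c

theorem cls_gen (i : ι) (u : S i → Tm_s4 Y S E)
    (h : ∀ c : S i →₀ ℝ, ‖Finsupp.linearCombination ℝ (fun s => cls (u s)) c‖ ≤
      ‖Finsupp.linearCombination ℝ (Subtype.val : S i → Y i) c‖) (s : S i) :
    cls (Tm_s4.gen i u s) = cls (u s) := by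
  have := isModel_NN.ext i u (fun c => by rw [← norm_qmk, qmk_mapDomain]; exact h c) s
  rw [← norm_qmk, map_sub, norm_le_zero_iff, sub_eq_zero] at this
  exact this

/-- Contractive maps on the terms factor through the quotient. -/
theorem exists_lift {W : Type*} [NormedAddCommGroup W] [NormedSpace ℝ W] [CompleteSpace W]
    (f : Tm_s4 Y S E → W)
    (hf : ∀ v, ‖Finsupp.linearCombination ℝ f v‖ ≤ NN Y S E v) :
    ∃ P : QQ Y S E →L[ℝ] W, ‖P‖ ≤ 1 ∧ ∀ t, P (cls t) = f t := by
  have hn : ∀ v, ‖Finsupp.linearCombination ℝ f v‖ ≤ 1 * ‖qmk Y S E v‖ := fun v => by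
    rw [norm_qmk, one_mul]; exact hf v
  refine ⟨(Finsupp.linearCombination ℝ f).extendOfNorm (qmk Y S E),
    LinearMap.opNorm_extendOfNorm_le qmk_surj.denseRange zero_le_one hn, fun t => ?_⟩
  rw [cls, LinearMap.extendOfNorm_eq qmk_surj.denseRange ⟨1, hn⟩]
  simp

open Classical in
/-- A chosen contractive extension. -/
noncomputable def extChoice {W : Type*} [NormedAddCommGroup W] [NormedSpace ℝ W] (i : ι)
    (h : S i → W) : Y i →L[ℝ] W :=
  if H : ∃ H : Y i →L[ℝ] W, ‖H‖ ≤ 1 ∧ ∀ s : S i, H s = h s then H.choose else 0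

theorem extChoice_norm {W : Type*} [NormedAddCommGroup W] [NormedSpace ℝ W] (i : ι)
    (h : S i → W) : ‖extChoice i h‖ ≤ 1 := by
  unfold extChoice
  split_ifs with H
  · exact H.choose_spec.1
  · simp

theorem extChoice_apply {W : Type*} [NormedAddCommGroup W] [NormedSpace ℝ W] {i : ι}
    {h : S i → W} (H : ∃ H : Y i →L[ℝ] W, ‖H‖ ≤ 1 ∧ ∀ s : S i, H s = h s) (s : S i) :
    extChoice i h s = h s := by
  unfold extChoice
  rw [dif_pos H]
  exact H.choose_spec.2 s

theorem lc_clm_le {B W : Type*} [NormedAddCommGroup B] [NormedSpace ℝ B]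
    [NormedAddCommGroup W] [NormedSpace ℝ W] (L : B →L[ℝ] W) (hL : ‖L‖ ≤ 1) {κ : Type*}
    (g : κ → B) (c : κ →₀ ℝ) :
    ‖Finsupp.linearCombination ℝ (fun k => L (g k)) c‖ ≤ ‖Finsupp.linearCombination ℝ g c‖ := by
  have : Finsupp.linearCombination ℝ (fun k => L (g k)) c
      = L (Finsupp.linearCombination ℝ g c) := by
    simp [Finsupp.linearCombination_apply, Finsupp.sum]
  rw [this]
  simpa using L.le_of_opNorm_le hL (Finsupp.linearCombination ℝ g c)

/-- The projection on terms. -/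
noncomputable def projTm : Tm_s4 Y S E → E
  | .of e => e
  | .gen i u b => extChoice i (fun s => projTm (u s)) b

theorem exists_proj [CompleteSpace E] (hE : ∀ i, ExtProp (Y i) (S i) E) :
    ∃ P : QQ Y S E →L[ℝ] E, ‖P‖ ≤ 1 ∧ ∀ e, P (cls (Tm_s4.of e)) = e := by
  obtain ⟨P, hP, hPt⟩ := exists_lift (projTm (Y := Y) (S := S) (E := E)) <| by
    apply le_NN_of
    · intro c
      simp only [projTm]
      exact le_rfl
    · intro i u c
      simp only [projTm]
      exact lc_clm_le _ (extChoice_norm i _) id c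
    · intro i u _ h s
      simp only [projTm]
      exact extChoice_apply (hE i _ h) s
  exact ⟨P, hP, fun e => by rw [hPt]; simp [projTm]⟩

/-- The rank of a term. -/
noncomputable def Tm_s4.rank : Tm_s4 Y S E → Ordinal.{u}
  | .of _ => 0
  | .gen _ u _ => ⨆ s, Order.succ (rank (u s))

theorem Tm_s4.rank_lt (i : ι) (u : S i → Tm_s4 Y S E) (b : Y i) (s : S i) :
    (u s).rank < (Tm_s4.gen i u b).rank := by
  rw [Tm_s4.rank]
  exact (Order.lt_succ _).trans_le (Ordinal.le_iSup (fun s => Order.succ (u s).rank) s)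

open Classical in
/-- Modification of the functional `f₀` at the generators `aux`. -/
noncomputable def modTm (f₀ : QQ Y S E →L[ℝ] ℝ)
    (aux : ∀ x : (Σ i, S i → Tm_s4 Y S E), Y x.1 →L[ℝ] ℝ) : Tm_s4 Y S E → ℝ
  | .of e => f₀ (cls (Tm_s4.of e))
  | .gen i u b => (if ∀ s, modTm f₀ aux (u s) = f₀ (cls (u s)) then aux ⟨i, u⟩
      else extChoice i (fun s => modTm f₀ aux (u s))) b

theorem gen_isometry (i : ι) (u : S i → Tm_s4 Y S E)
    (h : ∀ c : S i →₀ ℝ, ‖Finsupp.linearCombination ℝ (fun s => cls (u s)) c‖ =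
      ‖Finsupp.linearCombination ℝ (Subtype.val : S i → Y i) c‖) (b : Y i) :
    ‖cls (Tm_s4.gen i u b)‖ = ‖b‖ := by
  classical
  choose G hG1 hG using fun x : (Σ i, S i → Tm_s4 Y S E) => exists_genL x.1 x.2
  apply le_antisymm
  · have := (G ⟨i, u⟩).le_of_opNorm_le (hG1 _) b
    rw [hG] at this
    simpa using this
  obtain ⟨φ, hφ, hφb⟩ := exists_dual_vector'' ℝ b
  obtain ⟨f₀, hf₀, hf₀u⟩ := hb_family (fun s => cls (u s)) (fun s : S i => φ s) (fun c => by
    rw [h c]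
    exact lc_clm_le φ hφ Subtype.val c)
  let aux : ∀ x : (Σ i, S i → Tm_s4 Y S E), Y x.1 →L[ℝ] ℝ :=
    Function.update (fun x => f₀.comp (G x)) ⟨i, u⟩ φ
  have haux_self : aux ⟨i, u⟩ = φ := Function.update_self ..
  have haux_ne : ∀ x, x ≠ ⟨i, u⟩ → aux x = f₀.comp (G x) := fun x hx =>
    Function.update_of_ne hx ..
  have haux_norm : ∀ x, ‖aux x‖ ≤ 1 := by
    intro x
    by_cases hx : x = ⟨i, u⟩
    · subst hx
      rw [haux_self]; exact hφ
    · rw [haux_ne x hx]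
      exact (ContinuousLinearMap.opNorm_comp_le _ _).trans
        (mul_le_one₀ hf₀ (norm_nonneg _) (hG1 x))
  let f := modTm f₀ aux
  have hfof : ∀ e, f (Tm_s4.of e) = f₀ (cls (Tm_s4.of e)) := fun e => by simp only [f, modTm]
  have hfgen : ∀ i' u' b', f (Tm_s4.gen i' u' b') = (if ∀ s, f (u' s) = f₀ (cls (u' s))
      then aux ⟨i', u'⟩ else extChoice i' (fun s => f (u' s))) b' := fun i' u' b' => by
    simp only [f]
    rw [modTm]
  have hagree : ∀ t : Tm_s4 Y S E, t.rank < (Tm_s4.gen i u b).rank → f t = f₀ (cls t) := by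
    intro t
    induction t with
    | of e => intro _; exact hfof e
    | gen i' u' b' ih =>
      intro hr
      rw [hfgen, if_pos (fun s => ih s ((Tm_s4.rank_lt i' u' b' s).trans hr)), haux_ne, 
        ContinuousLinearMap.comp_apply, hG]
      intro heq
      cases heq
      have : (Tm_s4.gen i u b').rank = (Tm_s4.gen i u b).rank := by simp only [Tm_s4.rank]
      exact hr.ne this
  have hfu : ∀ s, f (u s) = f₀ (cls (u s)) := fun s => hagree _ (Tm_s4.rank_lt i u b s)
  have hfb : f (Tm_s4.gen i u b) = ‖b‖ := by
    rw [hfgen, if_pos hfu, haux_self, hφb]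
    rfl
  have hle : ∀ v, ‖Finsupp.linearCombination ℝ f v‖ ≤ NN Y S E v := by
    apply le_NN_of
    · intro c
      simp only [hfof]
      refine (lc_clm_le f₀ hf₀ _ c).trans ?_
      rw [← qmk_mapDomain, norm_qmk]
      exact isModel_NN.of c
    · intro i' u' c
      simp only [hfgen]
      refine lc_clm_le _ ?_ id c
      split_ifs
      · exact haux_norm _
      · exact extChoice_norm _ _
    · intro i' u' hN hf s
      rw [hfgen]
      split_ifs with hag
      · by_cases hx : (⟨i', u'⟩ : (Σ i, S i → Tm_s4 Y S E)) = ⟨i, u⟩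
        · cases hx
          rw [haux_self, hfu, hf₀u]
        · rw [haux_ne _ hx, ContinuousLinearMap.comp_apply, hG, hag, cls_gen]
          intro c
          rw [← qmk_mapDomain, norm_qmk]
          exact hN c
      · exact extChoice_apply (hb_family _ _ hf) s
  have := hle (Finsupp.single (Tm_s4.gen i u b) 1)
  rw [← norm_qmk] at this
  simpa [hfb, cls] using this

/-- Realization hypothesis for the family of pairs. -/
def Realizes (Y : ι → Type u) [∀ i, NormedAddCommGroup (Y i)] [∀ i, NormedSpace ℝ (Y i)]
    (S : ∀ i, Set (Y i)) (E : Type u) [NormedAddCommGroup E] [NormedSpace ℝ E]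
    (Γ : Type u) : Prop :=
  ∀ (B : Type u) [NormedAddCommGroup B] [NormedSpace ℝ B] (T : Set B) (d : Γ → B),
    DenseRange d → ExtProp B T E → ∃ i, ∃ e : B ≃ₗᵢ[ℝ] Y i, ∀ b, e b ∈ S i ↔ b ∈ T

theorem extend_isometry {Γ : Type u} (hr : Realizes Y S E Γ) {B : Type u} [NormedAddCommGroup B]
    [NormedSpace ℝ B] (T : Set B) (d : Γ → B) (hd : DenseRange d) (hT : ExtProp B T E)
    (t : T → Tm_s4 Y S E)
    (ht : ∀ c : T →₀ ℝ, ‖Finsupp.linearCombination ℝ (fun s => cls (t s)) c‖ =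
      ‖Finsupp.linearCombination ℝ (Subtype.val : T → B) c‖) :
    ∃ G : B →ₗᵢ[ℝ] QQ Y S E, (∀ s : T, G s = cls (t s)) ∧ ∀ b, ∃ t', G b = cls t' := by
  obtain ⟨i, e, he⟩ := hr B T d hd hT
  let ε : S i → T := fun s => ⟨e.symm s, by rw [← he, e.apply_symm_apply]; exact s.2⟩
  let u : S i → Tm_s4 Y S E := fun s => t (ε s)
  have hu : ∀ c : S i →₀ ℝ, ‖Finsupp.linearCombination ℝ (fun s => cls (u s)) c‖ =
      ‖Finsupp.linearCombination ℝ (Subtype.val : S i → Y i) c‖ := by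
    intro c
    have h1 := ht (c.mapDomain ε)
    rw [Finsupp.linearCombination_mapDomain, Finsupp.linearCombination_mapDomain] at h1
    have h2 : Finsupp.linearCombination ℝ (Subtype.val ∘ ε) c
        = e.symm (Finsupp.linearCombination ℝ (Subtype.val : S i → Y i) c) := by
      simp [Finsupp.linearCombination_apply, Finsupp.sum, ε]
    rw [h2, e.symm.norm_map] at h1
    exact h1
  obtain ⟨L, hL1, hL⟩ := exists_genL i u
  refine ⟨⟨(L.toLinearMap).comp e.toLinearEquiv.toLinearMap, fun b => ?_⟩, fun s => ?_, fun b => ?_⟩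
  · change ‖L (e b)‖ = ‖b‖
    rw [hL, gen_isometry i u hu, e.norm_map]
  · change L (e s) = _
    have hs : e s ∈ S i := (he s).2 s.2
    rw [hL]
    have := cls_gen i u (fun c => (hu c).le) ⟨e s, hs⟩
    rw [this]
    have h3 : ε ⟨e s, hs⟩ = s := Subtype.ext (e.symm_apply_apply _)
    simp only [u, h3]
  · exact ⟨_, hL (e b)⟩

theorem extProp_of_dense {B W : Type*} [NormedAddCommGroup B] [NormedSpace ℝ B]
    [NormedAddCommGroup W] [NormedSpace ℝ W] [CompleteSpace W] (T : Set B)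
    (hT : Dense (Submodule.span ℝ T : Set B)) : ExtProp B T W := by
  intro h dom
  have hd : DenseRange (Finsupp.linearCombination ℝ (Subtype.val : T → B)) := by
    have h1 := Finsupp.range_linearCombination ℝ (v := (Subtype.val : T → B))
    rw [Subtype.range_coe] at h1
    rw [DenseRange, ← LinearMap.coe_range, h1]
    exact hT
  have dom' : ∀ c, ‖Finsupp.linearCombination ℝ h c‖ ≤
      1 * ‖Finsupp.linearCombination ℝ (Subtype.val : T → B) c‖ := by simpa using dom
  refine ⟨(Finsupp.linearCombination ℝ h).extendOfNorm
    (Finsupp.linearCombination ℝ (Subtype.val : T → B)),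
    LinearMap.opNorm_extendOfNorm_le hd zero_le_one dom', fun s => ?_⟩
  have := LinearMap.extendOfNorm_eq hd ⟨1, dom'⟩ (Finsupp.single s 1)
  simpa using this

theorem exists_rep [CompleteSpace E] {Γ : Type u} [Infinite Γ] (hr : Realizes Y S E Γ)
    (x : UniformSpace.Completion (QQ Y S E)) : ∃ t : Tm_s4 Y S E, x = (cls t : QQ Y S E) := by
  obtain ⟨q, hq⟩ : ∃ q : ℕ → QQ Y S E,
      Filter.Tendsto (fun n => (q n : UniformSpace.Completion (QQ Y S E))) Filter.atTop
        (nhds x) := by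
    have hx : x ∈ closure (Set.range ((↑) : QQ Y S E → UniformSpace.Completion (QQ Y S E))) :=
      UniformSpace.Completion.denseRange_coe x
    obtain ⟨y, hy, hyx⟩ := mem_closure_iff_seq_limit.1 hx
    choose q hq using hy
    exact ⟨q, by simpa [hq] using hyx⟩
  choose v hv using fun n => qmk_surj (q n)
  let D : Set (Tm_s4 Y S E) := ⋃ n, ((v n).support : Set (Tm_s4 Y S E))
  have hD : D.Countable := Set.countable_iUnion fun n => (v n).support.countable_toSet
  let co : QQ Y S E →ₗᵢ[ℝ] UniformSpace.Completion (QQ Y S E) :=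
    UniformSpace.Completion.toComplₗᵢ
  let T0 : Set (UniformSpace.Completion (QQ Y S E)) := (fun t => co (cls t)) '' D
  have hT0 : T0.Countable := hD.image _
  let B : Submodule ℝ (UniformSpace.Completion (QQ Y S E)) :=
    (Submodule.span ℝ T0).topologicalClosure
  have hsep : TopologicalSpace.SeparableSpace B :=
    (hT0.isSeparable.span (R := ℝ)).closure.separableSpace
  let d : Γ → B := fun γ => TopologicalSpace.denseSeq B (Function.invFun (Infinite.natEmbedding Γ) γ)
  have hd : DenseRange d := by
    have hs : Function.Surjective (Function.invFun (Infinite.natEmbedding Γ)) :=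
      Function.invFun_surjective (Infinite.natEmbedding Γ).injective
    have := TopologicalSpace.denseRange_denseSeq B
    rw [DenseRange] at this ⊢
    rwa [show d = TopologicalSpace.denseSeq B ∘ Function.invFun (Infinite.natEmbedding Γ) from rfl,
      hs.range_comp]
  have hTB : T0 ⊆ B := fun y hy => Submodule.le_topologicalClosure _ (Submodule.subset_span hy)
  let T : Set B := Subtype.val ⁻¹' T0
  have himg : (Subtype.val : B → _) '' T = T0 := by
    ext y
    constructor
    · rintro ⟨z, hz, rfl⟩
      exact hz
    · intro hy
      exact ⟨⟨y, hTB hy⟩, hy, rfl⟩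
  have hdense : Dense (Submodule.span ℝ T : Set B) := by
    intro y
    rw [closure_subtype]
    have h2 : (Subtype.val : B → _) '' (Submodule.span ℝ T : Set B)
        = (Submodule.span ℝ T0 : Set _) := by
      rw [← himg]
      have := Submodule.map_span B.subtype T
      exact congrArg (fun M : Submodule ℝ (UniformSpace.Completion (QQ Y S E)) =>
        (M : Set (UniformSpace.Completion (QQ Y S E)))) this
    rw [h2]
    exact y.2
  have ht : ∀ s : T, ∃ t : Tm_s4 Y S E, co (cls t) = s := fun s => by
    obtain ⟨t, _, h⟩ := s.2
    exact ⟨t, h⟩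
  choose t ht using ht
  obtain ⟨G, hG, hGt⟩ := extend_isometry hr T d hd (extProp_of_dense T hdense) t (fun c => by
    rw [← co.norm_map]
    have h1 : co (Finsupp.linearCombination ℝ (fun s => cls (t s)) c)
        = B.subtype (Finsupp.linearCombination ℝ (Subtype.val : T → B) c) := by
      simp [Finsupp.linearCombination_apply, Finsupp.sum, ht]
    rw [h1]
    rfl)
  -- `co ∘ G` is the inclusion of `B`
  have hcoG : ∀ y : B, co (G y) = y := by
    have h1 : ∀ y ∈ (Submodule.span ℝ T : Set B), co (G y) = y := by
      intro y hy
      induction hy using Submodule.span_induction with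
      | mem y hy => rw [hG ⟨y, hy⟩, ht]
      | zero => simp
      | add y z _ _ hy hz => simp [hy, hz]
      | smul r y _ hy => simp [hy]
    have hcl : IsClosed {y : B | co (G y) = y} :=
      isClosed_eq (co.continuous.comp G.continuous) continuous_subtype_val
    intro y
    exact hcl.closure_subset_iff.2 h1 (hdense y)
  have hxB : x ∈ B := by
    refine mem_closure_of_tendsto (f := fun n => (q n : UniformSpace.Completion (QQ Y S E))) hq
      (Filter.Eventually.of_forall fun n => ?_)
    have h1 : (q n : UniformSpace.Completion (QQ Y S E))
        = (v n).sum fun t r => r • co (cls t) := by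
      change co (q n) = _
      rw [← hv n, qmk_eq]
      simp [Finsupp.linearCombination_apply, Finsupp.sum]
    rw [h1]
    refine Submodule.sum_mem _ fun t ht => Submodule.smul_mem _ _ (Submodule.subset_span ?_)
    exact ⟨t, Set.mem_iUnion.2 ⟨n, ht⟩, rfl⟩
  obtain ⟨t', ht'⟩ := hGt ⟨x, hxB⟩
  refine ⟨t', ?_⟩
  have := hcoG ⟨x, hxB⟩
  rw [ht'] at this
  exact this.symm

theorem complete_QQ [CompleteSpace E] {Γ : Type u} [Infinite Γ] (hr : Realizes Y S E Γ) :
    CompleteSpace (QQ Y S E) := by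
  rw [completeSpace_iff_isComplete_range
    (UniformSpace.Completion.isUniformInducing_coe (QQ Y S E))]
  have : Set.range ((↑) : QQ Y S E → UniformSpace.Completion (QQ Y S E)) = Set.univ := by
    rw [Set.eq_univ_iff_forall]
    intro x
    obtain ⟨t, ht⟩ := exists_rep hr x
    exact ⟨_, ht.symm⟩
  rw [this]
  exact isComplete_univ

theorem exists_rep' [CompleteSpace E] {Γ : Type u} [Infinite Γ] (hr : Realizes Y S E Γ)
    (x : QQ Y S E) : ∃ t : Tm_s4 Y S E, cls t = x := by
  obtain ⟨t, ht⟩ := exists_rep hr (x : UniformSpace.Completion (QQ Y S E))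
  exact ⟨t, (UniformSpace.Completion.coe_injective _ ht).symm⟩

end Construction

/-- The set of relevant pairs inside `ℓ∞(Γ)`. -/
def PairIdx (Γ : Type u) (E : Type u) [NormedAddCommGroup E] [NormedSpace ℝ E] : Type u :=
  {x : Σ Y : Submodule ℝ (lp (fun _ : Γ => ℝ) ∞), Set Y // ExtProp x.1 x.2 E}

theorem realizes_pairIdx (Γ : Type u) (E : Type u) [NormedAddCommGroup E] [NormedSpace ℝ E] :
    Realizes (fun i : PairIdx Γ E => i.1.1) (fun i => i.1.2) E Γ := by
  intro B _ _ T d hd hT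
  obtain ⟨e0⟩ := exists_embed_linf d hd
  let e := e0.equivRange
  refine ⟨⟨⟨LinearMap.range e0.toLinearMap, {y | e.symm y ∈ T}⟩, ?_⟩, e, fun b => ?_⟩
  · intro h dom
    let ε : T → {y | e.symm y ∈ T} := fun s => ⟨e s, by
      change e.symm (e s) ∈ T
      rw [e.symm_apply_apply]; exact s.2⟩
    obtain ⟨H, hH1, hH⟩ := hT (fun s => h (ε s)) (fun c => by
      have h1 := dom (c.mapDomain ε)
      rw [Finsupp.linearCombination_mapDomain, Finsupp.linearCombination_mapDomain] at h1
      have h2 : Finsupp.linearCombination ℝ (Subtype.val ∘ ε) c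
          = e (Finsupp.linearCombination ℝ (Subtype.val : T → B) c) := by
        simp [Finsupp.linearCombination_apply, Finsupp.sum, ε]
      rw [h2, e.norm_map] at h1
      exact h1)
    refine ⟨H.comp e.symm.toContinuousLinearEquiv.toContinuousLinearMap, ?_, fun s => ?_⟩
    · refine ContinuousLinearMap.opNorm_le_bound _ zero_le_one fun y => ?_
      change ‖H (e.symm y)‖ ≤ _
      have := H.le_of_opNorm_le hH1 (e.symm y)
      rwa [e.symm.norm_map] at this
    · change H (e.symm s) = _
      have h3 := hH ⟨e.symm s, s.2⟩
      rw [h3]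
      congr 1
      exact Subtype.ext (e.apply_symm_apply _)
  · change e.symm (e b) ∈ T ↔ _
    rw [e.symm_apply_apply]

theorem extProp_of_injective {α β : Cardinal.{u}} {E : BanachSpace.{u}}
    (hE : IsABInjective1 α β E) (A B : BanachSpace.{u}) (hA : DensityLT A.carrier α)
    (hB : DensityLT B.carrier β) (i : A.carrier →ₗᵢ[ℝ] B.carrier) :
    ExtProp B.carrier (Set.range i) E.carrier := by
  intro h dom
  obtain ⟨L, hL1, hL⟩ := exists_span_map (Subtype.val : Set.range i → B.carrier) h dom
  let R : Submodule ℝ B.carrier := LinearMap.range i.toLinearMap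
  have hR : (R : Set B.carrier) = Set.range i := rfl
  have hRs : ∀ x ∈ R, x ∈ Submodule.span ℝ (Set.range (Subtype.val : Set.range i → B.carrier)) := by
    intro x hx
    exact Submodule.subset_span ⟨⟨x, hx⟩, rfl⟩
  let t : R →L[ℝ] E.carrier := L.comp (R.subtypeL.codRestrict _ fun x => hRs x x.2)
  have ht : ‖t‖ ≤ 1 := ContinuousLinearMap.opNorm_le_bound _ zero_le_one fun x =>
    L.le_of_opNorm_le hL1 ⟨x, hRs x x.2⟩
  have hRd : DensityLT R α := by
    obtain ⟨s, hs, hc⟩ := hA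
    have he : Continuous i.equivRange := i.equivRange.continuous
    exact ⟨i.equivRange '' s, i.equivRange.surjective.denseRange.dense_image he hs,
      Cardinal.mk_image_le.trans_lt hc⟩
  obtain ⟨H, hHa, hHn⟩ := hE B hB R (by rw [hR]; exact i.isometry.isClosedEmbedding.isClosed_range)
    hRd t
  refine ⟨H, hHn.trans ht, fun s => ?_⟩
  have := hHa ⟨s, s.2⟩
  rw [this]
  exact hL s (hRs s s.2)

theorem forward_aux {ι : Type u} (Y : ι → Type u) [∀ i, NormedAddCommGroup (Y i)]
    [∀ i, NormedSpace ℝ (Y i)] (S : ∀ i, Set (Y i)) (α β : Cardinal.{u})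
    (hα : Cardinal.aleph0 ≤ α) (hαβ : α ≤ β) (E : BanachSpace.{u})
    (hE : IsABInjective1 α β E) (hr : Realizes Y S E.carrier β.out)
    (hYS : ∀ i, ExtProp (Y i) (S i) E.carrier) :
    ∃ U : BanachSpace.{u}, IsABUnivDisp α β U ∧
        ∃ (j : E.carrier →ₗᵢ[ℝ] U.carrier) (P : U.carrier →L[ℝ] E.carrier),
          ‖P‖ ≤ 1 ∧ ∀ x : E.carrier, P (j x) = x := by
  let Γ : Type u := β.out
  have hΓ : Infinite Γ := by
    rw [Cardinal.infinite_iff, Cardinal.mk_out]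
    exact hα.trans hαβ
  have hr : Realizes Y S E.carrier Γ := hr
  have hc := complete_QQ hr
  obtain ⟨P, hP, hPe⟩ := exists_proj (Y := Y) (S := S) (E := E.carrier) hYS
  obtain ⟨J, hJ, hJe⟩ := exists_ofL (Y := Y) (S := S) (E := E.carrier)
  have hPJ : ∀ x, P (J x) = x := fun x => by rw [hJe, hPe]
  let U : BanachSpace.{u} := ⟨QQ Y S E.carrier⟩
  refine ⟨U, ?_, ⟨J.toLinearMap, fun x => ?_⟩, P, hP, hPJ⟩
  · intro A B hA hB w i
    obtain ⟨s, hs, hsc⟩ := id hB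
    have hne : Nonempty s := hs.nonempty.to_subtype
    have hle : Cardinal.mk s ≤ Cardinal.mk Γ := by rw [Cardinal.mk_out]; exact hsc.le
    obtain ⟨f⟩ := hle
    let d : Γ → B.carrier := fun γ => (Function.invFun f γ : s)
    have hd : DenseRange d := by
      have h1 : Set.range d = s := by
        rw [show d = Subtype.val ∘ Function.invFun f from rfl,
          (Function.invFun_surjective f.injective).range_comp, Subtype.range_coe]
      rw [DenseRange, h1]
      exact hs
    choose a ha using fun x : Set.range i => x.2
    choose t ht using fun x : Set.range i => exists_rep' hr (w (a x))
    obtain ⟨G, hG, -⟩ := extend_isometry hr (Set.range i) d hd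
      (extProp_of_injective hE A B hA hB i) t (fun c => by
        simp only [ht]
        have h1 : Finsupp.linearCombination ℝ (fun x => w (a x)) c
            = w (Finsupp.linearCombination ℝ a c) := by
          simp [Finsupp.linearCombination_apply, Finsupp.sum]
        have h2 : Finsupp.linearCombination ℝ (Subtype.val : Set.range i → B.carrier) c
            = i (Finsupp.linearCombination ℝ a c) := by
          simp [Finsupp.linearCombination_apply, Finsupp.sum, ha]
        rw [h2, i.norm_map]
        exact (congrArg norm h1).trans (w.norm_map _))
    refine ⟨G, fun x => ?_⟩
    have h1 := hG ⟨i x, x, rfl⟩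
    rw [ht] at h1
    refine h1.trans ?_
    congr 1
    exact i.injective (ha ⟨i x, x, rfl⟩)
  · apply le_antisymm
    · have := J.le_of_opNorm_le hJ x
      rwa [one_mul] at this
    · have := P.le_of_opNorm_le hP (J x)
      rwa [hPJ, one_mul] at this


theorem forward (α β : Cardinal.{u}) (hα : Cardinal.aleph0 ≤ α) (hαβ : α ≤ β) (E : BanachSpace.{u})
    (hE : IsABInjective1 α β E) :
    ∃ U : BanachSpace.{u}, IsABUnivDisp α β U ∧
        ∃ (j : E.carrier →ₗᵢ[ℝ] U.carrier) (P : U.carrier →L[ℝ] E.carrier),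
          ‖P‖ ≤ 1 ∧ ∀ x : E.carrier, P (j x) = x :=
  forward_aux _ _ α β hα hαβ E hE (realizes_pairIdx β.out E.carrier) (fun i => i.2)

/-- For infinite cardinals `α ≤ β`, a Banach space is `(α, β)₁`-injective iff it is a
`1`-complemented subspace of a Banach space of `(α, β)`-universal disposition. -/
theorem abInjective1_iff_oneComplemented_abUnivDisp
    (α β : Cardinal.{u}) (hα : Cardinal.aleph0 ≤ α) (hαβ : α ≤ β) (E : BanachSpace.{u}) :
    IsABInjective1 α β E ↔
      ∃ U : BanachSpace.{u}, IsABUnivDisp α β U ∧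
        ∃ (j : E.carrier →ₗᵢ[ℝ] U.carrier) (P : U.carrier →L[ℝ] E.carrier),
          ‖P‖ ≤ 1 ∧ ∀ x : E.carrier, P (j x) = x := by
  constructor
  · exact forward α β hα hαβ E
  · rintro ⟨U, hU, j, P, hP, hPj⟩
    exact backward α β E U hU j P hP hPj
end

section
/- Let α ≤ β be infinite cardinals. For every Banach space X there exist a Banach space U of (α, β)-universal disposition and a linear isometric embedding of X into U. -/
section Helpers

universe u

open CategoryTheory CategoryTheory.Limits
open scoped ENNReal

/-- Hahn-Banach along an isometric embedding. -/
theorem hb_ext {A Y : Type u} [NormedAddCommGroup A] [NormedSpace ℝ A]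
    [NormedAddCommGroup Y] [NormedSpace ℝ Y] (v : A →ₗᵢ[ℝ] Y) (g : StrongDual ℝ A)
    (hg : ‖g‖ ≤ 1) : ∃ f : StrongDual ℝ Y, ‖f‖ ≤ 1 ∧ ∀ a, f (v a) = g a := by
  let e := v.equivRange
  obtain ⟨f, hf, hn⟩ := exists_extension_norm_eq (𝕜 := ℝ) (LinearMap.range v.toLinearMap)
    (g.comp (e.symm.toContinuousLinearEquiv : _ →L[ℝ] A))
  refine ⟨f, ?_, fun a => ?_⟩
  · rw [hn]
    refine ContinuousLinearMap.opNorm_le_bound _ zero_le_one fun x => ?_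
    refine (g.le_of_opNorm_le hg _).trans ?_
    simp
  · have := hf (e a)
    simpa [e] using this

/-- A norming family of functionals gives an isometric embedding into `ℓ_∞`. -/
theorem exists_toLinfty {E Γ : Type u} [NormedAddCommGroup E] [NormedSpace ℝ E]
    (φ : Γ → StrongDual ℝ E) (h1 : ∀ γ, ‖φ γ‖ ≤ 1)
    (h2 : ∀ x, ∀ ε > 0, ∃ γ, ‖x‖ - ε ≤ ‖φ γ x‖) :
    ∃ v : E →ₗᵢ[ℝ] lp (fun _ : Γ => ℝ) ∞, ∀ x γ, v x γ = φ γ x := by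
  have hb : ∀ x γ, ‖φ γ x‖ ≤ ‖x‖ := fun x γ => by
    simpa using (φ γ).le_of_opNorm_le (h1 γ) x
  let v : E →ₗ[ℝ] lp (fun _ : Γ => ℝ) ∞ :=
    { toFun := fun x => ⟨fun γ => φ γ x, memℓp_infty ⟨‖x‖, by rintro _ ⟨γ, rfl⟩; exact hb x γ⟩⟩
      map_add' := fun x y => by ext γ; exact map_add (φ γ) x y
      map_smul' := fun c x => by ext γ; simp }
  refine ⟨⟨v, fun x => ?_⟩, fun x γ => rfl⟩
  apply le_antisymm
  · exact lp.norm_le_of_forall_le (norm_nonneg _) (fun γ => hb x γ)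
  · refine le_of_forall_pos_le_add fun ε hε => ?_
    obtain ⟨γ, hγ⟩ := h2 x ε hε
    have : ‖φ γ x‖ ≤ ‖v x‖ := lp.norm_apply_le_norm ENNReal.top_ne_zero (v x) γ
    linarith

/-- One multiple push-out step. -/
theorem exists_step (L Y : Type u) [NormedAddCommGroup L] [NormedSpace ℝ L]
    [NormedAddCommGroup Y] [NormedSpace ℝ Y] :
    ∃ (Γ : Type u) (j : Y →ₗᵢ[ℝ] lp (fun _ : Γ => ℝ) ∞),
      ∀ (A : Submodule ℝ L) (v : A →ₗᵢ[ℝ] Y),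
        ∃ w : L →ₗᵢ[ℝ] lp (fun _ : Γ => ℝ) ∞, ∀ a : A, w a = j (v a) := by
  classical
  let T := Σ A : Submodule ℝ L, A →ₗᵢ[ℝ] Y
  let Γ := {p : StrongDual ℝ Y × (T → StrongDual ℝ L) // ‖p.1‖ ≤ 1 ∧
    ∀ t, ‖p.2 t‖ ≤ 1 ∧ ∀ a : t.1, p.2 t a = p.1 (t.2 a)}
  have key : ∀ f : StrongDual ℝ Y, ‖f‖ ≤ 1 → ∀ t : T, ∃ g : StrongDual ℝ L, ‖g‖ ≤ 1 ∧
      ∀ a : t.1, g a = f (t.2 a) := fun f hf t => by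
    have := hb_ext t.1.subtypeₗᵢ (f.comp t.2.toContinuousLinearMap) (by
      refine ContinuousLinearMap.opNorm_le_bound _ zero_le_one fun x => ?_
      refine (f.le_of_opNorm_le hf _).trans ?_
      simp)
    simpa using this
  obtain ⟨j, hj⟩ := exists_toLinfty (E := Y) (fun γ : Γ => γ.1.1) (fun γ => γ.2.1)
    (fun x ε hε => by
      obtain ⟨f, hf, hx⟩ := exists_dual_vector'' ℝ x
      choose g hg using key f hf
      refine ⟨⟨(f, g), hf, hg⟩, ?_⟩
      simp [hx, hε.le])
  refine ⟨Γ, j, fun A v => ?_⟩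
  let t : T := ⟨A, v⟩
  obtain ⟨w, hw⟩ := exists_toLinfty (E := L) (fun γ : Γ => γ.1.2 t) (fun γ => (γ.2.2 t).1)
    (fun x ε hε => by
      obtain ⟨g₀, hg₀, hx⟩ := exists_dual_vector'' ℝ x
      obtain ⟨f, hf, hfg⟩ := hb_ext v (g₀.comp A.subtypeL) (by
        refine ContinuousLinearMap.opNorm_le_bound _ zero_le_one fun x => ?_
        refine (g₀.le_of_opNorm_le hg₀ _).trans ?_
        simp)
      choose g hg using key f hf
      refine ⟨⟨(f, Function.update g t g₀), hf, fun s => ?_⟩, ?_⟩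
      · by_cases hs : s = t
        · subst hs
          simp only [Function.update_self]
          exact ⟨hg₀, fun a => (hfg a).symm⟩
        · simp only [Function.update_of_ne hs]
          exact hg s
      · simp [hx, hε.le])
  refine ⟨w, fun a => ?_⟩
  ext γ
  rw [hw, hj]
  exact (γ.2.2 t).2 a

/-- Every space of density `< β` embeds into `ℓ_∞(β)`. -/
theorem exists_embed_linfty (β : Cardinal.{u}) (B : Type u) [NormedAddCommGroup B]
    [NormedSpace ℝ B] (h : ∃ s : Set B, Dense s ∧ Cardinal.mk s < β) :
    Nonempty (B →ₗᵢ[ℝ] lp (fun _ : β.out => ℝ) ∞) := by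
  obtain ⟨s, hs, hc⟩ := h
  obtain ⟨x₀, hx₀⟩ := hs.nonempty
  have : Nonempty s := ⟨⟨x₀, hx₀⟩⟩
  have : Cardinal.mk s ≤ Cardinal.mk β.out := by simpa using hc.le
  obtain ⟨e⟩ := this
  let q : β.out → s := Function.invFun e
  have hq : ∀ x, q (e x) = x := Function.leftInverse_invFun e.injective
  choose φ hφ using fun x : B => exists_dual_vector'' ℝ x
  obtain ⟨v, -⟩ := exists_toLinfty (fun γ : β.out => φ (q γ)) (fun γ => (hφ _).1)
    (fun x ε hε => by
      obtain ⟨y, hy, hxy⟩ := hs.exists_dist_lt x (half_pos hε)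
      refine ⟨e ⟨y, hy⟩, ?_⟩
      simp only [hq]
      have h1 : ‖φ y (x - y)‖ ≤ ‖x - y‖ := by
        simpa using (φ y).le_of_opNorm_le (hφ y).1 (x - y)
      rw [dist_eq_norm] at hxy
      have h2 : φ y x = ‖y‖ + φ y (x - y) := by
        rw [map_sub, (hφ y).2]; simp
      have h3 := norm_sub_norm_le x y
      have h4 : φ y x ≤ ‖φ y x‖ := le_abs_self _
      have h5 := (abs_le.1 h1).1
      linarith)
  exact ⟨v⟩

/-- Normed spaces with linear isometric embeddings. -/
structure NSp : Type (u + 1) where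
  carrier : Type u
  [norm : NormedAddCommGroup carrier]
  [space : NormedSpace ℝ carrier]

attribute [instance] NSp.norm NSp.space

instance : Category.{u} NSp.{u} where
  Hom X Y := X.carrier →ₗᵢ[ℝ] Y.carrier
  id X := LinearIsometry.id
  comp f g := LinearIsometry.comp g f

section colim
variable {J : Type u} [LinearOrder J] (F : J ⥤ NSp.{u})

/-- Transition maps. -/
def NSp.tr (i j : J) (h : i ≤ j) : (F.obj i).carrier →ₗᵢ[ℝ] (F.obj j).carrier :=
  F.map (homOfLE h)

instance : DirectedSystem (fun j => (F.obj j).carrier) (NSp.tr F · · ·) where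
  map_self i x := by
    have : F.map (homOfLE (le_refl i)) = 𝟙 _ := F.map_id i
    exact congrArg (fun f : (F.obj i).carrier →ₗᵢ[ℝ] (F.obj i).carrier => f x) this
  map_map k j i hij hjk x := by
    have := F.map_comp (homOfLE hij) (homOfLE hjk)
    exact (congrArg (fun f : (F.obj _).carrier →ₗᵢ[ℝ] (F.obj _).carrier => f x) this).symm

/-- Direct limit. -/
abbrev NSp.DL : Type u := DirectLimit (fun j => (F.obj j).carrier) (NSp.tr F)

variable [Nonempty J]

noncomputable instance : Norm (NSp.DL F) where
  norm := DirectLimit.lift _ (fun i x => ‖x‖) (fun i j h x => ((NSp.tr F i j h).norm_map x).symm)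

theorem NSp.norm_mk (i : J) (x : (F.obj i).carrier) :
    ‖(⟦⟨i, x⟩⟧ : NSp.DL F)‖ = ‖x‖ := rfl

noncomputable instance : NormedAddCommGroup (NSp.DL F) :=
  AddGroupNorm.toNormedAddCommGroup
    { toFun := fun x => ‖x‖
      map_zero' := by
        rw [DirectLimit.zero_def (Classical.arbitrary J), NSp.norm_mk, norm_zero]
      add_le' := DirectLimit.induction₂ _ fun i x y => by
        rw [DirectLimit.add_def]; exact norm_add_le x y
      neg' := DirectLimit.induction _ fun i x => by
        rw [DirectLimit.neg_def]; exact norm_neg x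
      eq_zero_of_map_eq_zero' := DirectLimit.induction _ fun i x hx => by
        have : x = 0 := norm_eq_zero.1 hx
        rw [this, ← DirectLimit.zero_def] }

noncomputable instance : NormedSpace ℝ (NSp.DL F) where
  norm_smul_le r := DirectLimit.induction _ fun i x => by
    rw [DirectLimit.smul_def]; exact norm_smul_le r x

/-- Inclusions. -/
noncomputable def NSp.inc (i : J) : (F.obj i).carrier →ₗᵢ[ℝ] NSp.DL F where
  toFun x := ⟦⟨i, x⟩⟧
  map_add' x y := (DirectLimit.add_def ..).symm
  map_smul' r x := (DirectLimit.smul_def ..).symm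
  norm_map' x := rfl

theorem NSp.inc_tr (i j : J) (h : i ≤ j) (x : (F.obj i).carrier) :
    NSp.inc F j (NSp.tr F i j h x) = NSp.inc F i x :=
  Quotient.sound ⟨j, le_rfl, h, by
    exact DirectedSystem.map_self (f := (NSp.tr F · · ·)) _⟩

theorem NSp.exists_inc (x : NSp.DL F) : ∃ i y, NSp.inc F i y = x :=
  DirectLimit.induction _ (fun i y => ⟨i, y, rfl⟩) x

theorem NSp.exists_colim : ∃ (U : Type u) (_ : NormedAddCommGroup U) (_ : NormedSpace ℝ U)
    (inc : ∀ i, (F.obj i).carrier →ₗᵢ[ℝ] U),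
    (∀ i j h x, inc j (NSp.tr F i j h x) = inc i x) ∧ ∀ x, ∃ i y, inc i y = x :=
  ⟨NSp.DL F, inferInstance, inferInstance, NSp.inc F, NSp.inc_tr F, NSp.exists_inc F⟩

/-- The colimit cocone. -/
noncomputable def NSp.cocone : Cocone F where
  pt := ⟨NSp.DL F⟩
  ι := { app := fun i => NSp.inc F i
         naturality := fun i j f => LinearIsometry.ext fun x => NSp.inc_tr F i j (leOfHom f) x }

/-- The universal map. -/
noncomputable def NSp.desc (s : Cocone F) : NSp.DL F →ₗᵢ[ℝ] s.pt.carrier where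
  toFun := DirectLimit.lift _
    (fun i x => (show (F.obj i).carrier →ₗᵢ[ℝ] s.pt.carrier from s.ι.app i) x)
    (fun i j h x => by
      have := s.w (homOfLE h)
      exact (congrArg (fun f : (F.obj i).carrier →ₗᵢ[ℝ] s.pt.carrier => f x) this).symm)
  map_add' := DirectLimit.induction₂ _ fun i x y => by
    rw [DirectLimit.add_def]; exact LinearIsometry.map_add _ x y
  map_smul' r := DirectLimit.induction _ fun i x => by
    rw [DirectLimit.smul_def]; exact LinearIsometry.map_smul _ r x
  norm_map' := DirectLimit.induction _ fun i x => LinearIsometry.norm_map _ x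

/-- It is a colimit. -/
noncomputable def NSp.isColimit : IsColimit (NSp.cocone F) where
  desc s := NSp.desc F s
  fac s i := LinearIsometry.ext fun x => rfl
  uniq s m hm := LinearIsometry.ext <| DirectLimit.induction _ fun i x =>
    congrArg (fun f : (F.obj i).carrier →ₗᵢ[ℝ] s.pt.carrier => f x) (hm i)

end colim

theorem NSp.hasColim (J : Type u) [LinearOrder J] [Nonempty J] : HasColimitsOfShape J NSp.{u} :=
  ⟨fun F => ⟨⟨⟨_, NSp.isColimit F⟩⟩⟩⟩

theorem NSp.hasIteration (J : Type u) [LinearOrder J] [Nonempty J] :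
    HasIterationOfShape J NSp.{u} where
  hasColimitsOfShape_of_isSuccLimit j hj := by
    have : Nonempty (Set.Iio j) := hj.nonempty_Iio.to_subtype
    exact NSp.hasColim _
  hasColimitsOfShape := NSp.hasColim J

/-- Factorization of isometric embeddings. -/
theorem exists_factor {A E U : Type u} [NormedAddCommGroup A] [NormedSpace ℝ A]
    [NormedAddCommGroup E] [NormedSpace ℝ E] [NormedAddCommGroup U] [NormedSpace ℝ U]
    (f : A →ₗᵢ[ℝ] U) (g : E →ₗᵢ[ℝ] U) (h : ∀ a, ∃ e, g e = f a) :
    ∃ v : A →ₗᵢ[ℝ] E, ∀ a, g (v a) = f a := by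
  choose v hv using h
  refine ⟨⟨⟨⟨v, fun x y => ?_⟩, fun r x => ?_⟩, fun x => ?_⟩, hv⟩
  · apply g.injective; simp [hv]
  · apply g.injective; simp [hv]
  · change ‖v x‖ = ‖x‖
    rw [← g.norm_map, hv, f.norm_map]

/-- The main construction. -/
theorem exists_big (κ : Cardinal.{u}) (hκ : κ.IsRegular) (hκ' : Cardinal.aleph0 < κ)
    (L X : Type u) [NormedAddCommGroup L] [NormedSpace ℝ L]
    [NormedAddCommGroup X] [NormedSpace ℝ X] :
    ∃ (U : Type u) (_ : NormedAddCommGroup U) (_ : NormedSpace ℝ U),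
      CompleteSpace U ∧ Nonempty (X →ₗᵢ[ℝ] U) ∧
      ∀ (A : Submodule ℝ L) (v : A →ₗᵢ[ℝ] U), (∃ s : Set A, Dense s ∧ Cardinal.mk s < κ) →
        ∃ w : L →ₗᵢ[ℝ] U, ∀ a : A, w a = v a := by
  classical
  have : Fact κ.IsRegular := ⟨hκ⟩
  choose G st hst using fun Y : NSp.{u} => exists_step L Y.carrier
  let Φ : SmallObject.SuccStruct NSp.{u} :=
    { X₀ := ⟨X⟩
      succ := fun Y => ⟨lp (fun _ : G Y => ℝ) ∞⟩
      toSucc := fun Y => st Y }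
  let J := κ.ord.ToType
  have : Nonempty J := by simpa [J] using hκ.ne_zero
  let : OrderBot J := WellFoundedLT.toOrderBot J
  let : SuccOrder J := SuccOrder.ofLinearWellFoundedLT J
  have : NoMaxOrder J := Cardinal.noMaxOrder hκ'.le
  have := NSp.hasIteration J
  let F : J ⥤ NSp.{u} := Φ.iterationFunctor J
  have hP : ∀ {Y Z : NSp.{u}} (f : Y ⟶ Z), Φ.prop f → CompleteSpace Z.carrier ∧
      ∀ (A : Submodule ℝ L) (v : A →ₗᵢ[ℝ] Y.carrier), ∃ w : L →ₗᵢ[ℝ] Z.carrier,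
        ∀ a : A, w a = (show Y.carrier →ₗᵢ[ℝ] Z.carrier from f) (v a) := by
    intro Y Z f hf
    cases hf
    refine ⟨?_, hst _⟩
    change CompleteSpace (lp (fun _ : G _ => ℝ) ∞)
    infer_instance
  have hF : ∀ j : J, CompleteSpace (F.obj (Order.succ j)).carrier ∧
      ∀ (A : Submodule ℝ L) (v : A →ₗᵢ[ℝ] (F.obj j).carrier),
        ∃ w : L →ₗᵢ[ℝ] (F.obj (Order.succ j)).carrier,
        ∀ a : A, w a = NSp.tr F j _ (Order.le_succ j) (v a) := fun j =>
    hP _ (Φ.prop_iterationFunctor_map_succ j (not_isMax j))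
  obtain ⟨U, iU, jU, inc, inc_tr, exists_inc⟩ := NSp.exists_colim F
  have hbd : ∀ {K : Type u} (x : K → U), Cardinal.mk K < κ →
      ∃ j : J, ∀ k, ∃ y, inc (Order.succ j) y = x k := by
    intro K x hK
    choose i y hy using fun k => exists_inc (x k)
    have hK' : HasCardinalLT K κ := by rwa [hasCardinalLT_iff_cardinal_mk_lt]
    refine ⟨IsCardinalFiltered.max i hK', fun k => ⟨NSp.tr F (i k) _
      ((leOfHom (IsCardinalFiltered.toMax i hK' k)).trans (Order.le_succ _)) (y k), ?_⟩⟩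
    rw [inc_tr, hy]
  have hcr : ∀ j : J, IsComplete (Set.range (inc (Order.succ j))) := fun j => by
    have := (hF j).1
    exact (inc (Order.succ j)).isometry.isUniformInducing.isComplete_range
  refine ⟨U, iU, jU, ?_, ?_, ?_⟩
  · refine Metric.complete_of_cauchySeq_tendsto fun x hx => ?_
    obtain ⟨j, hj⟩ := hbd (fun n : ULift.{u} ℕ => x n.down) (by simpa using hκ')
    obtain ⟨a, -, ha⟩ := cauchySeq_tendsto_of_isComplete (hcr j) (fun n => hj ⟨n⟩) hx
    exact ⟨a, ha⟩
  · exact ⟨(inc ⊥).comp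
      (show X →ₗᵢ[ℝ] (F.obj ⊥).carrier from (Φ.iterationFunctorObjBotIso J).inv)⟩
  · rintro A v ⟨s, hs, hsκ⟩
    obtain ⟨j, hj⟩ := hbd (fun a : s => v a) hsκ
    have hr : ∀ a, ∃ e, inc (Order.succ j) e = v a := by
      have hcl := ((hcr j).isClosed).preimage v.continuous
      have : s ⊆ v ⁻¹' Set.range (inc (Order.succ j)) := fun a ha => hj ⟨a, ha⟩
      intro a
      exact closure_minimal this hcl (hs a)
    obtain ⟨v', hv'⟩ := exists_factor v (inc (Order.succ j)) hr
    obtain ⟨w, hw⟩ := (hF (Order.succ j)).2 A v'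
    refine ⟨(inc _).comp w, fun a => ?_⟩
    change inc _ (w a) = v a
    rw [hw, inc_tr, hv']

end Helpers

/-- For infinite cardinals `α ≤ β`, every Banach space embeds isometrically into some
Banach space of `(α, β)`-universal disposition. -/
theorem exists_abUnivDisp_extension
    (α β : Cardinal.{u}) (hα : Cardinal.aleph0 ≤ α) (hαβ : α ≤ β)
    (X : BanachSpace.{u}) :
    ∃ U : BanachSpace.{u}, IsABUnivDisp α β U ∧
      Nonempty (X.carrier →ₗᵢ[ℝ] U.carrier) := by
  have hκ : (Order.succ α).IsRegular := Cardinal.isRegular_succ hα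
  obtain ⟨U, iU, jU, hc, hX, hU⟩ := exists_big (Order.succ α) hκ
    (Order.lt_succ_of_le hα) (lp (fun _ : β.out => ℝ) ⊤) X.carrier
  refine ⟨⟨U⟩, ?_, hX⟩
  rintro A B ⟨s, hs, hsα⟩ hB u i
  obtain ⟨b⟩ := exists_embed_linfty β B.carrier hB
  let e := (b.comp i).equivRange
  obtain ⟨w, hw⟩ := hU _ (u.comp e.symm.toLinearIsometry) ⟨e '' s,
    e.surjective.denseRange.dense_image e.continuous hs, (Cardinal.mk_image_le.trans_lt hsα).trans
      (Order.lt_succ α)⟩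
  refine ⟨w.comp b, fun a => ?_⟩
  have := hw (e a)
  simpa [e] using this
end

section
/- A Banach space E is locally 1-injective if and only if E is a 1-complemented subspace of some Banach space of 𝔉-universal disposition; that is, if and only if there exist a Banach space U of 𝔉-universal disposition, a linear isometric embedding j : E → U, and a bounded linear operator P : U → E with ‖P‖ ≤ 1 and P ∘ j = id_E. -/
/-- `E` is locally `1`-injective: for every finite-dimensional Banach space `B` and every
subspace `A ⊆ B`, every operator `t : A → E` extends to `T : B → E` with `‖T‖ = ‖t‖`. -/
def IsLocallyInjective1 (E : BanachSpace.{u}) : Prop :=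
  ∀ B : BanachSpace.{u}, FiniteDimensional ℝ B.carrier →
    ∀ (A : Submodule ℝ B.carrier) (t : A →L[ℝ] E.carrier),
      ∃ T : B.carrier →L[ℝ] E.carrier,
        (∀ a : A, T (a : B.carrier) = t a) ∧ ‖T‖ = ‖t‖

/-- `U` is of universal disposition for finite-dimensional Banach spaces. -/
def IsUnivDispFin (U : BanachSpace.{u}) : Prop :=
  ∀ A B : BanachSpace.{u}, FiniteDimensional ℝ A.carrier → FiniteDimensional ℝ B.carrier →
    ∀ (u : A.carrier →ₗᵢ[ℝ] U.carrier) (i : A.carrier →ₗᵢ[ℝ] B.carrier),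
      ∃ u' : B.carrier →ₗᵢ[ℝ] U.carrier, ∀ a : A.carrier, u' (i a) = u a

namespace LocInj

/-- One-point extension of a seminorm. -/
noncomputable def extSeminorm {V X : Type*} [AddCommGroup V] [Module ℝ V] [AddCommGroup X]
    [Module ℝ X] (q : Seminorm ℝ V) (ρ : V →ₗ[ℝ] V) (φ : V →ₗ[ℝ] ℝ) (A : X →ₗ[ℝ] V)
    (N : Seminorm ℝ (X × ℝ)) : Seminorm ℝ V :=
  have bdd : ∀ w : V, BddBelow (Set.range fun a : X => q (ρ w - A a) + N (a, φ w)) := by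
    intro w
    refine ⟨0, ?_⟩
    rintro _ ⟨a, rfl⟩
    have h1 := apply_nonneg q (ρ w - A a)
    have h2 := apply_nonneg N (a, φ w)
    exact add_nonneg h1 h2
  Seminorm.ofSMulLE (fun w => ⨅ a : X, (q (ρ w - A a) + N (a, φ w)))
    (by
      apply le_antisymm
      · refine (ciInf_le (bdd 0) 0).trans ?_
        have : ((0 : X), (0 : ℝ)) = 0 := rfl
        simp [this]
      · exact le_ciInf fun a => add_nonneg (apply_nonneg _ _) (apply_nonneg _ _))
    (by
      intro x y
      refine le_ciInf_add_ciInf fun a b => ?_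
      refine (ciInf_le (bdd (x + y)) (a + b)).trans ?_
      have h1 : q (ρ (x + y) - A (a + b)) ≤ q (ρ x - A a) + q (ρ y - A b) := by
        have : ρ (x + y) - A (a + b) = (ρ x - A a) + (ρ y - A b) := by
          rw [map_add, map_add]; abel
        rw [this]; exact map_add_le_add _ _ _
      have h2 : N (a + b, φ (x + y)) ≤ N (a, φ x) + N (b, φ y) := by
        have : (a + b, φ (x + y)) = (a, φ x) + (b, φ y) := by simp
        rw [this]; exact map_add_le_add _ _ _
      linarith)
    (by
      intro r x
      rw [Real.mul_iInf_of_nonneg (norm_nonneg r)]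
      refine le_ciInf fun a => (ciInf_le (bdd (r • x)) (r • a)).trans (le_of_eq ?_)
      have h1 : ρ (r • x) - A (r • a) = r • (ρ x - A a) := by
        rw [map_smul, map_smul, smul_sub]
      have h2 : (r • a, φ (r • x)) = r • (a, φ x) := by simp
      rw [h1, h2, map_smul_eq_mul, map_smul_eq_mul, mul_add])

theorem extSeminorm_le {V X : Type*} [AddCommGroup V] [Module ℝ V] [AddCommGroup X]
    [Module ℝ X] (q : Seminorm ℝ V) (ρ : V →ₗ[ℝ] V) (φ : V →ₗ[ℝ] ℝ) (A : X →ₗ[ℝ] V)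
    (N : Seminorm ℝ (X × ℝ)) (w : V) (a : X) :
    extSeminorm q ρ φ A N w ≤ q (ρ w - A a) + N (a, φ w) := by
  refine ciInf_le (f := fun a : X => q (ρ w - A a) + N (a, φ w)) ?_ a
  refine ⟨0, ?_⟩
  rintro _ ⟨a, rfl⟩
  exact add_nonneg (apply_nonneg _ _) (apply_nonneg _ _)

theorem le_extSeminorm {V X : Type*} [AddCommGroup V] [Module ℝ V] [AddCommGroup X]
    [Module ℝ X] (q : Seminorm ℝ V) (ρ : V →ₗ[ℝ] V) (φ : V →ₗ[ℝ] ℝ) (A : X →ₗ[ℝ] V)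
    (N : Seminorm ℝ (X × ℝ)) (w : V) (c : ℝ) (h : ∀ a, c ≤ q (ρ w - A a) + N (a, φ w)) :
    c ≤ extSeminorm q ρ φ A N w :=
  le_ciInf h

/-- Terms: names of the elements of the space to be constructed. -/
inductive Tm (E : Type u) : Type u
  | base : E → Tm E
  | node : Seminorm ℝ ((ℕ →₀ ℝ) × ℝ) → (ℕ → Tm E) → Tm E

/-- Formal combinations of a sequence of terms. -/
noncomputable def comb {E : Type u} (args : ℕ → Tm E) : (ℕ →₀ ℝ) →ₗ[ℝ] (Tm E →₀ ℝ) :=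
  Finsupp.linearCombination ℝ (fun i => Finsupp.single (args i) (1 : ℝ))

theorem comb_mem {E : Type u} (args : ℕ → Tm E) (D : Set (Tm E)) (h : ∀ i, args i ∈ D)
    (a : ℕ →₀ ℝ) : comb args a ∈ Finsupp.supported ℝ ℝ D := by
  unfold comb
  rw [Finsupp.linearCombination_apply]
  exact Submodule.sum_mem _ fun i _ =>
    Submodule.smul_mem _ _ (Finsupp.single_mem_supported ℝ _ (h i))

variable {E : Type u} [NormedAddCommGroup E] [NormedSpace ℝ E]

/-- Value of the base terms. -/
def val : Tm E → E
  | .base e => e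
  | .node _ _ => 0

/-- Linear extension of `val`. -/
noncomputable def valL : (Tm E →₀ ℝ) →ₗ[ℝ] E := Finsupp.linearCombination ℝ val

/-- The node `node N args` solves its extension problem. -/
def Solves (q : Seminorm ℝ (Tm E →₀ ℝ)) (P : (Tm E →₀ ℝ) →ₗ[ℝ] E)
    (N : Seminorm ℝ ((ℕ →₀ ℝ) × ℝ)) (args : ℕ → Tm E) : Prop :=
  (∀ a, q (comb args a) = N (a, 0)) →
  (∃ e : E, ∀ a (s : ℝ), ‖P (comb args a) + s • e‖ ≤ N (a, s)) →
  ∀ a (s : ℝ), q (comb args a + s • Finsupp.single (Tm.node N args) 1) = N (a, s)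

theorem Solves.congr {q q' : Seminorm ℝ (Tm E →₀ ℝ)} {P P' : (Tm E →₀ ℝ) →ₗ[ℝ] E}
    {N : Seminorm ℝ ((ℕ →₀ ℝ) × ℝ)} {args : ℕ → Tm E} {D : Set (Tm E)}
    (h : Solves q P N args) (hq : ∀ w ∈ Finsupp.supported ℝ ℝ D, q' w = q w)
    (hP : ∀ w ∈ Finsupp.supported ℝ ℝ D, P' w = P w) (hn : Tm.node N args ∈ D)
    (ha : ∀ i, args i ∈ D) : Solves q' P' N args := by
  intro h1 h2 a s
  have hc := fun a => comb_mem args D ha a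
  rw [hq _ (Submodule.add_mem _ (hc a)
    (Submodule.smul_mem _ _ (Finsupp.single_mem_supported ℝ _ hn)))]
  refine h (fun a => by rw [← hq _ (hc a)]; exact h1 a) ?_ a s
  obtain ⟨e, he⟩ := h2
  exact ⟨e, fun a s => by rw [← hP _ (hc a)]; exact he a s⟩

/-- Partial structures. -/
structure Part (E : Type u) [NormedAddCommGroup E] [NormedSpace ℝ E] where
  D : Set (Tm E)
  q : Seminorm ℝ (Tm E →₀ ℝ)
  P : (Tm E →₀ ℝ) →ₗ[ℝ] E
  norm_le : ∀ w, ‖P w‖ ≤ q w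
  base_mem : ∀ e, Tm.base e ∈ D
  base_q : ∀ w ∈ Finsupp.supported ℝ ℝ (Set.range (Tm.base : E → Tm E)), q w = ‖valL w‖
  base_P : ∀ w ∈ Finsupp.supported ℝ ℝ (Set.range (Tm.base : E → Tm E)), P w = valL w
  args_mem : ∀ N args, Tm.node N args ∈ D → ∀ i, args i ∈ D
  solves : ∀ N args, Tm.node N args ∈ D → Solves q P N args

instance : Preorder (Part E) where
  le x y := x.D ⊆ y.D ∧ (∀ w ∈ Finsupp.supported ℝ ℝ x.D, y.q w = x.q w) ∧
    (∀ w ∈ Finsupp.supported ℝ ℝ x.D, y.P w = x.P w)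
  le_refl x := ⟨subset_rfl, fun _ _ => rfl, fun _ _ => rfl⟩
  le_trans x y z h1 h2 := ⟨h1.1.trans h2.1,
    fun w hw => (h2.2.1 w (Finsupp.supported_mono h1.1 hw)).trans (h1.2.1 w hw),
    fun w hw => (h2.2.2 w (Finsupp.supported_mono h1.1 hw)).trans (h1.2.2 w hw)⟩

instance : Nonempty (Part E) := ⟨{
  D := Set.range Tm.base
  q := (normSeminorm ℝ E).comp valL
  P := valL
  norm_le := fun w => le_rfl
  base_mem := fun e => ⟨e, rfl⟩
  base_q := fun w _ => rfl
  base_P := fun w _ => rfl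
  args_mem := by rintro N args ⟨e, he⟩; cases he
  solves := by rintro N args ⟨e, he⟩; cases he }⟩

theorem exists_ext (p : Part E) (N : Seminorm ℝ ((ℕ →₀ ℝ) × ℝ)) (args : ℕ → Tm E)
    (ht : Tm.node N args ∉ p.D) (ha : ∀ i, args i ∈ p.D) :
    ∃ p' : Part E, p ≤ p' ∧ Tm.node N args ∈ p'.D := by
  classical
  set t := Tm.node N args with htdef
  have hbs : Set.range (Tm.base : E → Tm E) ⊆ p.D := by
    rintro _ ⟨e, rfl⟩; exact p.base_mem e
  have hargs : ∀ N' args', Tm.node N' args' ∈ insert t p.D → ∀ i, args' i ∈ insert t p.D := by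
    intro N' args' h i
    rcases h with h | h
    · rw [htdef] at h
      cases h
      exact Set.mem_insert_of_mem _ (ha i)
    · exact Set.mem_insert_of_mem _ (p.args_mem _ _ h i)
  by_cases hv : (∀ a, p.q (comb args a) = N (a, 0)) ∧
      (∃ e : E, ∀ a (s : ℝ), ‖p.P (comb args a) + s • e‖ ≤ N (a, s))
  swap
  · refine ⟨{ p with
      D := insert t p.D
      base_mem := fun e => Set.mem_insert_of_mem _ (p.base_mem e)
      args_mem := hargs
      solves := ?_ }, ⟨Set.subset_insert _ _, fun _ _ => rfl, fun _ _ => rfl⟩,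
        Set.mem_insert _ _⟩
    rintro N' args' (h | h)
    · rw [htdef] at h
      cases h
      intro h1 h2
      exact absurd ⟨h1, h2⟩ hv
    · exact p.solves _ _ h
  obtain ⟨hN, e, he⟩ := hv
  let φ : (Tm E →₀ ℝ) →ₗ[ℝ] ℝ := Finsupp.lapply t
  let ρ : (Tm E →₀ ℝ) →ₗ[ℝ] (Tm E →₀ ℝ) := LinearMap.id - (Finsupp.lsingle t).comp φ
  let q' := extSeminorm p.q ρ φ (comb args) N
  let P' : (Tm E →₀ ℝ) →ₗ[ℝ] E := p.P.comp ρ + φ.smulRight e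
  have hφ : ∀ w ∈ Finsupp.supported ℝ ℝ p.D, φ w = 0 := fun w hw =>
    (Finsupp.mem_supported' ℝ w).1 hw t ht
  have hρ : ∀ w ∈ Finsupp.supported ℝ ℝ p.D, ρ w = w := fun w hw => by
    simp only [ρ, LinearMap.sub_apply, LinearMap.id_apply, LinearMap.comp_apply, hφ w hw, map_zero,
      sub_zero]
  have hqq : ∀ w ∈ Finsupp.supported ℝ ℝ p.D, q' w = p.q w := by
    intro w hw
    apply le_antisymm
    · refine (extSeminorm_le _ _ _ _ _ w 0).trans (le_of_eq ?_)
      have : ((0 : ℕ →₀ ℝ), (0 : ℝ)) = 0 := rfl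
      rw [hφ w hw, hρ w hw, this]
      simp
    · refine le_extSeminorm _ _ _ _ _ w _ fun a => ?_
      rw [hφ w hw, hρ w hw, ← hN]
      have := map_add_le_add p.q (w - comb args a) (comb args a)
      rwa [sub_add_cancel] at this
  have hPP : ∀ w ∈ Finsupp.supported ℝ ℝ p.D, P' w = p.P w := by
    intro w hw
    simp only [P', LinearMap.add_apply, LinearMap.comp_apply, LinearMap.smulRight_apply,
      hφ w hw, hρ w hw, zero_smul, add_zero]
  refine ⟨{
    D := insert t p.D
    q := q'
    P := P'
    norm_le := ?_
    base_mem := fun e => Set.mem_insert_of_mem _ (p.base_mem e)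
    base_q := fun w hw => (hqq w (Finsupp.supported_mono hbs hw)).trans (p.base_q w hw)
    base_P := fun w hw => (hPP w (Finsupp.supported_mono hbs hw)).trans (p.base_P w hw)
    args_mem := hargs
    solves := ?_ }, ⟨Set.subset_insert _ _, hqq, hPP⟩, Set.mem_insert _ _⟩
  · intro w
    refine le_extSeminorm _ _ _ _ _ w _ fun a => ?_
    have h1 : P' w = p.P (ρ w - comb args a) + (p.P (comb args a) + φ w • e) := by
      simp only [P', LinearMap.add_apply, LinearMap.comp_apply, LinearMap.smulRight_apply, map_sub]
      abel
    rw [h1]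
    exact (norm_add_le _ _).trans (add_le_add (p.norm_le _) (he _ _))
  · rintro N' args' (h | h)
    · rw [htdef] at h
      cases h
      intro _ _ a s
      have hca := comb_mem args p.D ha a
      have h1 : φ (comb args a + s • Finsupp.single t 1) = s := by
        rw [map_add, hφ _ hca]
        simp [φ]
      have h2 : ρ (comb args a + s • Finsupp.single t 1) = comb args a := by
        rw [map_add, hρ _ hca]
        simp [ρ, φ]
      change q' (comb args a + s • Finsupp.single t 1) = _
      apply le_antisymm
      · refine (extSeminorm_le _ _ _ _ _ _ a).trans (le_of_eq ?_)
        rw [h1, h2]; simp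
      · refine le_extSeminorm _ _ _ _ _ _ _ fun b => ?_
        rw [h1, h2, ← map_sub, hN]
        have := map_add_le_add N (a - b, 0) (b, s)
        simpa using this
    · exact (p.solves _ _ h).congr hqq hPP h (p.args_mem _ _ h)

theorem chain_bdd (c : Set (Part E)) (hc : IsChain (· ≤ ·) c) (hne : c.Nonempty) :
    BddAbove c := by
  classical
  let D : Set (Tm E) := ⋃ p ∈ c, p.D
  have hdir : ∀ p ∈ c, ∀ p' ∈ c, ∃ r ∈ c, p ≤ r ∧ p' ≤ r := by
    intro p hp p' hp'
    rcases hc.total hp hp' with h | h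
    · exact ⟨p', hp', h, le_rfl⟩
    · exact ⟨p, hp, le_rfl, h⟩
  have hfin : ∀ w ∈ Finsupp.supported ℝ ℝ D, ∃ p ∈ c, w ∈ Finsupp.supported ℝ ℝ p.D := by
    intro w hw
    have key : ∀ s : Finset (Tm E), (s : Set (Tm E)) ⊆ D → ∃ p ∈ c, (s : Set (Tm E)) ⊆ p.D := by
      intro s
      induction s using Finset.induction_on with
      | empty => intro _; obtain ⟨p, hp⟩ := hne; exact ⟨p, hp, by simp⟩
      | insert x s _ ih =>
        intro hs
        rw [Finset.coe_insert, Set.insert_subset_iff] at hs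
        obtain ⟨p, hp, hps⟩ := ih hs.2
        have hx := hs.1
        simp only [D, Set.mem_iUnion] at hx
        obtain ⟨p', hp', hx⟩ := hx
        obtain ⟨r, hr, h1, h2⟩ := hdir p hp p' hp'
        refine ⟨r, hr, ?_⟩
        rw [Finset.coe_insert, Set.insert_subset_iff]
        exact ⟨h2.1 hx, hps.trans h1.1⟩
    exact key _ hw
  let R : (Tm E →₀ ℝ) →ₗ[ℝ] (Tm E →₀ ℝ) :=
    (Finsupp.supported ℝ ℝ D).subtype.comp (Finsupp.restrictDom ℝ ℝ D)
  have hR : ∀ w, R w ∈ Finsupp.supported ℝ ℝ D := fun w => (Finsupp.restrictDom ℝ ℝ D w).2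
  have hRid : ∀ w ∈ Finsupp.supported ℝ ℝ D, R w = w := by
    intro w hw
    have := LinearMap.congr_fun (Finsupp.restrictDom_comp_subtype (R := ℝ) (M := ℝ) D) ⟨w, hw⟩
    exact congrArg Subtype.val this
  choose! st hst hstm using hfin
  have hq : ∀ p ∈ c, ∀ w ∈ Finsupp.supported ℝ ℝ p.D, w ∈ Finsupp.supported ℝ ℝ D →
      (st w).q w = p.q w ∧ (st w).P w = p.P w := by
    intro p hp w hw hwD
    obtain ⟨r, hr, h1, h2⟩ := hdir p hp (st w) (hst w hwD)
    exact ⟨(h2.2.1 w (hstm w hwD)).symm.trans (h1.2.1 w hw),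
      (h2.2.2 w (hstm w hwD)).symm.trans (h1.2.2 w hw)⟩
  have h2 : ∀ x ∈ Finsupp.supported ℝ ℝ D, ∀ y ∈ Finsupp.supported ℝ ℝ D, ∃ r ∈ c,
      x ∈ Finsupp.supported ℝ ℝ r.D ∧ y ∈ Finsupp.supported ℝ ℝ r.D := by
    intro x hx y hy
    obtain ⟨r, hr, h1, h2⟩ := hdir _ (hst x hx) _ (hst y hy)
    exact ⟨r, hr, Finsupp.supported_mono h1.1 (hstm x hx),
      Finsupp.supported_mono h2.1 (hstm y hy)⟩
  let q : Seminorm ℝ (Tm E →₀ ℝ) := Seminorm.of (fun w => (st (R w)).q (R w))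
    (by
      intro x y
      obtain ⟨r, hr, hx, hy⟩ := h2 _ (hR x) _ (hR y)
      have hxy := Submodule.add_mem _ hx hy
      rw [← map_add] at hxy
      rw [(hq r hr _ hx (hR x)).1, (hq r hr _ hy (hR y)).1, (hq r hr _ hxy (hR _)).1, map_add]
      exact map_add_le_add _ _ _)
    (by
      intro s x
      have hx := hstm _ (hR x)
      have hsx := Submodule.smul_mem _ s hx
      rw [← map_smul] at hsx
      rw [(hq _ (hst _ (hR x)) _ hsx (hR _)).1, map_smul, map_smul_eq_mul])
  let P : (Tm E →₀ ℝ) →ₗ[ℝ] E :=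
    { toFun := fun w => (st (R w)).P (R w)
      map_add' := by
        intro x y
        obtain ⟨r, hr, hx, hy⟩ := h2 _ (hR x) _ (hR y)
        have hxy := Submodule.add_mem _ hx hy
        rw [← map_add] at hxy
        rw [(hq r hr _ hx (hR x)).2, (hq r hr _ hy (hR y)).2, (hq r hr _ hxy (hR _)).2, map_add,
          map_add]
      map_smul' := by
        intro s x
        have hx := hstm _ (hR x)
        have hsx := Submodule.smul_mem _ s hx
        rw [← map_smul] at hsx
        rw [(hq _ (hst _ (hR x)) _ hsx (hR _)).2, map_smul, map_smul, RingHom.id_apply] }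
  have hsub : ∀ p ∈ c, p.D ⊆ D := fun p hp => Set.subset_biUnion_of_mem (u := fun p => Part.D p) hp
  have hqp : ∀ p ∈ c, ∀ w ∈ Finsupp.supported ℝ ℝ p.D, q w = p.q w := by
    intro p hp w hw
    have hwD := Finsupp.supported_mono (hsub p hp) hw
    change (st (R w)).q (R w) = _
    rw [hRid w hwD]
    exact (hq p hp w hw hwD).1
  have hPp : ∀ p ∈ c, ∀ w ∈ Finsupp.supported ℝ ℝ p.D, P w = p.P w := by
    intro p hp w hw
    have hwD := Finsupp.supported_mono (hsub p hp) hw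
    change (st (R w)).P (R w) = _
    rw [hRid w hwD]
    exact (hq p hp w hw hwD).2
  obtain ⟨p0, hp0⟩ := hne
  have hbs : Set.range (Tm.base : E → Tm E) ⊆ p0.D := by
    rintro _ ⟨e, rfl⟩; exact p0.base_mem e
  refine ⟨{
    D := D
    q := q
    P := P
    norm_le := fun w => (st (R w)).norm_le (R w)
    base_mem := fun e => hsub p0 hp0 (p0.base_mem e)
    base_q := fun w hw => (hqp p0 hp0 w (Finsupp.supported_mono hbs hw)).trans (p0.base_q w hw)
    base_P := fun w hw => (hPp p0 hp0 w (Finsupp.supported_mono hbs hw)).trans (p0.base_P w hw)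
    args_mem := ?_
    solves := ?_ }, fun p hp => ⟨hsub p hp, hqp p hp, hPp p hp⟩⟩
  · intro N args h i
    simp only [D, Set.mem_iUnion] at h
    obtain ⟨p, hp, h⟩ := h
    exact hsub p hp (p.args_mem _ _ h i)
  · intro N args h
    simp only [D, Set.mem_iUnion] at h
    obtain ⟨p, hp, h⟩ := h
    exact (p.solves _ _ h).congr (hqp p hp) (hPp p hp) h (p.args_mem _ _ h)

theorem exists_full : ∃ p : Part E, ∀ t, t ∈ p.D := by
  obtain ⟨p, hp⟩ := zorn_le_nonempty (α := Part E) chain_bdd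
  refine ⟨p, fun t => ?_⟩
  induction t with
  | base e => exact p.base_mem e
  | node N args ih =>
    by_contra h
    obtain ⟨p', h1, h2⟩ := exists_ext p N args h ih
    exact h ((hp h1).1 h2)

theorem exists_quot {V : Type u} [AddCommGroup V] [Module ℝ V] (q : Seminorm ℝ V) :
    ∃ (U : Type u) (_ : NormedAddCommGroup U) (_ : NormedSpace ℝ U) (mk : V →ₗ[ℝ] U),
      Function.Surjective mk ∧ ∀ v, ‖mk v‖ = q v := by
  let i1 : SeminormedAddCommGroup V := q.toAddGroupSeminorm.toSeminormedAddCommGroup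
  let i2 : NormedSpace ℝ V := { norm_smul_le := fun a b => (map_smul_eq_mul q a b).le }
  exact ⟨SeparationQuotient V, inferInstance, inferInstance,
    (SeparationQuotient.mkCLM ℝ V : V →ₗ[ℝ] SeparationQuotient V),
    SeparationQuotient.surjective_mk, fun v => SeparationQuotient.norm_mk v⟩

/-- One-point extension property over `E`. -/
def Star {U : Type u} [NormedAddCommGroup U] [NormedSpace ℝ U] (P : U →ₗ[ℝ] E) : Prop :=
  ∀ (x : ℕ → U) (N : Seminorm ℝ ((ℕ →₀ ℝ) × ℝ)),
    (∀ a, ‖Finsupp.linearCombination ℝ x a‖ = N (a, 0)) →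
    (∃ e : E, ∀ a (s : ℝ), ‖P (Finsupp.linearCombination ℝ x a) + s • e‖ ≤ N (a, s)) →
    ∃ y : U, ∀ a (s : ℝ), ‖Finsupp.linearCombination ℝ x a + s • y‖ = N (a, s)

theorem exists_args (w : Tm E →₀ ℝ) : ∃ (args : ℕ → Tm E) (a : ℕ →₀ ℝ), comb args a = w := by
  classical
  have hc : (insert (Tm.base 0) (w.support : Set (Tm E))).Countable :=
    (w.support.finite_toSet.insert _).countable
  obtain ⟨args, hargs⟩ := hc.exists_eq_range (Set.insert_nonempty _ _)
  refine ⟨args, ?_⟩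
  have h1 : w ∈ Submodule.span ℝ (Set.range fun i => Finsupp.single (args i) (1 : ℝ)) := by
    have : (Set.range fun i => Finsupp.single (args i) (1 : ℝ)) =
        (fun t => Finsupp.single t (1 : ℝ)) '' (Set.range args) := by
      rw [← Set.range_comp]; rfl
    rw [this, ← Finsupp.supported_eq_span_single, Finsupp.mem_supported, ← hargs]
    exact Set.subset_insert _ _
  rw [← Finsupp.range_linearCombination] at h1
  exact h1

theorem exists_space : ∃ (U : Type u) (_ : NormedAddCommGroup U) (_ : NormedSpace ℝ U)
    (P : U →ₗ[ℝ] E) (j : E →ₗᵢ[ℝ] U), (∀ x, ‖P x‖ ≤ ‖x‖) ∧ (∀ x, P (j x) = x) ∧ Star P := by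
  obtain ⟨p, hp⟩ := exists_full (E := E)
  obtain ⟨U, i1, i2, mk, hsurj, hmk⟩ := exists_quot p.q
  have hker : mk.ker ≤ p.P.ker := by
    intro w hw
    rw [LinearMap.mem_ker] at hw ⊢
    have := p.norm_le w
    rw [← hmk, hw, norm_zero] at this
    exact norm_le_zero_iff.1 this
  obtain ⟨g, hg⟩ := LinearMap.exists_rightInverse_of_surjective mk (LinearMap.range_eq_top.2 hsurj)
  have hg' : ∀ u, mk (g u) = u := fun u => LinearMap.congr_fun hg u
  let P : U →ₗ[ℝ] E := p.P.comp g
  have hP : ∀ w, P (mk w) = p.P w := by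
    intro w
    have : g (mk w) - w ∈ mk.ker := by
      rw [LinearMap.mem_ker, map_sub, hg', sub_self]
    have := hker this
    rw [LinearMap.mem_ker, map_sub, sub_eq_zero] at this
    exact this
  have hbm : ∀ (e : E) (s : ℝ), Finsupp.single (Tm.base e) s ∈
      Finsupp.supported ℝ ℝ (Set.range (Tm.base : E → Tm E)) := fun e s =>
    Finsupp.single_mem_supported ℝ _ ⟨e, rfl⟩
  have hval : ∀ (e : E) (s : ℝ), valL (Finsupp.single (Tm.base e) s) = s • e := by
    intro e s; simp [valL, val]
  have hmkeq : ∀ w w', p.q (w - w') = 0 → mk w = mk w' := by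
    intro w w' h
    rw [← hmk, norm_eq_zero, map_sub, sub_eq_zero] at h
    exact h
  have hnode : ∀ N args, Solves p.q p.P N args := fun N args => p.solves N args (hp _)
  have hT : ∀ u : U, ∃ t, mk (Finsupp.single t 1) = u := by
    intro u
    obtain ⟨w, rfl⟩ := hsurj u
    obtain ⟨args, c, hc⟩ := exists_args w
    let N : Seminorm ℝ ((ℕ →₀ ℝ) × ℝ) :=
      p.q.comp ((comb args).coprod (LinearMap.toSpanSingleton ℝ _ w))
    have hN : ∀ a s, N (a, s) = p.q (comb args a + s • w) := by
      intro a s; simp [N]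
    refine ⟨Tm.node N args, ?_⟩
    have := hnode N args (fun a => by simp [hN])
      ⟨p.P w, fun a s => by rw [hN, ← map_smul, ← map_add]; exact p.norm_le _⟩ (-c) 1
    apply hmkeq
    rw [hN, map_neg, hc, one_smul, one_smul, neg_add_cancel, map_zero, neg_add_eq_sub] at this
    exact this
  refine ⟨U, i1, i2, P,
    { toFun := fun e => mk (Finsupp.single (Tm.base e) 1)
      map_add' := ?_
      map_smul' := ?_
      norm_map' := ?_ }, ?_, ?_, ?_⟩
  · intro x y
    rw [← map_add]
    apply hmkeq
    rw [p.base_q _ (Submodule.sub_mem _ (hbm _ _) (Submodule.add_mem _ (hbm _ _) (hbm _ _)))]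
    simp [hval]
  · intro s x
    rw [← map_smul]
    apply hmkeq
    rw [p.base_q _ (Submodule.sub_mem _ (hbm _ _) (Submodule.smul_mem _ _ (hbm _ _)))]
    simp [hval]
  · intro x
    change ‖mk (Finsupp.single (Tm.base x) 1)‖ = _
    rw [hmk, p.base_q _ (hbm _ _), hval, one_smul]
  · intro x
    obtain ⟨w, rfl⟩ := hsurj x
    rw [hP, hmk]; exact p.norm_le w
  · intro x
    change P (mk (Finsupp.single (Tm.base x) 1)) = _
    rw [hP, p.base_P _ (hbm _ _), hval, one_smul]
  · intro x N h1 h2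
    choose args hargs using fun i => hT (x i)
    have hlc : ∀ a, Finsupp.linearCombination ℝ x a = mk (comb args a) := by
      intro a
      rw [comb, Finsupp.linearCombination_apply, Finsupp.linearCombination_apply, Finsupp.sum,
        Finsupp.sum, map_sum]
      refine Finset.sum_congr rfl fun i _ => ?_
      rw [map_smul, hargs]
    refine ⟨mk (Finsupp.single (Tm.node N args) 1), fun a s => ?_⟩
    rw [hlc, ← map_smul, ← map_add, hmk]
    refine hnode N args (fun a => by rw [← hmk, ← hlc]; exact h1 a) ?_ a s
    obtain ⟨e, he⟩ := h2
    exact ⟨e, fun a s => by rw [← hP, ← hlc]; exact he a s⟩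

theorem Star.complete {U : Type u} [NormedAddCommGroup U] [NormedSpace ℝ U] [CompleteSpace E]
    {P : U →ₗ[ℝ] E} (hP : ∀ x, ‖P x‖ ≤ ‖x‖) (h : Star P) : CompleteSpace U := by
  refine Metric.complete_of_cauchySeq_tendsto fun x hx => ?_
  let ι : U →ₗᵢ[ℝ] UniformSpace.Completion U := UniformSpace.Completion.toComplₗᵢ
  obtain ⟨ξ, hξ⟩ := cauchySeq_tendsto_of_complete (u := fun n => ι (x n))
    (ι.isometry.uniformContinuous.comp_cauchySeq hx)
  have hPx : CauchySeq (fun n => P (x n)) := by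
    have : LipschitzWith 1 P := by
      refine LipschitzWith.of_dist_le_mul fun a b => ?_
      rw [dist_eq_norm, dist_eq_norm, ← map_sub]
      simpa using hP (a - b)
    exact this.uniformContinuous.comp_cauchySeq hx
  obtain ⟨e, he⟩ := cauchySeq_tendsto_of_complete hPx
  let N : Seminorm ℝ ((ℕ →₀ ℝ) × ℝ) := (normSeminorm ℝ (UniformSpace.Completion U)).comp
    ((ι.toLinearMap.comp (Finsupp.linearCombination ℝ x)).coprod
      (LinearMap.toSpanSingleton ℝ _ ξ))
  have hN : ∀ a s, N (a, s) = ‖ι (Finsupp.linearCombination ℝ x a) + s • ξ‖ := by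
    intro a s; simp [N]
  obtain ⟨y, hy⟩ := h x N (fun a => by simp [hN]) ⟨e, fun a s => by
    rw [hN]
    refine le_of_tendsto_of_tendsto ((tendsto_const_nhds.add (he.const_smul s)).norm)
      ((tendsto_const_nhds.add (hξ.const_smul s)).norm) (Filter.Eventually.of_forall fun n => ?_)
    change ‖P (Finsupp.linearCombination ℝ x a) + s • P (x n)‖ ≤
      ‖ι (Finsupp.linearCombination ℝ x a) + s • ι (x n)‖
    rw [← map_smul, ← map_add, ← map_smul, ← map_add, ι.norm_map]
    exact hP _⟩
  refine ⟨y, ?_⟩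
  rw [tendsto_iff_norm_sub_tendsto_zero] at hξ ⊢
  refine hξ.congr fun n => ?_
  have := hy (Finsupp.single n 1) (-1)
  rw [hN] at this
  simp only [Finsupp.linearCombination_single, one_smul, neg_smul, ← sub_eq_add_neg] at this
  exact this.symm

theorem Star.step {U B : Type u} [NormedAddCommGroup U] [NormedSpace ℝ U]
    [NormedAddCommGroup B] [NormedSpace ℝ B] [FiniteDimensional ℝ B]
    {P : U →ₗ[ℝ] E} (hP : ∀ x, ‖P x‖ ≤ ‖x‖) (h : Star P)
    (hE : ∀ (A : Submodule ℝ B) (t : A →L[ℝ] E), ∃ T : B →L[ℝ] E, (∀ a : A, T a = t a) ∧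
      ‖T‖ = ‖t‖) (S : Submodule ℝ B) :
    ∀ f : B →ₗ[ℝ] U, (∀ x ∈ S, ‖f x‖ = ‖x‖) →
      ∃ g : B →ₗ[ℝ] U, (∀ x ∈ S, g x = f x) ∧ ∀ x, ‖g x‖ = ‖x‖ := by
  induction S using WellFoundedGT.induction with
  | ind S ih =>
  intro f hf
  by_cases hS : S = ⊤
  · exact ⟨f, fun _ _ => rfl, fun x => hf x (hS ▸ Submodule.mem_top)⟩
  obtain ⟨b, hb⟩ : ∃ b, b ∉ S := by
    by_contra hcon
    push Not at hcon
    exact hS (Submodule.eq_top_iff'.2 hcon)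
  obtain ⟨s0, hs0⟩ := (IsNoetherian.noetherian S : S.FG)
  obtain ⟨z, hz⟩ := ((s0.finite_toSet.insert 0).countable).exists_eq_range (Set.insert_nonempty _ _)
  have hspan : Submodule.span ℝ (Set.range z) = S := by
    rw [← hz, Submodule.span_insert_zero, hs0]
  let t0 : S →ₗ[ℝ] E := P.comp (f.comp S.subtype)
  have ht0 : ∀ x, ‖t0 x‖ ≤ 1 * ‖x‖ := by
    intro x
    rw [one_mul]
    exact (hP _).trans (hf x x.2).le
  obtain ⟨T, hT1, hT2⟩ := hE S (t0.mkContinuous 1 ht0)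
  have hT3 : ‖T‖ ≤ 1 := hT2.trans_le (LinearMap.mkContinuous_norm_le _ zero_le_one _)
  have hzS : ∀ a, Finsupp.linearCombination ℝ z a ∈ S := by
    intro a
    rw [← hspan, ← Finsupp.range_linearCombination]
    exact ⟨a, rfl⟩
  let N : Seminorm ℝ ((ℕ →₀ ℝ) × ℝ) := (normSeminorm ℝ B).comp
    ((Finsupp.linearCombination ℝ z).coprod (LinearMap.toSpanSingleton ℝ _ b))
  have hN : ∀ a s, N (a, s) = ‖Finsupp.linearCombination ℝ z a + s • b‖ := by
    intro a s; simp [N]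
  have hfz : ∀ a, Finsupp.linearCombination ℝ (fun i => f (z i)) a =
      f (Finsupp.linearCombination ℝ z a) := by
    intro a
    rw [Finsupp.apply_linearCombination]; rfl
  obtain ⟨y, hy⟩ := h (fun i => f (z i)) N (fun a => by
      rw [hfz, hf _ (hzS a), hN]; simp) ⟨T b, fun a s => by
      rw [hfz, hN]
      have h1 : P (f (Finsupp.linearCombination ℝ z a)) = T (Finsupp.linearCombination ℝ z a) :=
        (hT1 ⟨_, hzS a⟩).symm
      rw [h1, ← map_smul, ← map_add]
      exact (T.le_of_opNorm_le hT3 _).trans (one_mul _).le⟩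
  obtain ⟨φ, hφ0, hφb⟩ : ∃ φ : B →ₗ[ℝ] ℝ, (∀ x ∈ S, φ x = 0) ∧ φ b = 1 := by
    obtain ⟨φ, h1, h2⟩ := Submodule.exists_le_ker_of_notMem hb
    refine ⟨(φ b)⁻¹ • φ, fun x hx => ?_, ?_⟩
    · have : φ x = 0 := h2 hx
      simp [this]
    · simp [h1]
  let f' : B →ₗ[ℝ] U := f + φ.smulRight (y - f b)
  have hf'S : ∀ x ∈ S, f' x = f x := by
    intro x hx; simp [f', hφ0 x hx]
  have hf'b : f' b = y := by simp [f', hφb]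
  obtain ⟨g, hg1, hg2⟩ := ih (S ⊔ Submodule.span ℝ {b}) (by
      refine lt_of_le_of_ne le_sup_left fun heq => hb ?_
      rw [heq]
      exact Submodule.mem_sup_right (Submodule.mem_span_singleton_self b)) f' (by
    intro x hx
    obtain ⟨v, hv, w, hw, rfl⟩ := Submodule.mem_sup.1 hx
    obtain ⟨s, rfl⟩ := Submodule.mem_span_singleton.1 hw
    rw [← hspan, ← Finsupp.range_linearCombination] at hv
    obtain ⟨a, rfl⟩ := hv
    rw [map_add, map_smul, hf'S _ (hzS a), hf'b, ← hfz, hy, hN])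
  exact ⟨g, fun x hx => (hg1 x (Submodule.mem_sup_left hx)).trans (hf'S x hx), hg2⟩

theorem forward (E : BanachSpace.{u}) (hE : IsLocallyInjective1 E) :
    ∃ U : BanachSpace.{u}, IsUnivDispFin U ∧
      ∃ (j : E.carrier →ₗᵢ[ℝ] U.carrier) (P : U.carrier →L[ℝ] E.carrier),
        ‖P‖ ≤ 1 ∧ ∀ x : E.carrier, P (j x) = x := by
  obtain ⟨U, i1, i2, P, j, hP, hj, hstar⟩ := exists_space (E := E.carrier)
  have := hstar.complete hP
  refine ⟨⟨U⟩, ?_, j, P.mkContinuous 1 (fun x => by rw [one_mul]; exact hP x),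
    LinearMap.mkContinuous_norm_le _ zero_le_one _, hj⟩
  intro A B hA hB v i
  obtain ⟨r, hr⟩ := LinearMap.exists_leftInverse_of_injective i.toLinearMap
    (LinearMap.ker_eq_bot.2 i.injective)
  have hr' : ∀ a, r (i a) = a := fun a => LinearMap.congr_fun hr a
  obtain ⟨g, hg1, hg2⟩ := hstar.step (B := B.carrier) hP (hE B hB) i.toLinearMap.range
    (v.toLinearMap.comp r) (by
      rintro _ ⟨a, rfl⟩
      change ‖v (r (i a))‖ = ‖i a‖
      rw [hr', v.norm_map, i.norm_map])
  refine ⟨⟨g, hg2⟩, fun a => ?_⟩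
  have h1 : g (i a) = v (r (i a)) := hg1 (i a) ⟨a, rfl⟩
  rw [hr'] at h1
  exact h1

theorem univDisp_ext (U : BanachSpace.{u}) (hU : IsUnivDispFin U) (B : BanachSpace.{u})
    (hB : FiniteDimensional ℝ B.carrier) (A : Submodule ℝ B.carrier) (t : A →L[ℝ] U.carrier)
    (ht : ‖t‖ ≤ 1) :
    ∃ T : B.carrier →L[ℝ] U.carrier, (∀ a : A, T a = t a) ∧ ‖T‖ ≤ 1 := by
  let F : Submodule ℝ U.carrier := t.toLinearMap.range
  have : FiniteDimensional ℝ F := inferInstance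
  let t' : A →ₗ[ℝ] F := t.toLinearMap.rangeRestrict
  let M := WithLp 1 (F × B.carrier)
  let κ : A →ₗ[ℝ] M := (WithLp.linearEquiv 1 ℝ (F × B.carrier)).symm.toLinearMap.comp
    (t'.prod (-A.subtype))
  have : FiniteDimensional ℝ M :=
    (WithLp.linearEquiv 1 ℝ (F × B.carrier)).symm.finiteDimensional
  let K : Submodule ℝ M := κ.range
  have : IsClosed (K : Set M) := K.closed_of_finiteDimensional
  let inF : F →ₗ[ℝ] M := (WithLp.linearEquiv 1 ℝ (F × B.carrier)).symm.toLinearMap.comp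
    (LinearMap.inl ℝ _ _)
  let inB : B.carrier →ₗ[ℝ] M := (WithLp.linearEquiv 1 ℝ (F × B.carrier)).symm.toLinearMap.comp
    (LinearMap.inr ℝ _ _)
  have hnM : ∀ m : M, ‖m‖ = ‖m.fst‖ + ‖m.snd‖ := fun m => WithLp.prod_norm_eq_of_L1 m
  have hinF : ∀ x, ‖inF x‖ = ‖x‖ := by
    intro x; rw [hnM]; simp [inF]
  have hinB : ∀ x, ‖inB x‖ = ‖x‖ := by
    intro x; rw [hnM]; simp [inB]
  let Q : BanachSpace.{u} := ⟨M ⧸ K⟩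
  have : FiniteDimensional ℝ Q.carrier := inferInstanceAs (FiniteDimensional ℝ (M ⧸ K))
  let i : F →ₗᵢ[ℝ] M ⧸ K := ⟨K.mkQ.comp inF, by
    intro x
    apply le_antisymm
    · exact (Submodule.Quotient.norm_mk_le K (inF x)).trans (hinF x).le
    · refine (QuotientAddGroup.le_norm_iff (S := K.toAddSubgroup)
        (x := (Submodule.Quotient.mk (inF x) : M ⧸ K))).2 fun m hm => ?_
      have hm' : m - inF x ∈ K := (Submodule.Quotient.eq K).1 hm
      obtain ⟨a, ha⟩ := hm'
      have hm2 : m = κ a + inF x := by rw [ha]; abel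
      have h1 : m.fst = t' a + x := by rw [hm2]; rfl
      have h2 : m.snd = -(a : B.carrier) := by
        rw [hm2]
        change -(a : B.carrier) + 0 = _
        rw [add_zero]
      rw [hnM, h1, h2, norm_neg]
      have h3 : ‖t' a‖ ≤ ‖(a : B.carrier)‖ :=
        (t.le_of_opNorm_le ht a).trans (one_mul _).le
      have h4 : ‖x‖ ≤ ‖t' a + x‖ + ‖t' a‖ := by
        have := norm_sub_le (t' a + x) (t' a)
        rwa [add_sub_cancel_left] at this
      linarith⟩
  obtain ⟨w, hw⟩ := hU ⟨F⟩ Q inferInstance inferInstance F.subtypeₗᵢ i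
  let T0 : B.carrier →ₗ[ℝ] U.carrier := w.toLinearMap.comp (K.mkQ.comp inB)
  have hT0 : ∀ x, ‖T0 x‖ ≤ 1 * ‖x‖ := by
    intro x
    rw [one_mul]
    change ‖w (K.mkQ (inB x))‖ ≤ _
    rw [w.norm_map]
    exact (Submodule.Quotient.norm_mk_le K (inB x)).trans (hinB x).le
  refine ⟨T0.mkContinuous 1 hT0, fun a => ?_, LinearMap.mkContinuous_norm_le _ zero_le_one _⟩
  have h1 : K.mkQ (inB a) = i (t' a) := by
    refine ((Submodule.Quotient.eq K).2 ?_).symm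
    refine ⟨a, ?_⟩
    apply (WithLp.linearEquiv 1 ℝ (F × B.carrier)).injective
    refine Prod.ext ?_ ?_
    · change t' a = t' a - 0
      rw [sub_zero]
    · change -(a : B.carrier) = 0 - a
      rw [zero_sub]
  change w (K.mkQ (inB a)) = t a
  rw [h1]
  exact hw (t' a)

theorem backward (E U : BanachSpace.{u}) (hU : IsUnivDispFin U)
    (j : E.carrier →ₗᵢ[ℝ] U.carrier) (P : U.carrier →L[ℝ] E.carrier) (hP : ‖P‖ ≤ 1)
    (hj : ∀ x : E.carrier, P (j x) = x) : IsLocallyInjective1 E := by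
  intro B hB A t
  have ht : ‖j.toContinuousLinearMap.comp (‖t‖⁻¹ • t)‖ ≤ 1 := by
    refine ContinuousLinearMap.opNorm_le_bound _ zero_le_one fun a => ?_
    change ‖j (‖t‖⁻¹ • t a)‖ ≤ _
    rw [j.norm_map, norm_smul, norm_inv, Real.norm_of_nonneg t.opNorm_nonneg, one_mul]
    refine (mul_le_mul_of_nonneg_left (t.le_opNorm a) (inv_nonneg.2 t.opNorm_nonneg)).trans ?_
    rw [← mul_assoc]
    refine (mul_le_mul_of_nonneg_right (inv_mul_le_one) (norm_nonneg a)).trans (one_mul _).le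
  obtain ⟨T, hT1, hT2⟩ := univDisp_ext U hU B hB A _ ht
  have hext : ∀ a : A, (‖t‖ • P.comp T) (a : B.carrier) = t a := by
    intro a
    change ‖t‖ • P (T a) = t a
    rw [hT1]
    change ‖t‖ • P (j (‖t‖⁻¹ • t a)) = t a
    rw [hj, smul_smul]
    by_cases h : ‖t‖ = 0
    · have h0 := t.le_opNorm a
      rw [h, zero_mul] at h0
      rw [norm_le_zero_iff.1 h0, smul_zero]
    · rw [mul_inv_cancel₀ h, one_smul]
  refine ⟨‖t‖ • P.comp T, hext, le_antisymm ?_ ?_⟩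
  · rw [norm_smul, Real.norm_of_nonneg t.opNorm_nonneg]
    have : ‖P.comp T‖ ≤ 1 :=
      (P.opNorm_comp_le T).trans (mul_le_one₀ hP (norm_nonneg _) hT2)
    exact (mul_le_mul_of_nonneg_left this t.opNorm_nonneg).trans (mul_one _).le
  · refine ContinuousLinearMap.opNorm_le_bound _ (norm_nonneg _) fun a => ?_
    rw [← hext a]
    exact ContinuousLinearMap.le_opNorm _ _

end LocInj


/-- A Banach space is locally `1`-injective iff it is a `1`-complemented subspace of a
Banach space of universal disposition for finite-dimensional spaces. -/
theorem locallyInjective1_iff_oneComplemented_univDispFin (E : BanachSpace.{u}) :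
    IsLocallyInjective1 E ↔
      ∃ U : BanachSpace.{u}, IsUnivDispFin U ∧
        ∃ (j : E.carrier →ₗᵢ[ℝ] U.carrier) (P : U.carrier →L[ℝ] E.carrier),
          ‖P‖ ≤ 1 ∧ ∀ x : E.carrier, P (j x) = x := by
  constructor
  · exact LocInj.forward E
  · rintro ⟨U, hU, j, P, hP, hj⟩
    exact LocInj.backward E U hU j P hP hj
end
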